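/- For every real number a with 0 < a ≤ 1/2, there exist positive constants A(a) and T₀(a) such that for every T ≥ T₀(a), the number of zeros (counted with multiplicity, or equivalently the cardinality of the set of zeros) of s ↦ Q(s,a) lying on the line segment from 1/2 to 1/2 + iT is greater than A(a)·T. -/

import Mathlib

open Complex MeasureTheory

/-- The Hurwitz zeta function `ζ(s, a)`. -/
noncomputable def hzeta (a : ℝ) (s : ℂ) : ℂ := HurwitzZeta.hurwitzZeta (a : UnitAddCircle) s

/-- The periodic (exponential) zeta function `Li(s, a)`. -/
noncomputable def pzeta (a : ℝ) (s : ℂ) : ℂ := HurwitzZeta.expZeta (a : UnitAddCircle) s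

/-- The quadrilateral zeta function `Q(s, a)`, defined by
`2Q(s,a) = ζ(s,a) + ζ(s,1−a) + Li(s,a) + Li(s,1−a)`. -/
noncomputable def Qzeta (s : ℂ) (a : ℝ) : ℂ :=
  (hzeta a s + hzeta (1 - a) s + pzeta a s + pzeta (1 - a) s) / 2


/-- Gaussian double integral bound -/
lemma planch_gauss (g : ℝ → ℂ) (h1 : Integrable g) (h2 : Integrable (fun y => ‖g y‖ ^ 2))
    (ε : ℝ) (hε : 0 < ε) :
    ∫ t : ℝ, ‖∫ y, g y * cexp (I * t * y)‖ ^ 2 * Real.exp (-ε * t ^ 2)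
      ≤ 2 * Real.pi * ∫ y, ‖g y‖ ^ 2 := by
  have hn : ∀ v y : ℝ, ‖cexp (I * v * y)‖ = 1 := by
    intro v y
    rw [show I * (v:ℂ) * y = ((v * y : ℝ) : ℂ) * I by push_cast; ring,
        Complex.norm_exp_ofReal_mul_I]
  set k : ℝ → ℝ := fun d => √(Real.pi / ε) * Real.exp (-(1/(4*ε)) * d ^ 2) with hk
  have hkint : Integrable k := (integrable_exp_neg_mul_sq (by positivity)).const_mul _
  have hkval : ∫ d, k d = 2 * Real.pi := by
    rw [hk, integral_const_mul, integral_gaussian, ← Real.sqrt_mul (by positivity)]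
    rw [show Real.pi / ε * (Real.pi / (1 / (4 * ε))) = (2 * Real.pi) ^ 2 by field_simp; ring]
    exact Real.sqrt_sq (by positivity)
  have hkpos : ∀ d, 0 ≤ k d := fun d => by positivity
  -- integrand in t
  have hgc : Integrable (fun y => (starRingEnd ℂ) (g y)) := by
    have := h1.norm
    refine (integrable_norm_iff ?_).1 (by simpa using this)
    exact Complex.continuous_conj.comp_aestronglyMeasurable h1.aestronglyMeasurable
  have e1 : ∀ t : ℝ, ((‖∫ y, g y * cexp (I * t * y)‖ ^ 2 * Real.exp (-ε * t ^ 2) : ℝ) : ℂ)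
      = ∫ p : ℝ × ℝ, (g p.1 * (starRingEnd ℂ) (g p.2)) *
          (cexp (I * ((p.1 - p.2 : ℝ) : ℂ) * t) * cexp (-(ε:ℂ) * t ^ 2)) := by
    intro t
    have hc : (starRingEnd ℂ) (∫ y, g y * cexp (I * t * y)) =
        ∫ y, (starRingEnd ℂ) (g y) * cexp (-(I * t * y)) := by
      rw [← integral_conj]
      congr 1; ext y
      rw [map_mul, ← Complex.exp_conj]
      congr 2
      simp
    push_cast
    rw [← Complex.mul_conj', hc, ← integral_prod_mul, ← integral_mul_const]
    congr 1; ext p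
    rw [show I * ((p.1:ℂ) - p.2) * t = I * t * p.1 + -(I * t * p.2) by ring,
      Complex.exp_add]
    ring
  have hbig : Integrable (fun q : ℝ × (ℝ × ℝ) => (g q.2.1 * (starRingEnd ℂ) (g q.2.2)) *
          (cexp (I * ((q.2.1 - q.2.2 : ℝ) : ℂ) * q.1) * cexp (-(ε:ℂ) * q.1 ^ 2)))
          (volume.prod (volume.prod volume)) := by
    have hgg : Integrable (fun p : ℝ × ℝ => g p.1 * (starRingEnd ℂ) (g p.2)) (volume.prod volume) :=
      h1.mul_prod hgc
    have he : Integrable (fun t : ℝ => cexp (-(ε:ℂ) * t ^ 2)) :=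
      integrable_cexp_neg_mul_sq (by simpa using hε)
    have hp := he.mul_prod hgg
    refine hp.mono ?_ (Filter.Eventually.of_forall fun q => ?_)
    · exact (hgg.aestronglyMeasurable.comp_snd).mul (by fun_prop)
    · simp only [norm_mul]
      rw [hn, one_mul, mul_comm]
  have e2 : ((∫ t : ℝ, ‖∫ y, g y * cexp (I * t * y)‖ ^ 2 * Real.exp (-ε * t ^ 2) : ℝ) : ℂ)
      = ∫ p : ℝ × ℝ, (g p.1 * (starRingEnd ℂ) (g p.2)) * (k (p.1 - p.2) : ℂ) := by
    rw [← integral_complex_ofReal]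
    simp_rw [e1]
    rw [integral_integral_swap (μ := volume) (ν := (volume : Measure (ℝ × ℝ))) hbig]
    congr 1; ext p
    rw [integral_const_mul, fourierIntegral_gaussian (by simpa using hε)]
    congr 1
    simp only [hk]
    push_cast
    congr 1
    · rw [← Complex.ofReal_div, Real.sqrt_eq_rpow, Complex.ofReal_cpow (by positivity)]
      norm_num
    · congr 1
      field_simp
  have hA : Integrable (fun p : ℝ × ℝ => ‖g p.2‖ ^ 2 * k (p.1 - p.2)) (volume.prod volume) :=
    Integrable.convolution_integrand (ContinuousLinearMap.mul ℝ ℝ) h2 hkint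
  have hB : Integrable (fun p : ℝ × ℝ => ‖g p.1‖ ^ 2 * k (p.1 - p.2)) (volume.prod volume) := by
    have := hA.swap
    refine this.congr (Filter.Eventually.of_forall fun p => ?_)
    simp only [Function.comp, Prod.fst_swap, Prod.snd_swap, hk]
    rw [← neg_sub, neg_sq]
  have iA : ∫ p : ℝ × ℝ, ‖g p.2‖ ^ 2 * k (p.1 - p.2) = 2 * Real.pi * ∫ y, ‖g y‖ ^ 2 := by
    rw [Measure.volume_eq_prod, integral_prod_symm _ hA]
    simp only [integral_const_mul, integral_sub_right_eq_self k, hkval]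
    rw [integral_mul_const, mul_comm]
  have iB : ∫ p : ℝ × ℝ, ‖g p.1‖ ^ 2 * k (p.1 - p.2) = 2 * Real.pi * ∫ y, ‖g y‖ ^ 2 := by
    rw [Measure.volume_eq_prod, integral_prod _ hB]
    simp only [integral_const_mul, integral_sub_left_eq_self k, hkval]
    rw [integral_mul_const, mul_comm]
  have hnn : 0 ≤ ∫ t : ℝ, ‖∫ y, g y * cexp (I * t * y)‖ ^ 2 * Real.exp (-ε * t ^ 2) :=
    integral_nonneg fun t => by positivity
  calc _ = ‖((∫ t : ℝ, ‖∫ y, g y * cexp (I * t * y)‖ ^ 2 * Real.exp (-ε * t ^ 2) : ℝ) : ℂ)‖ := by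
        rw [Complex.norm_real, Real.norm_of_nonneg hnn]
    _ ≤ ∫ p : ℝ × ℝ, (1/2) * (‖g p.2‖ ^ 2 * k (p.1 - p.2)) + (1/2) * (‖g p.1‖ ^ 2 * k (p.1 - p.2)) := by
        rw [e2]
        refine norm_integral_le_of_norm_le ((hA.const_mul _).add (hB.const_mul _)) ?_
        refine Filter.Eventually.of_forall fun p => ?_
        simp only [norm_mul, RCLike.norm_conj, Complex.norm_real, Real.norm_of_nonneg (hkpos _)]
        nlinarith [hkpos (p.1 - p.2), mul_nonneg (sq_nonneg (‖g p.1‖ - ‖g p.2‖)) (hkpos (p.1 - p.2))]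
    _ = _ := by
        rw [Measure.volume_eq_prod] at iA iB ⊢
        rw [integral_add (hA.const_mul _) (hB.const_mul _), integral_const_mul, integral_const_mul,
          iA, iB]
        ring

lemma planch (g : ℝ → ℂ) (h1 : Integrable g) (h2 : Integrable (fun y => ‖g y‖ ^ 2)) (A B : ℝ)
    (hAB : A ≤ B) :
    ∫ t in A..B, ‖∫ y, g y * cexp (I * t * y)‖ ^ 2 ≤ 2 * Real.pi * ∫ y, ‖g y‖ ^ 2 := by
  have hcont : Continuous (fun t : ℝ => ∫ y, g y * cexp (I * t * y)) := by
    apply continuous_of_dominated (bound := fun y => ‖g y‖)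
    · intro t
      exact h1.aestronglyMeasurable.mul (by fun_prop)
    · intro t
      refine Filter.Eventually.of_forall fun y => ?_
      rw [norm_mul, show I * (t:ℂ) * y = ((t * y : ℝ) : ℂ) * I by push_cast; ring,
        Complex.norm_exp_ofReal_mul_I, mul_one]
    · exact h1.norm
    · refine Filter.Eventually.of_forall fun y => ?_
      fun_prop
  have hbd : ∀ t : ℝ, ‖∫ y, g y * cexp (I * t * y)‖ ≤ ∫ y, ‖g y‖ := by
    intro t
    refine (norm_integral_le_integral_norm _).trans (le_of_eq ?_)
    congr 1; ext y
    rw [norm_mul, show I * (t:ℂ) * y = ((t * y : ℝ) : ℂ) * I by push_cast; ring,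
        Complex.norm_exp_ofReal_mul_I, mul_one]
  set G : ℝ → ℂ := fun t => ∫ y, g y * cexp (I * t * y) with hG
  set R := 2 * Real.pi * ∫ y, ‖g y‖ ^ 2 with hR
  have key : ∀ ε : ℝ, 0 < ε → Real.exp (-ε * (|A| + |B|) ^ 2) * ∫ t in A..B, ‖G t‖ ^ 2 ≤ R := by
    intro ε hε
    refine le_trans ?_ (planch_gauss g h1 h2 ε hε)
    rw [← intervalIntegral.integral_const_mul, intervalIntegral.integral_of_le hAB]
    have hint : Integrable (fun t : ℝ => ‖G t‖ ^ 2 * Real.exp (-ε * t ^ 2)) := by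
      refine (integrable_exp_neg_mul_sq hε).bdd_mul (c := (∫ y, ‖g y‖) ^ 2)
        (by fun_prop) ?_
      refine Filter.Eventually.of_forall fun t => ?_
      rw [Real.norm_of_nonneg (by positivity)]
      exact pow_le_pow_left₀ (norm_nonneg _) (hbd t) 2
    calc ∫ t in Set.Ioc A B, Real.exp (-ε * (|A| + |B|) ^ 2) * ‖G t‖ ^ 2
        ≤ ∫ t in Set.Ioc A B, ‖G t‖ ^ 2 * Real.exp (-ε * t ^ 2) := by
          apply setIntegral_mono_on
          · exact (Continuous.integrableOn_Icc (by fun_prop)).mono_set Set.Ioc_subset_Icc_self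
          · exact hint.integrableOn
          · exact measurableSet_Ioc
          · intro t ht
            rw [mul_comm]
            gcongr ?_ * ?_
            apply Real.exp_le_exp.2
            have : t ^ 2 ≤ (|A| + |B|) ^ 2 := by
              rw [sq_le_sq, abs_of_nonneg (by positivity : 0 ≤ |A| + |B|), abs_le]
              constructor
              · linarith [neg_abs_le A, ht.1, abs_nonneg B]
              · linarith [le_abs_self B, ht.2, abs_nonneg A]
            nlinarith
      _ ≤ _ := setIntegral_le_integral hint (Filter.Eventually.of_forall fun t => by positivity)
  have hlim : Filter.Tendsto (fun ε : ℝ => Real.exp (-ε * (|A| + |B|) ^ 2) * ∫ t in A..B, ‖G t‖ ^ 2)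
      (nhdsWithin 0 (Set.Ioi 0)) (nhds (∫ t in A..B, ‖G t‖ ^ 2)) := by
    have : Continuous (fun ε : ℝ => Real.exp (-ε * (|A| + |B|) ^ 2) * ∫ t in A..B, ‖G t‖ ^ 2) := by
      fun_prop
    have h := (this.tendsto 0).mono_left (nhdsWithin_le_nhds (s := Set.Ioi 0))
    simpa using h
  exact le_of_tendsto hlim (Filter.eventually_of_mem self_mem_nhdsWithin fun ε hε => key ε hε)

noncomputable def mulH (H y : ℝ) : ℂ := ∫ v in (0:ℝ)..H, cexp (I * v * y)

lemma continuous_mulH (H : ℝ) : Continuous (mulH H) := by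
  unfold mulH
  apply intervalIntegral.continuous_parametric_intervalIntegral_of_continuous'
  fun_prop

lemma norm_exp_Ivy (v y : ℝ) : ‖cexp (I * v * y)‖ = 1 := by
  rw [show I * (v:ℂ) * y = ((v * y : ℝ) : ℂ) * I by push_cast; ring,
        Complex.norm_exp_ofReal_mul_I]

lemma norm_mulH_le (H y : ℝ) (hH : 0 ≤ H) : ‖mulH H y‖ ≤ H := by
  unfold mulH
  have := intervalIntegral.norm_integral_le_of_norm_le_const (a := 0) (b := H) (C := 1)
    (f := fun v : ℝ => cexp (I * v * y)) (fun v _ => (norm_exp_Ivy v y).le)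
  simpa [abs_of_nonneg hH] using this

lemma norm_mulH_le' (H y : ℝ) (hy : y ≠ 0) : ‖mulH H y‖ ≤ 2 / |y| := by
  unfold mulH
  have hc : (I * y : ℂ) ≠ 0 := by simp [hy]
  have : (∫ v in (0:ℝ)..H, cexp (I * v * y)) = (cexp (I * H * y) - 1) / (I * y) := by
    have h := integral_exp_mul_complex (a := 0) (b := H) hc
    simp only [Complex.ofReal_zero, mul_zero, Complex.exp_zero] at h
    rw [show I * (H:ℂ) * y = I * y * H by ring, ← h]
    congr 1; ext v; ring_nf
  rw [this, norm_div, norm_mul, norm_I, one_mul, Complex.norm_real, Real.norm_eq_abs]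
  gcongr
  refine (norm_sub_le _ _).trans ?_
  rw [norm_exp_Ivy]; norm_num

lemma planchH (f : ℝ → ℂ) (h1 : Integrable f) (h2 : Integrable (fun y => ‖f y‖ ^ 2)) (A B : ℝ)
    (hAB : A ≤ B) (H : ℝ) (hH : 0 ≤ H) :
    ∫ t in A..B, ‖∫ v in t..t + H, ∫ y, f y * cexp (I * v * y)‖ ^ 2
      ≤ 2 * Real.pi * ∫ y, ‖f y‖ ^ 2 * ‖mulH H y‖ ^ 2 := by
  have e1 : ∀ t : ℝ, (∫ v in t..t + H, ∫ y, f y * cexp (I * v * y))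
      = ∫ y, (f y * mulH H y) * cexp (I * t * y) := by
    intro t
    rw [intervalIntegral.integral_of_le (by linarith), integral_integral_swap]
    · congr 1; ext y
      rw [integral_const_mul, mul_assoc]
      congr 1
      rw [mulH, ← intervalIntegral.integral_of_le (by linarith), ← intervalIntegral.integral_mul_const]
      have := intervalIntegral.integral_comp_add_right (a := 0) (b := H)
        (fun v : ℝ => cexp (I * v * y)) t
      rw [zero_add, add_comm H t] at this
      rw [← this]
      congr 1; ext v
      rw [← Complex.exp_add]; push_cast; ring_nf
    · have hh : Integrable (fun p : ℝ × ℝ => f p.2) ((volume.restrict (Set.Ioc t (t+H))).prod volume) :=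
        h1.comp_snd _
      refine Integrable.mono hh (hh.aestronglyMeasurable.mul (by fun_prop)) ?_
      refine Filter.Eventually.of_forall fun p => ?_
      simp only [Function.uncurry]
      rw [norm_mul, norm_exp_Ivy, mul_one]
  simp_rw [e1]
  have h := planch (fun y => f y * mulH H y)
    (h1.mul_bdd (c := H) (continuous_mulH H).aestronglyMeasurable
      (Filter.Eventually.of_forall fun y => norm_mulH_le H y hH)) ?_ A B hAB
  · simpa only [norm_mul, mul_pow] using h
  · simp only [norm_mul, mul_pow]
    refine h2.mul_bdd (c := H ^ 2) (((continuous_mulH H).norm.pow 2).aestronglyMeasurable)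
      (Filter.Eventually.of_forall fun y => ?_)
    rw [Real.norm_of_nonneg (by positivity)]
    exact pow_le_pow_left₀ (norm_nonneg _) (norm_mulH_le H y hH) 2


lemma sum_inv_sq_le (K : ℕ) : ∑ k ∈ Finset.range K, (1:ℝ) / ((k:ℝ) + 1) ^ 2 ≤ 2 - 1 / (K:ℝ) := by
  induction K with
  | zero => norm_num
  | succ n ih =>
    rw [Finset.sum_range_succ]
    push_cast
    rcases Nat.eq_zero_or_pos n with h0 | h0
    · subst h0; norm_num
    · have hn : (0:ℝ) < n := by exact_mod_cast h0
      have : (1:ℝ) / ((n:ℝ) + 1) ^ 2 ≤ 1 / (n:ℝ) - 1 / ((n:ℝ) + 1) := by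
        rw [div_sub_div _ _ hn.ne' (by positivity), div_le_div_iff₀ (by positivity) (by positivity)]
        nlinarith
      linarith

lemma weight_half (g : ℝ → ℝ) (hg : ∀ y, 0 ≤ g y) (hint : Integrable g) (H L M₀ M : ℝ)
    (hH : 0 ≤ H) (hL : 0 < L) (hM : 0 ≤ M)
    (h0 : ∫ y in (0:ℝ)..L, g y ≤ M₀)
    (hk : ∀ k : ℕ, ∫ y in ((k:ℝ) + 1) * L..((k:ℝ) + 2) * L, g y ≤ M) (m : ℝ → ℝ) (hmc : Continuous m)
    (hm0 : ∀ y, 0 ≤ m y) (hm1 : ∀ y, m y ≤ H ^ 2) (hm2 : ∀ y, 0 < y → m y ≤ 4 / y ^ 2) :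
    ∫ y in Set.Ioi 0, g y * m y ≤ H ^ 2 * M₀ + 8 / L ^ 2 * M := by
  have hgm : Integrable (fun y => g y * m y) := by
    refine hint.mul_bdd (c := H ^ 2) hmc.aestronglyMeasurable (Filter.Eventually.of_forall fun y => ?_)
    rw [Real.norm_of_nonneg (hm0 y)]; exact hm1 y
  have hlim := intervalIntegral_tendsto_integral_Ioi (μ := volume) (f := fun y => g y * m y) 0 hgm.integrableOn
    (l := Filter.atTop) (b := fun K : ℕ => ((K:ℝ) + 1) * L)
    (Filter.Tendsto.atTop_mul_const hL (Filter.tendsto_atTop_add_const_right _ _ tendsto_natCast_atTop_atTop))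
  refine le_of_tendsto hlim (Filter.Eventually.of_forall fun K => ?_)
  have hii : ∀ a b, IntervalIntegrable (fun y => g y * m y) volume a b := fun a b => hgm.intervalIntegrable
  have hig : ∀ a b, IntervalIntegrable g volume a b := fun a b => hint.intervalIntegrable
  have key : ∀ K : ℕ, ∫ y in (0:ℝ)..((K:ℝ) + 1) * L, g y * m y ≤
      H ^ 2 * M₀ + 4 / L ^ 2 * M * ∑ k ∈ Finset.range K, (1:ℝ) / ((k:ℝ) + 1) ^ 2 := by
    intro K
    induction K with
    | zero =>
      simp only [Nat.cast_zero, zero_add, one_mul, Finset.range_zero, Finset.sum_empty, mul_zero, add_zero]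
      calc ∫ y in (0:ℝ)..L, g y * m y ≤ ∫ y in (0:ℝ)..L, H ^ 2 * g y := by
            apply intervalIntegral.integral_mono_on hL.le (hii _ _) ((hig _ _).const_mul _)
            intro y _
            rw [mul_comm]; exact mul_le_mul_of_nonneg_right (hm1 y) (hg y)
        _ ≤ _ := by
            rw [intervalIntegral.integral_const_mul]
            gcongr
    | succ n ih =>
      rw [← intervalIntegral.integral_add_adjacent_intervals (hii 0 (((n:ℝ) + 1) * L)) (hii _ _),
        Finset.sum_range_succ, mul_add, ← add_assoc]
      refine add_le_add ih ?_
      push_cast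
      have e : ((n:ℝ) + 1 + 1) * L = ((n:ℝ) + 2) * L := by ring
      rw [e]
      have hpos : 0 < ((n:ℝ) + 1) * L := by positivity
      calc ∫ y in ((n:ℝ) + 1) * L..((n:ℝ) + 2) * L, g y * m y
          ≤ ∫ y in ((n:ℝ) + 1) * L..((n:ℝ) + 2) * L, (4 / (((n:ℝ) + 1) * L) ^ 2) * g y := by
            apply intervalIntegral.integral_mono_on (by nlinarith) (hii _ _) ((hig _ _).const_mul _)
            intro y hy
            rw [mul_comm]
            refine mul_le_mul_of_nonneg_right ((hm2 y (hpos.trans_le hy.1)).trans ?_) (hg y)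
            gcongr
            exact hy.1
        _ ≤ (4 / (((n:ℝ) + 1) * L) ^ 2) * M := by
            rw [intervalIntegral.integral_const_mul]
            gcongr
            exact hk n
        _ = _ := by field_simp
  refine (key K).trans ?_
  have h1 := sum_inv_sq_le K
  have h2 : ∑ k ∈ Finset.range K, (1:ℝ) / ((k:ℝ) + 1) ^ 2 ≤ 2 := h1.trans (by
    have : (0:ℝ) ≤ 1 / (K:ℝ) := by positivity
    linarith)
  have h3 : 4 / L ^ 2 * M * ∑ k ∈ Finset.range K, (1:ℝ) / ((k:ℝ) + 1) ^ 2 ≤ 4 / L ^ 2 * M * 2 := by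
    gcongr
  calc _ ≤ H ^ 2 * M₀ + 4 / L ^ 2 * M * 2 := by linarith
    _ = _ := by ring

/-- Master mean square bound. -/
lemma planchW (f : ℝ → ℂ) (h1 : Integrable f) (h2 : Integrable (fun y => ‖f y‖ ^ 2)) (A B : ℝ)
    (hAB : A ≤ B) (H L M₀ M : ℝ) (hH : 0 ≤ H) (hL : 0 < L) (hM : 0 ≤ M)
    (h0 : ∫ y in (0:ℝ)..L, ‖f y‖ ^ 2 ≤ M₀)
    (hk : ∀ k : ℕ, ∫ y in ((k:ℝ) + 1) * L..((k:ℝ) + 2) * L, ‖f y‖ ^ 2 ≤ M)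
    (h0' : ∫ y in (0:ℝ)..L, ‖f (-y)‖ ^ 2 ≤ M₀)
    (hk' : ∀ k : ℕ, ∫ y in ((k:ℝ) + 1) * L..((k:ℝ) + 2) * L, ‖f (-y)‖ ^ 2 ≤ M) :
    ∫ t in A..B, ‖∫ v in t..t + H, ∫ y, f y * cexp (I * v * y)‖ ^ 2
      ≤ 4 * Real.pi * (H ^ 2 * M₀ + 8 / L ^ 2 * M) := by
  refine (planchH f h1 h2 A B hAB H hH).trans ?_
  have hmc : Continuous (fun y => ‖mulH H y‖ ^ 2) := (continuous_mulH H).norm.pow 2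
  have hm1 : ∀ y, ‖mulH H y‖ ^ 2 ≤ H ^ 2 := fun y =>
    pow_le_pow_left₀ (norm_nonneg _) (norm_mulH_le H y hH) 2
  have hm2 : ∀ y, y ≠ 0 → ‖mulH H y‖ ^ 2 ≤ 4 / y ^ 2 := fun y hy => by
    refine (pow_le_pow_left₀ (norm_nonneg _) (norm_mulH_le' H y hy) 2).trans (le_of_eq ?_)
    rw [div_pow, sq_abs]; norm_num
  have hgm : Integrable (fun y => ‖f y‖ ^ 2 * ‖mulH H y‖ ^ 2) := by
    refine h2.mul_bdd (c := H ^ 2) hmc.aestronglyMeasurable (Filter.Eventually.of_forall fun y => ?_)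
    rw [Real.norm_of_nonneg (by positivity)]; exact hm1 y
  have hR := weight_half (fun y => ‖f y‖ ^ 2) (fun y => by positivity) h2 H L M₀ M hH hL hM h0 hk
    (fun y => ‖mulH H y‖ ^ 2) hmc (fun y => by positivity) hm1 (fun y hy => hm2 y hy.ne')
  have hLf := weight_half (fun y => ‖f (-y)‖ ^ 2) (fun y => by positivity) h2.comp_neg H L M₀ M hH hL hM h0' hk'
    (fun y => ‖mulH H (-y)‖ ^ 2) (hmc.comp continuous_neg) (fun y => by positivity) (fun y => hm1 _)
    (fun y hy => by simpa using hm2 (-y) (by simpa using hy.ne'))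
  have e : ∫ y, ‖f y‖ ^ 2 * ‖mulH H y‖ ^ 2 = (∫ y in Set.Ioi 0, ‖f (-y)‖ ^ 2 * ‖mulH H (-y)‖ ^ 2) +
      ∫ y in Set.Ioi 0, ‖f y‖ ^ 2 * ‖mulH H y‖ ^ 2 := by
    rw [integral_comp_neg_Ioi (f := fun y => ‖f y‖ ^ 2 * ‖mulH H y‖ ^ 2), neg_zero,
      intervalIntegral.integral_Iic_add_Ioi hgm.integrableOn hgm.integrableOn]
  rw [e]
  have hpi := Real.pi_pos

  nlinarith


lemma hasMellin_cpow_Ioi1 (a : ℂ) {s : ℂ} (hs : s.re + a.re < 0) :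
    HasMellin (Set.indicator (Set.Ioi 1) (fun t => ↑t ^ a : ℝ → ℂ)) s (-1 / (s + a)) := by
  have h1 : (s + a - 1).re < -1 := by simp; linarith
  have e : ∀ t ∈ Set.Ioi (0:ℝ), ((t:ℂ) ^ (s - 1)) • (Set.indicator (Set.Ioi 1) (fun t => ↑t ^ a : ℝ → ℂ)) t
      = Set.indicator (Set.Ioi 1) (fun t => ↑t ^ (s + a - 1) : ℝ → ℂ) t := by
    intro t ht
    by_cases h : t ∈ Set.Ioi (1:ℝ)
    · rw [Set.indicator_of_mem h, Set.indicator_of_mem h, smul_eq_mul, ← Complex.cpow_add]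
      · congr 1; ring
      · exact_mod_cast (Set.mem_Ioi.1 ht).ne'
    · rw [Set.indicator_of_notMem h, Set.indicator_of_notMem h, smul_zero]
  have hint := integrableOn_Ioi_cpow_of_lt h1 zero_lt_one
  constructor
  · rw [MellinConvergent, integrableOn_congr_fun e measurableSet_Ioi]
    exact ((integrable_indicator_iff measurableSet_Ioi).2 hint).integrableOn
  · rw [mellin, setIntegral_congr_fun measurableSet_Ioi e, setIntegral_indicator measurableSet_Ioi]
    rw [show Set.Ioi (0:ℝ) ∩ Set.Ioi 1 = Set.Ioi 1 from Set.inter_eq_self_of_subset_right (Set.Ioi_subset_Ioi zero_le_one)]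
    rw [integral_Ioi_cpow_of_lt h1 zero_lt_one]
    simp

lemma U_preconn : IsPreconnected ({z : ℂ | 0 < z.im ∧ 0 < z.re} ∪ {z : ℂ | 1 / 2 < z.re}) := by
  have c1 : Convex ℝ {z : ℂ | 0 < z.im ∧ 0 < z.re} := by
    have := (convex_halfSpace_im_gt 0).inter (convex_halfSpace_re_gt 0)
    exact this
  have c2 : Convex ℝ {z : ℂ | 1 / 2 < z.re} := convex_halfSpace_re_gt _
  refine c1.isPreconnected.union' ?_ c2.isPreconnected
  refine ⟨1 + I, ?_, ?_⟩ <;> norm_num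

lemma U_open : IsOpen ({z : ℂ | 0 < z.im ∧ 0 < z.re} ∪ {z : ℂ | 1 / 2 < z.re}) := by
  refine IsOpen.union (IsOpen.inter ?_ ?_) ?_
  · exact isOpen_lt continuous_const Complex.continuous_im
  · exact isOpen_lt continuous_const Complex.continuous_re
  · exact isOpen_lt continuous_const Complex.continuous_re

lemma locint_cpow (c a : ℂ) : LocallyIntegrableOn (fun x : ℝ => c * (x:ℂ) ^ a) (Set.Ioi 0) := by
  refine ContinuousOn.locallyIntegrableOn (fun t ht ↦ ?_) measurableSet_Ioi
  exact (continuousAt_const.mul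
    (Complex.continuousAt_ofReal_cpow_const _ _ (Or.inr (ne_of_gt ht)))).continuousWithinAt

lemma cont_mellin (f : ℝ → ℂ) (c : ℂ) (F : ℂ → ℂ)
    (hloc : LocallyIntegrableOn f (Set.Ioi 0))
    (hinf : ∀ R : ℝ, f =O[Filter.atTop] (fun x : ℝ => x ^ (-R)))
    (h0 : (fun x : ℝ => f x - c * (x:ℂ) ^ (-(1/2) : ℂ)) =O[nhdsWithin 0 (Set.Ioi 0)]
      (fun _ : ℝ => (1:ℝ)))
    (hF : ∀ z, (0 < z.im ∧ 0 < z.re) ∨ 1/2 < z.re → DifferentiableAt ℂ F z)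
    (hFm : ∀ z, 1/2 < z.re → F z = mellin f z)
    (z : ℂ) (hz0 : 0 < z.re) (hz1 : z.re < 1/2) (hzi : 0 < z.im) :
    HasMellin (fun x : ℝ => f x - c * (x:ℂ) ^ (-(1/2) : ℂ)) z (F z) := by
  set g : ℝ → ℂ := Set.indicator (Set.Ioc 0 1) (fun t : ℝ => (t:ℂ) ^ (-(1/2) : ℂ)) with hg
  set h : ℝ → ℂ := Set.indicator (Set.Ioi 1) (fun t : ℝ => (t:ℂ) ^ (-(1/2) : ℂ)) with hh
  set f' : ℝ → ℂ := fun x => f x - c • g x with hf'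
  have hre : (-(1/2) : ℂ).re = -(1/2) := by norm_num
  have hgM : ∀ w : ℂ, 1/2 < w.re → HasMellin g w (1 / (w + -(1/2))) := fun w hw =>
    hasMellin_cpow_Ioc _ (by rw [hre]; linarith)
  have hhM : ∀ w : ℂ, w.re < 1/2 → HasMellin h w (-1 / (w + -(1/2))) := fun w hw =>
    hasMellin_cpow_Ioi1 _ (by rw [hre]; linarith)
  have hgloc : LocallyIntegrableOn g (Set.Ioi 0) := by
    have h1 := locint_cpow 1 (-(1/2))
    simp only [one_mul] at h1
    intro x hx
    obtain ⟨s, hs, hi⟩ := h1 x hx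
    exact ⟨s, hs, hi.indicator measurableSet_Ioc⟩
  have hf'loc : LocallyIntegrableOn f' (Set.Ioi 0) := by
    have : LocallyIntegrableOn (fun x => c • g x) (Set.Ioi 0) := by
      intro x hx
      obtain ⟨s, hs, hi⟩ := hgloc x hx
      exact ⟨s, hs, hi.smul c⟩
    exact hloc.sub this
  have hf'top : ∀ R : ℝ, f' =O[Filter.atTop] (fun x : ℝ => x ^ (-R)) := by
    intro R
    refine (hinf R).congr' ?_ Filter.EventuallyEq.rfl
    filter_upwards [Filter.eventually_gt_atTop (1:ℝ)] with x hx
    simp only [hf', hg]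
    rw [Set.indicator_of_notMem (by simp; intro _; linarith)]
    simp
  have hf'bot : f' =O[nhdsWithin 0 (Set.Ioi 0)] (fun x : ℝ => x ^ (-(0:ℝ))) := by
    refine h0.congr' ?_ ?_
    · filter_upwards [Ioc_mem_nhdsGT (zero_lt_one (α := ℝ))] with x hx
      simp only [hf', hg]
      rw [Set.indicator_of_mem hx]
      simp
    · exact Filter.Eventually.of_forall fun x => by simp
  have hf'M : ∀ w : ℂ, 0 < w.re → MellinConvergent f' w := fun w hw =>
    mellinConvergent_of_isBigO_rpow hf'loc (hf'top (w.re + 1)) (by linarith) hf'bot hw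
  have hf'D : ∀ w : ℂ, 0 < w.re → DifferentiableAt ℂ (mellin f') w := fun w hw =>
    mellin_differentiableAt_of_isBigO_rpow hf'loc (hf'top (w.re + 1)) (by linarith) hf'bot hw
  set U := ({z : ℂ | 0 < z.im ∧ 0 < z.re} ∪ {z : ℂ | 1 / 2 < z.re}) with hU
  have hne : ∀ w ∈ U, w + -(1/2) ≠ 0 := by
    rintro w hw h0
    have hw' : w = 1/2 := by linear_combination h0
    rw [hw'] at hw
    rcases hw with hw | hw
    · have := hw.1; norm_num at this
    · have : 1/2 < (1/2 : ℂ).re := hw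
      norm_num at this
  have hpos : ∀ w ∈ U, 0 < w.re := by
    rintro w (hw | hw)
    · exact hw.2
    · have : 1/2 < w.re := hw
      linarith
  have hEq : Set.EqOn F (fun w => mellin f' w + c * (1 / (w + -(1/2)))) U := by
    refine AnalyticOnNhd.eqOn_of_preconnected_of_eventuallyEq (𝕜 := ℂ) ?_ ?_ U_preconn (z₀ := 1)
      (Or.inr (by norm_num)) ?_
    · refine DifferentiableOn.analyticOnNhd (fun w hw => (hF w hw).differentiableWithinAt) U_open
    · refine DifferentiableOn.analyticOnNhd (fun w hw => DifferentiableAt.differentiableWithinAt ?_) U_open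
      refine (hf'D w (hpos w hw)).add (DifferentiableAt.const_mul ?_ c)
      exact (differentiableAt_const _).div (by fun_prop) (hne w hw)
    · have ho : IsOpen {z : ℂ | 1 / 2 < z.re} := isOpen_lt continuous_const Complex.continuous_re
      filter_upwards [ho.mem_nhds (show (1:ℂ) ∈ {z : ℂ | 1 / 2 < z.re} by norm_num)] with w hw
      have hw' : 1/2 < w.re := hw
      rw [hFm w hw]
      have h1 := hasMellin_add (hf'M w (by linarith)) ((hgM w hw').1.const_smul c)
      have h2 : (fun t => f' t + c • g t) = f := by ext t; simp [hf']
      rw [h2] at h1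
      rw [h1.2, mellin_const_smul, (hgM w hw').2]; rfl
  have hzU : z ∈ U := Or.inl ⟨hzi, hz0⟩
  have h1 := hasMellin_sub (hf'M z hz0) ((hhM z hz1).1.const_smul c)
  rw [mellin_const_smul, (hhM z hz1).2] at h1
  have e : Set.EqOn (fun t => f' t - c • h t) (fun x : ℝ => f x - c * (x:ℂ) ^ (-(1/2) : ℂ)) (Set.Ioi 0) := by
    intro t ht
    simp only [hf', hg, hh]
    have ht0 : (0:ℝ) < t := ht
    by_cases h1 : t ≤ 1
    · rw [Set.indicator_of_mem (Set.mem_Ioc.2 ⟨ht0, h1⟩), Set.indicator_of_notMem (by simpa using h1)]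
      simp
    · rw [Set.indicator_of_notMem (by simp; intro _; linarith), Set.indicator_of_mem (by simpa using h1)]
      simp
  have e' : Set.EqOn (fun t : ℝ => (t:ℂ) ^ (z - 1) • (f' t - c • h t))
     (fun t : ℝ => (t:ℂ) ^ (z - 1) • (f t - c * (t:ℂ) ^ (-(1/2) : ℂ))) (Set.Ioi 0) := by
    intro t ht
    have := e ht
    simp only at this ⊢
    rw [this]
  constructor
  · have h2 := h1.1
    rw [MellinConvergent, integrableOn_congr_fun e' measurableSet_Ioi] at h2
    exact h2
  · have h2 := h1.2
    rw [mellin, setIntegral_congr_fun measurableSet_Ioi e'] at h2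
    rw [mellin, h2, hEq hzU]
    simp only [smul_eq_mul]
    ring

lemma exp_form_aux (g : ℝ → ℂ) (z : ℂ) (y : ℝ) :
    |Real.exp y| • (((Real.exp y : ℝ) : ℂ) ^ (z - 1) • g (Real.exp y)) = g (Real.exp y) * cexp (z * y) := by
  rw [abs_of_pos (Real.exp_pos y), Complex.real_smul, smul_eq_mul,
    Complex.cpow_def_of_ne_zero (by exact_mod_cast (Real.exp_pos y).ne'),
    ← Complex.ofReal_log (Real.exp_pos y).le, Real.log_exp, ← mul_assoc, Complex.ofReal_exp,
    ← Complex.exp_add, mul_comm]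
  congr 2; ring

/-- log variable -/
lemma mellin_exp_form (g : ℝ → ℂ) (z : ℂ) :
    mellin g z = ∫ y : ℝ, g (Real.exp y) * cexp (z * y) := by
  have him : Real.exp '' Set.univ = Set.Ioi 0 := by rw [Set.image_univ, Real.range_exp]
  rw [mellin, ← him, integral_image_eq_integral_abs_deriv_smul MeasurableSet.univ
    (fun x _ => (Real.hasDerivAt_exp x).hasDerivWithinAt) Real.exp_injective.injOn]
  rw [setIntegral_univ]
  congr 1; ext y
  exact exp_form_aux g z y

lemma mellinConvergent_exp_form (g : ℝ → ℂ) (z : ℂ) (h : MellinConvergent g z) :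
    Integrable (fun y : ℝ => g (Real.exp y) * cexp (z * y)) := by
  have him : Real.exp '' Set.univ = Set.Ioi 0 := by rw [Set.image_univ, Real.range_exp]
  rw [MellinConvergent, ← him, integrableOn_image_iff_integrableOn_abs_deriv_smul MeasurableSet.univ
    (fun x _ => (Real.hasDerivAt_exp x).hasDerivWithinAt) Real.exp_injective.injOn, integrableOn_univ] at h
  refine h.congr (Filter.Eventually.of_forall fun y => ?_)
  exact exp_form_aux g z y


lemma mellin_termwise {ι : Type} [Countable ι] (φ : ℝ → ℂ) (z : ℂ) (hφ : MellinConvergent φ z)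
    (c : ι → ℂ) (lam : ι → ℝ) (hlam : ∀ n, 0 < lam n)
    (hs : Summable fun n => ‖c n‖ * (lam n) ^ (-2 * z.re)) (S : ℂ)
    (hS : HasSum (fun n => c n * (lam n : ℂ) ^ (-(2 * z))) S) :
    mellin (fun x => ∑' n, c n * φ ((lam n) ^ 2 * x)) z = mellin φ z * S := by
  have hl2 : ∀ n, 0 < lam n ^ 2 := fun n => pow_pos (hlam n) 2
  have hconv : ∀ n, MellinConvergent (fun x => φ ((lam n) ^ 2 * x)) z := fun n =>
    (MellinConvergent.comp_mul_left (hl2 n)).2 hφ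
  have hconv' : ∀ n, MellinConvergent (fun x => c n * φ ((lam n) ^ 2 * x)) z := fun n =>
    (hconv n).const_smul (c n)
  have hnorm : ∀ n, ∫ x in Set.Ioi (0:ℝ), ‖(x:ℂ) ^ (z - 1) • (c n * φ ((lam n) ^ 2 * x))‖
      = (∫ x in Set.Ioi (0:ℝ), ‖(x:ℂ) ^ (z - 1) • φ x‖) * (‖c n‖ * (lam n) ^ (-2 * z.re)) := by
    intro n
    have h1 := integral_comp_mul_left_Ioi (fun x : ℝ => ‖(x:ℂ) ^ (z - 1) • φ x‖) 0 (hl2 n)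
    rw [mul_zero] at h1
    have h2 : ∀ x ∈ Set.Ioi (0:ℝ), ‖(x:ℂ) ^ (z - 1) • (c n * φ ((lam n) ^ 2 * x))‖ =
        (‖c n‖ * (lam n ^ 2) ^ (-(z.re - 1))) * ‖((lam n ^ 2 * x : ℝ):ℂ) ^ (z - 1) • φ (lam n ^ 2 * x)‖ := by
      intro x hx
      have hx' : (0:ℝ) < x := hx
      simp only [norm_smul, norm_mul]
      rw [Complex.norm_cpow_eq_rpow_re_of_pos hx', Complex.norm_cpow_eq_rpow_re_of_pos (mul_pos (hl2 n) hx'),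
        Real.mul_rpow (hl2 n).le hx'.le, Real.rpow_neg (hl2 n).le]
      have : (lam n ^ 2) ^ (z.re - 1) ≠ 0 := (Real.rpow_pos_of_pos (hl2 n) _).ne'
      simp only [sub_re, one_re]
      field_simp
    rw [setIntegral_congr_fun measurableSet_Ioi h2, integral_const_mul, h1, smul_eq_mul]
    have h3 : (lam n ^ 2) ^ (-(z.re - 1)) * (lam n ^ 2)⁻¹ = (lam n) ^ (-2 * z.re) := by
      rw [← Real.rpow_natCast, ← Real.rpow_neg (hlam n).le, ← Real.rpow_mul (hlam n).le,
        ← Real.rpow_add (hlam n)]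
      congr 1; push_cast; ring
    rw [← h3]; ring
  have h := hasSum_integral_of_summable_integral_norm (μ := volume.restrict (Set.Ioi (0:ℝ)))
    (F := fun n (x : ℝ) => (x:ℂ) ^ (z - 1) • (c n * φ ((lam n) ^ 2 * x))) hconv' (by
      simp only [hnorm]
      exact hs.mul_left _)
  have e : ∀ n, ∫ x in Set.Ioi (0:ℝ), (x:ℂ) ^ (z - 1) • (c n * φ ((lam n) ^ 2 * x))
      = mellin φ z * (c n * (lam n : ℂ) ^ (-(2 * z))) := by
    intro n
    have h1 : mellin (fun x => c n • φ ((lam n) ^ 2 * x)) z = _ := mellin_const_smul _ z (c n)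
    rw [mellin_comp_mul_left _ _ (hl2 n)] at h1
    simp only [smul_eq_mul, mellin] at h1 ⊢
    rw [h1]
    have : ((lam n ^ 2 : ℝ) : ℂ) ^ (-z) = (lam n : ℂ) ^ (-(2 * z)) := by
      rw [show -(2 * z) = (2:ℕ) * (-z) by push_cast; ring, Complex.cpow_nat_mul',
        Complex.ofReal_pow]
      · rw [Complex.arg_ofReal_of_nonneg (hlam n).le]; simp [Real.pi_pos]
      · rw [Complex.arg_ofReal_of_nonneg (hlam n).le]; simp [Real.pi_pos.le]
    rw [this]; ring
  simp only [e] at h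
  have h' := h.unique (hS.mul_left (mellin φ z))
  rw [← h', mellin]
  congr 1; ext x
  simp only [smul_eq_mul]
  rw [tsum_mul_left]

lemma summable_fam (b : ℝ) (hb : 0 < b) (c : ℕ → ℂ) (C : ℝ) (hc : ∀ n, ‖c n‖ ≤ C) (σ : ℝ) (hσ : 1 / 2 < σ) :
    Summable fun n : ℕ => ‖c n‖ * ((n:ℝ) + b) ^ (-2 * σ) := by
  have h := ((Real.summable_one_div_nat_add_rpow b (2 * σ)).2 (by linarith)).mul_left C
  refine Summable.of_nonneg_of_le (fun n => by positivity) (fun n => ?_) h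
  have hp : 0 < (n:ℝ) + b := by positivity
  rw [abs_of_pos hp, neg_mul, Real.rpow_neg hp.le, one_div]
  exact mul_le_mul_of_nonneg_right (hc n) (by positivity)

lemma three_mellin (φ : ℝ → ℂ) (z : ℂ) (hz : 1 / 2 < z.re) (hφ : MellinConvergent φ z)
    (hφs : ∀ b : ℝ, 0 < b → ∀ x : ℝ, 0 < x → Summable (fun n : ℕ => ‖φ (((n:ℝ) + b) ^ 2 * x)‖))
    (c1 c2 c3 : ℕ → ℂ) (C : ℝ) (h1 : ∀ n, ‖c1 n‖ ≤ C) (h2 : ∀ n, ‖c2 n‖ ≤ C) (h3 : ∀ n, ‖c3 n‖ ≤ C)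
    (b1 b2 b3 : ℝ) (hb1 : 0 < b1) (hb2 : 0 < b2) (hb3 : 0 < b3) (S1 S2 S3 : ℂ)
    (hS1 : HasSum (fun n : ℕ => c1 n * (((n:ℝ) + b1 : ℝ) : ℂ) ^ (-(2 * z))) S1)
    (hS2 : HasSum (fun n : ℕ => c2 n * (((n:ℝ) + b2 : ℝ) : ℂ) ^ (-(2 * z))) S2)
    (hS3 : HasSum (fun n : ℕ => c3 n * (((n:ℝ) + b3 : ℝ) : ℂ) ^ (-(2 * z))) S3) :
    mellin (fun x => (∑' n : ℕ, c1 n * φ (((n:ℝ) + b1) ^ 2 * x)) +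
      ((∑' n : ℕ, c2 n * φ (((n:ℝ) + b2) ^ 2 * x)) + ∑' n : ℕ, c3 n * φ (((n:ℝ) + b3) ^ 2 * x))) z
      = mellin φ z * (S1 + (S2 + S3)) := by
  set c : ℕ ⊕ (ℕ ⊕ ℕ) → ℂ := Sum.elim c1 (Sum.elim c2 c3) with hc
  set lam : ℕ ⊕ (ℕ ⊕ ℕ) → ℝ := Sum.elim (fun n : ℕ => (n:ℝ) + b1)
    (Sum.elim (fun n : ℕ => (n:ℝ) + b2) (fun n : ℕ => (n:ℝ) + b3)) with hl
  have key := mellin_termwise φ z hφ c lam (by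
    rintro (n | n | n) <;> simp only [hl, Sum.elim_inl, Sum.elim_inr] <;> positivity)
    (by
      refine Summable.sum _ ?_ (Summable.sum _ ?_ ?_)
      · exact summable_fam b1 hb1 c1 C h1 z.re hz
      · exact summable_fam b2 hb2 c2 C h2 z.re hz
      · exact summable_fam b3 hb3 c3 C h3 z.re hz) (S1 + (S2 + S3))
    (by
      refine HasSum.sum ?_ (HasSum.sum ?_ ?_)
      · exact hS1
      · exact hS2
      · exact hS3)
  rw [← key, mellin, mellin]
  refine setIntegral_congr_fun measurableSet_Ioi fun x hx => ?_
  congr 1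
  have hx' : (0:ℝ) < x := hx
  have hs : ∀ (c : ℕ → ℂ) (hc : ∀ n, ‖c n‖ ≤ C) (b : ℝ), 0 < b →
      Summable (fun n : ℕ => c n * φ (((n:ℝ) + b) ^ 2 * x)) := by
    intro c hc b hb
    refine Summable.of_norm_bounded ((hφs b hb x hx').mul_left C) fun n => ?_
    rw [norm_mul]
    exact mul_le_mul_of_nonneg_right (hc n) (norm_nonneg _)
  symm
  refine HasSum.tsum_eq (HasSum.sum ?_ (HasSum.sum ?_ ?_))
  · exact (hs c1 h1 b1 hb1).hasSum
  · exact (hs c2 h2 b2 hb2).hasSum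
  · exact (hs c3 h3 b3 hb3).hasSum


lemma hasSum_hz (a : ℝ) (ha : 0 < a) (ha' : a ≤ 1) (s : ℂ) (hs : 1 < s.re) :
    HasSum (fun n : ℕ => (1:ℂ) * (((n:ℝ) + a : ℝ) : ℂ) ^ (-s)) (hzeta a s) := by
  have := HurwitzZeta.hasSum_hurwitzZeta_of_one_lt_re (a := a) ⟨ha.le, ha'⟩ hs
  refine this.congr_fun fun n => ?_
  rw [one_mul, Complex.cpow_neg, one_div]
  push_cast; rfl

lemma hasSum_pz (a : ℝ) (s : ℂ) (hs : 1 < s.re) :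
    HasSum (fun n : ℕ => ((2 * Real.cos (2 * Real.pi * a * (n + 1)) : ℝ) : ℂ) *
      (((n:ℝ) + 1 : ℝ) : ℂ) ^ (-s)) (pzeta a s + pzeta (1 - a) s) := by
  have h1 := HurwitzZeta.hasSum_expZeta_of_one_lt_re a hs
  have h2 := HurwitzZeta.hasSum_expZeta_of_one_lt_re (1 - a) hs
  have h := h1.add h2
  rw [← hasSum_nat_add_iff' 1] at h
  have hs0 : s ≠ 0 := by rintro rfl; norm_num at hs
  simp only [Finset.range_one, Finset.sum_singleton, Nat.cast_zero, Complex.zero_cpow hs0, div_zero,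
    add_zero, sub_zero] at h
  refine h.congr_fun fun n => ?_
  rw [Complex.cpow_neg]
  have e2 : cexp (2 * Real.pi * I * ((1 - a : ℝ) : ℂ) * ((n + 1 : ℕ) : ℂ))
      = cexp (-(2 * Real.pi * a * (n + 1)) * I) := by
    rw [Complex.exp_eq_exp_iff_exists_int]
    refine ⟨(n + 1 : ℕ), ?_⟩
    push_cast; ring
  have e1 : cexp (2 * Real.pi * I * (a : ℂ) * ((n + 1 : ℕ) : ℂ))
      = cexp ((2 * Real.pi * a * (n + 1)) * I) := by
    congr 1; push_cast; ring
  rw [e2, e1]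
  push_cast
  rw [Complex.two_cos]
  ring

lemma hasSum_hz_tail (a : ℝ) (ha : 0 < a) (ha' : a ≤ 1) (s : ℂ) (hs : 1 < s.re) (c : ℂ) :
    HasSum (fun n : ℕ => c * (((n:ℝ) + (1 + a) : ℝ) : ℂ) ^ (-s)) (c * (hzeta a s - (a : ℂ) ^ (-s))) := by
  have h := hasSum_hz a ha ha' s hs
  rw [← hasSum_nat_add_iff' 1] at h
  simp only [Finset.range_one, Finset.sum_singleton, Nat.cast_zero, zero_add, one_mul] at h
  refine (h.mul_left c).congr_fun fun n => ?_
  congr 3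
  push_cast; ring

lemma diff_Q (a : ℝ) (s : ℂ) (hs : s ≠ 1) : DifferentiableAt ℂ (fun s => Qzeta s a) s := by
  unfold Qzeta hzeta pzeta
  refine DifferentiableAt.div_const ?_ 2
  refine (((HurwitzZeta.differentiableAt_hurwitzZeta _ hs).add (HurwitzZeta.differentiableAt_hurwitzZeta _ hs)).add
    (HurwitzZeta.differentiableAt_expZeta _ _ (Or.inl hs))).add (HurwitzZeta.differentiableAt_expZeta _ _ (Or.inl hs))

lemma diff_Q2 (a : ℝ) (z : ℂ) (hz : (0 < z.im ∧ 0 < z.re) ∨ 1/2 < z.re) :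
    DifferentiableAt ℂ (fun z => Qzeta (2 * z) a) z := by
  refine DifferentiableAt.comp (f := fun z : ℂ => 2 * z) (g := fun s => Qzeta s a) z (diff_Q a _ ?_) (by fun_prop)
  intro h
  have h1 := congrArg Complex.re h
  have h2 := congrArg Complex.im h
  simp at h1 h2
  rcases hz with hz | hz
  · linarith [hz.1]
  · linarith


noncomputable def Sfam (c : ℕ → ℂ) (b : ℝ) (w : ℂ) : ℂ :=
  ∑' n : ℕ, c n * cexp (-(Real.pi * ((n:ℝ) + b : ℝ) ^ 2 * w))

lemma norm_term (b : ℝ) (n : ℕ) (w : ℂ) :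
    ‖cexp (-(Real.pi * ((n:ℝ) + b : ℝ) ^ 2 * w))‖ = Real.exp (-(Real.pi * ((n:ℝ) + b) ^ 2 * w.re)) := by
  rw [Complex.norm_exp]
  congr 1
  rw [neg_re, ← Complex.ofReal_pow, ← Complex.ofReal_mul, Complex.re_ofReal_mul]

lemma term_geom (b : ℝ) (hb : 0 < b) (u : ℝ) (hu : 0 < u) (n : ℕ) :
    Real.exp (-(Real.pi * ((n:ℝ) + b) ^ 2 * u)) ≤ Real.exp (-(Real.pi * b ^ 2 * u)) * (Real.exp (-(Real.pi * u))) ^ n := by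
  rw [← Real.exp_nat_mul, ← Real.exp_add]
  apply Real.exp_le_exp.2
  have h1 : (n:ℝ) ≤ (n:ℝ) ^ 2 := by
    have : n ≤ n ^ 2 := Nat.le_self_pow (by norm_num) n
    exact_mod_cast this
  have h2 : b ^ 2 + n ≤ ((n:ℝ) + b) ^ 2 := by nlinarith [Nat.cast_nonneg (α := ℝ) n]
  have h3 : 0 < Real.pi * u := mul_pos Real.pi_pos hu
  nlinarith

lemma geom_lt_one (u : ℝ) (hu : 0 < u) : Real.exp (-(Real.pi * u)) < 1 := by
  rw [Real.exp_lt_one_iff]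
  have := mul_pos Real.pi_pos hu
  linarith

lemma summable_gauss (b : ℝ) (hb : 0 < b) (u : ℝ) (hu : 0 < u) :
    Summable (fun n : ℕ => Real.exp (-(Real.pi * ((n:ℝ) + b) ^ 2 * u))) := by
  refine Summable.of_nonneg_of_le (fun n => (Real.exp_pos _).le) (term_geom b hb u hu) ?_
  exact (summable_geometric_of_lt_one (Real.exp_pos _).le (geom_lt_one u hu)).mul_left _

lemma summable_Sfam (c : ℕ → ℂ) (C : ℝ) (hc : ∀ n, ‖c n‖ ≤ C) (b : ℝ) (hb : 0 < b) (w : ℂ) (hw : 0 < w.re) :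
    Summable (fun n : ℕ => c n * cexp (-(Real.pi * ((n:ℝ) + b : ℝ) ^ 2 * w))) := by
  refine Summable.of_norm_bounded ((summable_gauss b hb w.re hw).mul_left C) fun n => ?_
  rw [norm_mul, norm_term]
  exact mul_le_mul_of_nonneg_right (hc n) (Real.exp_pos _).le

lemma norm_partial_le (c : ℕ → ℂ) (C : ℝ) (hc : ∀ n, ‖c n‖ ≤ C) (b : ℝ) (hb : 0 < b) (w : ℂ) (hw : 0 < w.re)
    (s : Finset ℕ) :
    ‖∑ n ∈ s, c n * cexp (-(Real.pi * ((n:ℝ) + b : ℝ) ^ 2 * w))‖ ≤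
      C * Real.exp (-(Real.pi * b ^ 2 * w.re)) / (1 - Real.exp (-(Real.pi * w.re))) := by
  have hC : 0 ≤ C := (norm_nonneg _).trans (hc 0)
  have hg := summable_geometric_of_lt_one (Real.exp_pos _).le (geom_lt_one w.re hw)
  calc _ ≤ ∑ n ∈ s, C * Real.exp (-(Real.pi * b ^ 2 * w.re)) * (Real.exp (-(Real.pi * w.re))) ^ n := by
        refine norm_sum_le_of_le _ fun n _ => ?_
        rw [norm_mul, norm_term, mul_assoc C]
        exact mul_le_mul (hc n) (term_geom b hb w.re hw n) (Real.exp_pos _).le hC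
    _ ≤ ∑' n, C * Real.exp (-(Real.pi * b ^ 2 * w.re)) * (Real.exp (-(Real.pi * w.re))) ^ n :=
        (hg.mul_left _).sum_le_tsum _ (fun n _ => by positivity)
    _ = _ := by
        rw [tsum_mul_left, tsum_geometric_of_lt_one (Real.exp_pos _).le (geom_lt_one w.re hw)]
        rfl

lemma norm_Sfam_le (c : ℕ → ℂ) (C : ℝ) (hc : ∀ n, ‖c n‖ ≤ C) (b : ℝ) (hb : 0 < b) (w : ℂ) (hw : 0 < w.re) :
    ‖Sfam c b w‖ ≤ C * Real.exp (-(Real.pi * b ^ 2 * w.re)) / (1 - Real.exp (-(Real.pi * w.re))) := by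
  have h := (summable_Sfam c C hc b hb w hw).hasSum.norm
  exact le_of_tendsto h (Filter.Eventually.of_forall fun s => norm_partial_le c C hc b hb w hw s)

noncomputable def cone : ℕ → ℂ := fun _ => 1
noncomputable def ccos (a : ℝ) : ℕ → ℂ := fun n => ((2 * Real.cos (2 * Real.pi * a * (n + 1)) : ℝ) : ℂ)

lemma cone_le (n : ℕ) : ‖cone n‖ ≤ 2 := by simp [cone]
lemma ccos_le (a : ℝ) (n : ℕ) : ‖ccos a n‖ ≤ 2 := by
  unfold ccos
  rw [Complex.norm_real, norm_mul, Real.norm_eq_abs, Real.norm_eq_abs]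
  have := Real.abs_cos_le_one (2 * Real.pi * a * (n + 1))
  rw [abs_two]; linarith

noncomputable def Stot (a : ℝ) (w : ℂ) : ℂ := Sfam cone a w + (Sfam cone (1 - a) w + Sfam (ccos a) 1 w)
noncomputable def Gth (a : ℝ) (w : ℂ) : ℂ := Stot a w - w ^ (-(1/2) : ℂ)

lemma thetaA (a : ℝ) (ha : 0 < a) (ha' : a < 1) (w : ℂ) (hw : 0 < w.re) :
    Sfam cone a w + Sfam cone (1 - a) w = cexp (-(Real.pi * a ^ 2 * w)) * jacobiTheta₂ (I * a * w) (I * w) := by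
  have hI : 0 < (I * w).im := by simpa using hw
  have h := (hasSum_jacobiTheta₂_term (I * a * w) hI).mul_left (cexp (-(Real.pi * a ^ 2 * w)))
  have h1 := (summable_Sfam cone 2 cone_le a ha w hw).hasSum
  have h2 := (summable_Sfam cone 2 cone_le (1 - a) (by linarith) w hw).hasSum
  have h3 := HasSum.of_nat_of_neg_add_one
    (f := fun n : ℤ => cexp (-(Real.pi * a ^ 2 * w)) * jacobiTheta₂_term n (I * a * w) (I * w))
    (m := Sfam cone a w) (m' := Sfam cone (1 - a) w) ?_ ?_
  · exact h3.unique h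
  · refine h1.congr_fun fun n => ?_
    rw [cone, one_mul, jacobiTheta₂_term, ← Complex.exp_add]
    congr 1
    push_cast
    linear_combination ((2 * Real.pi * n * a * w + Real.pi * n ^ 2 * w : ℂ)) * I_sq
  · refine h2.congr_fun fun n => ?_
    rw [cone, one_mul, jacobiTheta₂_term, ← Complex.exp_add]
    congr 1
    push_cast
    linear_combination ((2 * Real.pi * (-(n + 1)) * a * w + Real.pi * (-(n + 1)) ^ 2 * w : ℂ)) * I_sq

lemma thetaB (a : ℝ) (w : ℂ) (hw : 0 < w.re) :
    1 + Sfam (ccos a) 1 w = jacobiTheta₂ a (I * w) := by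
  have hI : 0 < (I * w).im := by simpa using hw
  have h := (hasSum_jacobiTheta₂_term a hI)
  have h1 := (summable_Sfam (ccos a) 2 (ccos_le a) 1 one_pos w hw).hasSum
  have h3 := h.nat_add_neg
  rw [← hasSum_nat_add_iff' 1] at h3
  have h4 : jacobiTheta₂_term 0 a (I * w) = 1 := by simp [jacobiTheta₂_term]
  simp only [Finset.range_one, Finset.sum_singleton, Nat.cast_zero, neg_zero, h4] at h3
  have h5 : HasSum (fun n => ccos a n * cexp (-(Real.pi * ((n:ℝ) + 1 : ℝ) ^ 2 * w)))
      (jacobiTheta₂ a (I * w) + 1 - (1 + 1)) := by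
    refine h3.congr_fun fun n => ?_
    unfold ccos jacobiTheta₂_term
    push_cast
    rw [Complex.two_cos, add_mul, ← Complex.exp_add, ← Complex.exp_add]
    congr 2
    · linear_combination (-(Real.pi * (n + 1) ^ 2 * w : ℂ)) * I_sq
    · linear_combination (-(Real.pi * (n + 1) ^ 2 * w : ℂ)) * I_sq
  rw [Sfam, h5.tsum_eq]; ring

lemma inv_re_pos (w : ℂ) (hw : 0 < w.re) : 0 < (1 / w).re := by
  rw [one_div, Complex.inv_re]
  have : w ≠ 0 := by rintro rfl; simp at hw
  exact div_pos hw (Complex.normSq_pos.2 this)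

lemma cpow_inv_half (w : ℂ) (hw : 0 < w.re) : (1 / w) ^ (-(1/2) : ℂ) = w ^ (1/2 : ℂ) := by
  rw [one_div, Complex.inv_cpow, Complex.cpow_neg, inv_inv]
  intro h
  have := Complex.abs_arg_lt_pi_div_two_iff.2 (Or.inl hw)
  rw [h, abs_of_pos Real.pi_pos] at this
  linarith [Real.pi_pos]

/-- functional equation of the theta function -/
lemma theta_fe (a : ℝ) (ha : 0 < a) (ha' : a < 1) (w : ℂ) (hw : 0 < w.re) :
    1 + Sfam (ccos a) 1 w = w ^ (-(1/2) : ℂ) * (Sfam cone a (1 / w) + Sfam cone (1 - a) (1 / w)) := by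
  have hw0 : w ≠ 0 := by rintro rfl; simp at hw
  rw [thetaB a w hw, thetaA a ha ha' _ (inv_re_pos w hw), jacobiTheta₂_functional_equation]
  have e1 : -I * (I * w) = w := by linear_combination (-w) * I_sq
  have e2 : -(Real.pi:ℂ) * I * a ^ 2 / (I * w) = -(Real.pi * a ^ 2 * (1 / w)) := by
    field_simp
  have e3 : (a:ℂ) / (I * w) = -(I * a * (1 / w)) := by
    field_simp
    linear_combination (a:ℂ) * I_sq
  have e4 : -1 / (I * w) = I * (1 / w) := by
    field_simp
    linear_combination (-1) * I_sq
  rw [e1, e2, e3, e4, jacobiTheta₂_neg_left, Complex.cpow_neg]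
  ring

lemma Gth_fe (a : ℝ) (ha : 0 < a) (ha' : a < 1) (w : ℂ) (hw : 0 < w.re) :
    Gth a (1 / w) = w ^ (1/2 : ℂ) * Gth a w := by
  have hw0 : w ≠ 0 := by rintro rfl; simp at hw
  have h1 := theta_fe a ha ha' w hw
  have h2 := theta_fe a ha ha' (1 / w) (inv_re_pos w hw)
  rw [one_div_one_div, cpow_inv_half w hw] at h2
  have h3 : w ^ (1/2 : ℂ) * w ^ (-(1/2) : ℂ) = 1 := by
    rw [← Complex.cpow_add _ _ hw0]; simp
  unfold Gth Stot
  rw [cpow_inv_half w hw]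
  linear_combination h2 - w ^ (1/2 : ℂ) * h1 + (1 - (Sfam cone a (1 / w) + Sfam cone (1 - a) (1 / w))) * h3


lemma cont_Stot (a : ℝ) (ha : 0 < a) (ha' : a < 1) (ω : ℂ) (hω : 0 < ω.re) (x : ℝ) (hx : 0 < x) :
    ContinuousAt (fun x : ℝ => Stot a (ω * x)) x := by
  have hre : ∀ x : ℝ, 0 < x → 0 < (ω * x).re := fun x hx => by
    rw [mul_comm, Complex.re_ofReal_mul]; positivity
  have hI : 0 < (I * (ω * x)).im := by simpa using hre x hx
  have e : (fun x : ℝ => Stot a (ω * x)) =ᶠ[nhds x] fun x : ℝ =>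
      cexp (-(Real.pi * a ^ 2 * (ω * x))) * jacobiTheta₂ (I * a * (ω * x)) (I * (ω * x)) +
        (jacobiTheta₂ a (I * (ω * x)) - 1) := by
    filter_upwards [lt_mem_nhds hx] with x hx
    rw [← thetaA a ha ha' _ (hre x hx), ← thetaB a _ (hre x hx), Stot]
    ring
  refine ContinuousAt.congr ?_ e.symm
  have h1 : ContinuousAt (fun x : ℝ => jacobiTheta₂ (I * a * (ω * x)) (I * (ω * x))) x :=
    ContinuousAt.comp (f := fun x : ℝ => (I * a * (ω * x), I * (ω * x)))
      (g := fun p : ℂ × ℂ => jacobiTheta₂ p.1 p.2) (continuousAt_jacobiTheta₂ _ hI) (by fun_prop)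
  have h2 : ContinuousAt (fun x : ℝ => jacobiTheta₂ a (I * (ω * x))) x :=
    ContinuousAt.comp (f := fun x : ℝ => ((a:ℂ), I * (ω * x)))
      (g := fun p : ℂ × ℂ => jacobiTheta₂ p.1 p.2) (continuousAt_jacobiTheta₂ _ hI) (by fun_prop)
  exact (ContinuousAt.mul (by fun_prop) h1).add (h2.sub continuousAt_const)

/-- uniform exponential decay -/
lemma Stot_decay (a : ℝ) (ha : 0 < a) (ha' : a ≤ 1 / 2) (w : ℂ) (hw : 0 < w.re) :
    ‖Stot a w‖ ≤ 6 * Real.exp (-(Real.pi * a ^ 2 * w.re)) / (1 - Real.exp (-(Real.pi * w.re))) := by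
  have h1 := norm_Sfam_le cone 2 cone_le a ha w hw
  have h2 := norm_Sfam_le cone 2 cone_le (1 - a) (by linarith) w hw
  have h3 := norm_Sfam_le (ccos a) 2 (ccos_le a) 1 one_pos w hw
  have hd : 0 < 1 - Real.exp (-(Real.pi * w.re)) := by linarith [geom_lt_one w.re hw]
  have mono : ∀ b : ℝ, a ≤ b → 2 * Real.exp (-(Real.pi * b ^ 2 * w.re)) / (1 - Real.exp (-(Real.pi * w.re)))
      ≤ 2 * Real.exp (-(Real.pi * a ^ 2 * w.re)) / (1 - Real.exp (-(Real.pi * w.re))) := by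
    intro b hb
    gcongr
  have h2' := h2.trans (mono (1 - a) (by linarith))
  have h3' := h3.trans (mono 1 (by linarith))
  calc ‖Stot a w‖ ≤ ‖Sfam cone a w‖ + (‖Sfam cone (1 - a) w‖ + ‖Sfam (ccos a) 1 w‖) := by
        unfold Stot
        exact (norm_add_le _ _).trans (by gcongr; exact norm_add_le _ _)
    _ ≤ _ := by
        have : 6 * Real.exp (-(Real.pi * a ^ 2 * w.re)) / (1 - Real.exp (-(Real.pi * w.re))) =
          3 * (2 * Real.exp (-(Real.pi * a ^ 2 * w.re)) / (1 - Real.exp (-(Real.pi * w.re)))) := by ring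
        rw [this]; linarith

lemma Stot_decay' (a : ℝ) (ha : 0 < a) (ha' : a ≤ 1 / 2) (ω : ℂ) (hω : 0 < ω.re) :
    ∃ D : ℝ, 0 < D ∧ ∀ x : ℝ, 1 ≤ x → ‖Stot a (ω * x)‖ ≤ D * Real.exp (-(Real.pi * a ^ 2 * ω.re) * x) := by
  have hd : 0 < 1 - Real.exp (-(Real.pi * ω.re)) := by linarith [geom_lt_one ω.re hω]
  refine ⟨6 / (1 - Real.exp (-(Real.pi * ω.re))), by positivity, fun x hx => ?_⟩
  have hre : (ω * x).re = ω.re * x := by rw [mul_comm, Complex.re_ofReal_mul]; ring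
  refine (Stot_decay a ha ha' (ω * x) (by rw [hre]; positivity)).trans ?_
  rw [hre, div_mul_eq_mul_div]
  have h1 : Real.exp (-(Real.pi * (ω.re * x))) ≤ Real.exp (-(Real.pi * ω.re)) := by
    apply Real.exp_le_exp.2
    have : 0 < Real.pi * ω.re := mul_pos Real.pi_pos hω
    nlinarith
  have h2 : Real.exp (-(Real.pi * a ^ 2 * (ω.re * x))) = Real.exp (-(Real.pi * a ^ 2 * ω.re) * x) := by
    congr 1; ring
  rw [h2]
  gcongr

lemma Stot_top (a : ℝ) (ha : 0 < a) (ha' : a ≤ 1 / 2) (ω : ℂ) (hω : 0 < ω.re) (R : ℝ) :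
    (fun x : ℝ => Stot a (ω * x)) =O[Filter.atTop] (fun x : ℝ => x ^ (-R)) := by
  obtain ⟨D, hD, h⟩ := Stot_decay' a ha ha' ω hω
  have h1 : (fun x : ℝ => Stot a (ω * x)) =O[Filter.atTop]
      (fun x : ℝ => Real.exp (-(Real.pi * a ^ 2 * ω.re) * x)) := by
    refine Asymptotics.IsBigO.of_bound D ?_
    filter_upwards [Filter.eventually_ge_atTop (1:ℝ)] with x hx
    rw [Real.norm_of_nonneg (Real.exp_pos _).le]
    exact h x hx
  exact h1.trans (isLittleO_exp_neg_mul_rpow_atTop (by have := Real.pi_pos; positivity) _).isBigO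

lemma mul_real_cpow (ω : ℂ) (hω : 0 < ω.re) (x : ℝ) (hx : 0 < x) (r : ℂ) :
    (ω * x) ^ r = ω ^ r * (x:ℂ) ^ r := by
  have hω0 : ω ≠ 0 := by rintro rfl; simp at hω
  rw [mul_comm, Complex.cpow_def_of_ne_zero (mul_ne_zero (by exact_mod_cast hx.ne') hω0),
    Complex.log_ofReal_mul hx hω0, Complex.cpow_def_of_ne_zero hω0,
    Complex.cpow_def_of_ne_zero (by exact_mod_cast hx.ne'), ← Complex.exp_add, Complex.ofReal_log hx.le]
  congr 1; ring

lemma Gth_zero (a : ℝ) (ha : 0 < a) (ha' : a ≤ 1 / 2) (ω : ℂ) (hω : 0 < ω.re) :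
    (fun x : ℝ => Gth a (ω * x)) =O[nhdsWithin 0 (Set.Ioi 0)] (fun _ : ℝ => (1:ℝ)) := by
  set ω' : ℂ := 1 / ω with hω'
  have hω'r : 0 < ω'.re := inv_re_pos ω hω
  have hω0 : ω ≠ 0 := by rintro rfl; simp at hω
  have key : ∀ x : ℝ, 0 < x → Gth a (ω * x) =
      ω' ^ (1/2 : ℂ) * ((x⁻¹ : ℝ):ℂ) ^ (1/2 : ℂ) * Stot a (ω' * (x⁻¹ : ℝ)) - 1 := by
    intro x hx
    have hx' : 0 < x⁻¹ := inv_pos.2 hx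
    have hre : 0 < (ω' * (x⁻¹:ℝ)).re := by rw [mul_comm, Complex.re_ofReal_mul]; positivity
    have h := Gth_fe a ha (by linarith) (ω' * (x⁻¹ : ℝ)) hre
    have e : 1 / (ω' * (x⁻¹ : ℝ)) = ω * x := by
      rw [hω']; push_cast; field_simp
    rw [e] at h
    rw [h, Gth, mul_sub, ← Complex.cpow_add _ _ (by rintro h0; rw [h0] at hre; simp at hre),
      mul_real_cpow ω' hω'r _ hx']
    simp
  have h2 : (fun x : ℝ => Stot a (ω' * (x:ℂ))) =O[Filter.atTop] (fun x : ℝ => x ^ (-(1/2:ℝ))) :=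
    Stot_top a ha ha' ω' hω'r (1/2)
  have h3 : (fun x : ℝ => Stot a (ω' * ((x⁻¹:ℝ):ℂ))) =O[nhdsWithin 0 (Set.Ioi 0)] (fun x : ℝ => (x⁻¹) ^ (-(1/2:ℝ))) :=
    h2.comp_tendsto tendsto_inv_nhdsGT_zero
  have h4 : (fun x : ℝ => ω' ^ (1/2 : ℂ) * ((x⁻¹ : ℝ):ℂ) ^ (1/2 : ℂ)) =O[nhdsWithin 0 (Set.Ioi 0)]
      (fun x : ℝ => (x⁻¹) ^ (1/2:ℝ)) := by
    refine Asymptotics.IsBigO.of_bound ‖ω' ^ (1/2 : ℂ)‖ ?_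
    filter_upwards [self_mem_nhdsWithin] with x hx
    have hx' : (0:ℝ) < x⁻¹ := inv_pos.2 hx
    rw [norm_mul, Complex.norm_cpow_eq_rpow_re_of_pos hx', Real.norm_of_nonneg (by positivity)]
    norm_num
  have h5 := h4.mul h3
  have h6 : (fun x : ℝ => (x⁻¹) ^ (1/2:ℝ) * (x⁻¹) ^ (-(1/2:ℝ))) =ᶠ[nhdsWithin 0 (Set.Ioi 0)] (fun _ => (1:ℝ)) := by
    filter_upwards [self_mem_nhdsWithin] with x hx
    have hx' : (0:ℝ) < x⁻¹ := inv_pos.2 hx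
    rw [← Real.rpow_add hx']; simp
  have h7 := (h5.congr' Filter.EventuallyEq.rfl h6).sub (Asymptotics.isBigO_refl (fun _ : ℝ => (1:ℂ)) _ |>.trans
    (Asymptotics.isBigO_const_const (1:ℂ) (one_ne_zero (α := ℝ)) _))
  refine h7.congr' ?_ Filter.EventuallyEq.rfl
  filter_upwards [self_mem_nhdsWithin] with x hx
  exact (key x hx).symm

lemma gamma_cplx (z : ℂ) (hz : 0 < z.re) (r : ℂ) (hr : 0 < r.re) :
    ∫ t : ℝ in Set.Ioi 0, (t:ℂ) ^ (z - 1) * cexp (-(r * t)) = (1 / r) ^ z * Complex.Gamma z := by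
  have hU : IsOpen {w : ℂ | 0 < w.re} := isOpen_lt continuous_const Complex.continuous_re
  have hmeas : ∀ (u w : ℂ), AEStronglyMeasurable (fun t : ℝ => (t:ℂ) ^ u * cexp (-(w * t)))
      (volume.restrict (Set.Ioi 0)) := by
    intro u w
    refine ContinuousOn.aestronglyMeasurable ?_ measurableSet_Ioi
    intro t ht
    have : ContinuousAt (fun t : ℝ => (t:ℂ) ^ u) t :=
      Complex.continuousAt_ofReal_cpow_const _ _ (Or.inr (ne_of_gt ht))
    exact (this.mul (by fun_prop)).continuousWithinAt
  have hnorm : ∀ (u w : ℂ) (t : ℝ), 0 < t → ‖(t:ℂ) ^ u * cexp (-(w * t))‖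
      = t ^ u.re * Real.exp (-w.re * t ^ (1:ℝ)) := by
    intro u w t ht
    rw [norm_mul, Complex.norm_cpow_eq_rpow_re_of_pos ht, Complex.norm_exp, Real.rpow_one]
    congr 2
    rw [neg_re, mul_comm _ (t:ℂ), Complex.re_ofReal_mul]; ring
  have hdiff : ∀ w ∈ {w : ℂ | 0 < w.re},
      DifferentiableAt ℂ (fun w => ∫ t : ℝ in Set.Ioi 0, (t:ℂ) ^ (z - 1) * cexp (-(w * t))) w := by
    intro w hw
    have hw' : 0 < w.re := hw
    have h := hasDerivAt_integral_of_dominated_loc_of_deriv_le (𝕜 := ℂ)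
      (μ := volume.restrict (Set.Ioi (0:ℝ)))
      (F := fun w (t:ℝ) => (t:ℂ) ^ (z - 1) * cexp (-(w * t)))
      (F' := fun w (t:ℝ) => (t:ℂ) ^ (z - 1) * (cexp (-(w * t)) * (-t)))
      (bound := fun t : ℝ => t ^ z.re * Real.exp (-(w.re/2) * t ^ (1:ℝ)))
      (x₀ := w) (s := {u : ℂ | w.re / 2 < u.re})
      ((isOpen_lt continuous_const Complex.continuous_re).mem_nhds (by simp; linarith))
      (Filter.Eventually.of_forall fun u => hmeas _ _) ?_ ?_ ?_ ?_ ?_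
    · exact h.2.differentiableAt
    · refine Integrable.mono' (integrableOn_rpow_mul_exp_neg_mul_rpow (s := (z-1).re) (p := 1)
        (by simp; linarith) one_pos hw') (hmeas _ _) ?_
      filter_upwards [ae_restrict_mem measurableSet_Ioi] with t ht
      exact (hnorm _ _ t ht).le
    · simp only [← mul_assoc]
      exact (hmeas _ _).mul (by fun_prop)
    · filter_upwards [ae_restrict_mem measurableSet_Ioi] with t ht u hu
      have ht' : 0 < t := ht
      rw [← mul_assoc, norm_mul, hnorm _ _ t ht, norm_neg, Complex.norm_real,
        Real.norm_of_nonneg ht'.le]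
      have : t ^ z.re = t ^ (z-1).re * t := by
        rw [← Real.rpow_add_one ht'.ne']; simp
      rw [this, Real.rpow_one]
      have h2 : Real.exp (-u.re * t) ≤ Real.exp (-(w.re/2) * t) := by
        apply Real.exp_le_exp.2
        have : w.re / 2 < u.re := hu
        nlinarith
      have h3 : 0 ≤ t ^ (z-1).re * t := by positivity
      nlinarith
    · exact integrableOn_rpow_mul_exp_neg_mul_rpow (by linarith) one_pos (by linarith)
    · filter_upwards with t u hu
      refine HasDerivAt.const_mul _ ?_
      refine HasDerivAt.cexp ?_
      have h9 : HasDerivAt (fun x : ℂ => -(x * (t:ℂ))) (-(1 * (t:ℂ))) u := ((hasDerivAt_id u).mul_const (t:ℂ)).neg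
      rwa [one_mul] at h9
  have hA1 : AnalyticOnNhd ℂ (fun w => ∫ t : ℝ in Set.Ioi 0, (t:ℂ) ^ (z - 1) * cexp (-(w * t)))
      {w : ℂ | 0 < w.re} :=
    DifferentiableOn.analyticOnNhd (fun w hw => (hdiff w hw).differentiableWithinAt) hU
  have hA2 : AnalyticOnNhd ℂ (fun w => (1 / w) ^ z * Complex.Gamma z) {w : ℂ | 0 < w.re} := by
    refine DifferentiableOn.analyticOnNhd (fun w hw => DifferentiableAt.differentiableWithinAt ?_) hU
    have hw' : 0 < w.re := hw
    have hw0 : w ≠ 0 := by rintro rfl; simp at hw'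
    refine DifferentiableAt.mul_const ?_ _
    have hd : DifferentiableAt ℂ (fun w : ℂ => 1 / w) w := by
      have := differentiableAt_inv (𝕜 := ℂ) hw0
      simp only [one_div]; exact this
    refine DifferentiableAt.cpow hd (by fun_prop) ?_
    rw [one_div]
    exact Or.inl (by rw [Complex.inv_re]; exact div_pos hw' (Complex.normSq_pos.2 hw0))
  refine hA1.eqOn_of_preconnected_of_frequently_eq hA2 (z₀ := 1)
    (convex_halfSpace_re_gt 0).isPreconnected (by simp) ?_ hr
  have ht : Filter.Tendsto (fun n : ℕ => (((1:ℝ) + 1 / ((n:ℝ) + 1) : ℝ) : ℂ)) Filter.atTop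
      (nhdsWithin 1 {1}ᶜ) := by
    refine tendsto_nhdsWithin_iff.2 ⟨?_, Filter.Eventually.of_forall fun n => ?_⟩
    · have := (tendsto_one_div_add_atTop_nhds_zero_nat (𝕜 := ℝ)).const_add 1
      have h2 := (Complex.continuous_ofReal.tendsto _).comp this
      rw [add_zero, Complex.ofReal_one] at h2
      exact h2
    · simp only [Set.mem_compl_iff, Set.mem_singleton_iff]
      intro h
      have : (1:ℝ) + 1 / ((n:ℝ) + 1) = 1 := by exact_mod_cast h
      have h2 : (0:ℝ) < 1 / ((n:ℝ) + 1) := by positivity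
      linarith
  refine ht.frequently (Filter.Frequently.of_forall fun n => ?_)
  have hp : (0:ℝ) < 1 + 1 / ((n:ℝ) + 1) := by positivity
  exact integral_cpow_mul_exp_neg_mul_Ioi hz hp

lemma mellin_expω (ω : ℂ) (hω : 0 < ω.re) (z : ℂ) (hz : 0 < z.re) :
    HasMellin (fun x : ℝ => cexp (-(Real.pi * ω * x))) z ((1 / (Real.pi * ω)) ^ z * Complex.Gamma z) := by
  have hr : 0 < ((Real.pi:ℂ) * ω).re := by rw [Complex.re_ofReal_mul]; exact mul_pos Real.pi_pos hω
  constructor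
  · refine mellinConvergent_of_isBigO_rpow_exp (a := ((Real.pi:ℂ) * ω).re) (b := 0) hr ?_ ?_ ?_ hz
    · exact (Continuous.locallyIntegrable (by fun_prop)).locallyIntegrableOn _
    · refine Asymptotics.IsBigO.of_bound 1 (Filter.Eventually.of_forall fun x => ?_)
      rw [Complex.norm_exp, Real.norm_of_nonneg (Real.exp_pos _).le, one_mul]
      apply le_of_eq; congr 1
      rw [neg_re, mul_comm _ (x:ℂ), Complex.re_ofReal_mul]; ring
    · simp only [neg_zero, Real.rpow_zero]
      have : Filter.Tendsto (fun x : ℝ => cexp (-(Real.pi * ω * x))) (nhdsWithin 0 (Set.Ioi 0))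
          (nhds (cexp (-(Real.pi * ω * (0:ℝ))))) :=
        (Continuous.tendsto (by fun_prop) 0).mono_left nhdsWithin_le_nhds
      exact this.isBigO_one ℝ
  · rw [mellin]
    simp only [smul_eq_mul]
    exact gamma_cplx z hz _ hr

lemma theta_id (a : ℝ) (ha : 0 < a) (ha' : a ≤ 1 / 2) (ω : ℂ) (hω : 0 < ω.re) (z : ℂ)
    (hz0 : 0 < z.re) (hz1 : z.re < 1 / 2) (hzi : 0 < z.im) :
    HasMellin (fun x : ℝ => Gth a (ω * x)) z
      ((1 / (Real.pi * ω)) ^ z * Complex.Gamma z * (2 * Qzeta (2 * z) a)) := by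
  have hω0 : ω ≠ 0 := by rintro rfl; simp at hω
  have hpi : (Real.pi:ℂ) ≠ 0 := by exact_mod_cast Real.pi_pos.ne'
  have h := cont_mellin (fun x : ℝ => Stot a (ω * x)) (ω ^ (-(1/2) : ℂ))
    (fun z => (1 / (Real.pi * ω)) ^ z * Complex.Gamma z * (2 * Qzeta (2 * z) a)) ?_
    (fun R => Stot_top a ha ha' ω hω R) ?_ ?_ ?_ z hz0 hz1 hzi
  · have e' : Set.EqOn
       (fun t : ℝ => (t:ℂ) ^ (z - 1) • (Stot a (ω * t) - ω ^ (-(1/2) : ℂ) * (t:ℂ) ^ (-(1/2) : ℂ)))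
       (fun t : ℝ => (t:ℂ) ^ (z - 1) • Gth a (ω * t)) (Set.Ioi 0) := by
      intro t ht
      simp only [Gth]
      rw [mul_real_cpow ω hω t ht]
    refine ⟨?_, ?_⟩
    · have := h.1
      rwa [MellinConvergent, integrableOn_congr_fun e' measurableSet_Ioi] at this
    · have := h.2
      rwa [mellin, setIntegral_congr_fun measurableSet_Ioi e'] at this
  · exact ContinuousOn.locallyIntegrableOn
      (fun x hx => (cont_Stot a ha (by linarith) ω hω x hx).continuousWithinAt) measurableSet_Ioi
  · refine (Gth_zero a ha ha' ω hω).congr' ?_ Filter.EventuallyEq.rfl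
    filter_upwards [self_mem_nhdsWithin] with x hx
    rw [Gth, mul_real_cpow ω hω x hx]
  · intro w hw
    have hwre : 0 < w.re := by rcases hw with hw | hw; exacts [hw.2, by linarith]
    refine DifferentiableAt.mul (DifferentiableAt.mul ?_ ?_) (DifferentiableAt.const_mul (diff_Q2 a w hw) 2)
    · exact DifferentiableAt.const_cpow differentiableAt_id (Or.inl (by simp [hω0, hpi]))
    · refine Complex.differentiableAt_Gamma w fun m hm => ?_
      rw [hm] at hwre
      simp at hwre
      linarith [Nat.cast_nonneg (α := ℝ) m]
  · intro w hw
    have hw2 : 1 < (2 * w).re := by simp; linarith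
    have hM := mellin_expω ω hω w (by linarith)
    have hsum : ∀ b : ℝ, 0 < b → ∀ x : ℝ, 0 < x →
        Summable (fun n : ℕ => ‖cexp (-(Real.pi * ω * ((((n:ℝ) + b) ^ 2 * x : ℝ):ℂ)))‖) := by
      intro b hb x hx
      have := summable_gauss b hb (ω * x).re (by rw [mul_comm, Complex.re_ofReal_mul]; positivity)
      refine this.congr fun n => ?_
      rw [← norm_term]
      congr 2; push_cast; ring
    have h3 := three_mellin (fun x : ℝ => cexp (-(Real.pi * ω * x))) w hw hM.1 hsum cone cone (ccos a) 2
      cone_le cone_le (ccos_le a) a (1 - a) 1 ha (by linarith) one_pos _ _ _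
      (hasSum_hz a ha (by linarith) (2 * w) hw2) (hasSum_hz (1 - a) (by linarith) (by linarith) (2 * w) hw2)
      (hasSum_pz a (2 * w) hw2)
    rw [hM.2] at h3
    have e1 : (1 / (Real.pi * ω)) ^ w * Complex.Gamma w * (2 * Qzeta (2 * w) a) =
      (1 / (Real.pi * ω)) ^ w * Complex.Gamma w * (hzeta a (2 * w) + (hzeta (1 - a) (2 * w) + (pzeta a (2 * w) + pzeta (1 - a) (2 * w)))) := by
      rw [Qzeta]; ring
    rw [e1, ← h3]
    congr 1; ext x
    unfold Stot Sfam
    have e2 : ∀ (b : ℝ) (n : ℕ), -(Real.pi * ω * ((((n:ℝ) + b) ^ 2 * x : ℝ):ℂ)) = -(Real.pi * ((n:ℝ) + b : ℝ) ^ 2 * (ω * x)) := by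
      intro b n; push_cast; ring
    simp only [e2]


lemma dsum_split (A : ℕ → ℕ → ℂ) (N : ℕ) :
    ∑ m ∈ Finset.range N, ∑ n ∈ Finset.range N, A m n =
      ∑ m ∈ Finset.range N, A m m + ∑ m ∈ Finset.range N, ∑ n ∈ Finset.range m, (A m n + A n m) := by
  induction N with
  | zero => simp
  | succ N ih =>
    rw [Finset.sum_range_succ, Finset.sum_congr rfl (fun m _ => Finset.sum_range_succ (A m) N),
      Finset.sum_add_distrib, ih, Finset.sum_range_succ (A N) N, Finset.sum_range_succ _ N,
      Finset.sum_range_succ _ N, Finset.sum_add_distrib (s := Finset.range N) (f := fun n => A N n)]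
    ring

lemma ms_abstract (E : ℕ → ℝ → ℂ) (hE : ∀ n, Continuous (E n)) (N : ℕ) (y0 y1 : ℝ) (D O : ℝ)
    (hD : ‖∫ y in y0..y1, ∑ m ∈ Finset.range N, (‖E m y‖^2 : ℝ)‖ ≤ D)
    (hO : ∑ m ∈ Finset.range N, ∑ n ∈ Finset.range m,
      (‖∫ y in y0..y1, E m y * (starRingEnd ℂ) (E n y)‖ + ‖∫ y in y0..y1, E n y * (starRingEnd ℂ) (E m y)‖) ≤ O) :
    ∫ y in y0..y1, ‖∑ m ∈ Finset.range N, E m y‖^2 ≤ D + O := by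
  have hc : ∀ n, Continuous (fun y => (starRingEnd ℂ) (E n y)) := fun n => Complex.continuous_conj.comp (hE n)
  have h1 : ((∫ y in y0..y1, ‖∑ m ∈ Finset.range N, E m y‖^2 : ℝ) : ℂ) =
      ∑ m ∈ Finset.range N, ∑ n ∈ Finset.range N, ∫ y in y0..y1, E m y * (starRingEnd ℂ) (E n y) := by
    rw [← intervalIntegral.integral_ofReal]
    have : ∀ y : ℝ, ((‖∑ m ∈ Finset.range N, E m y‖^2 : ℝ) : ℂ) =
        ∑ m ∈ Finset.range N, ∑ n ∈ Finset.range N, E m y * (starRingEnd ℂ) (E n y) := by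
      intro y
      rw [← Complex.normSq_eq_norm_sq, ← Complex.mul_conj, map_sum, Finset.sum_mul_sum]
    simp_rw [this]
    rw [intervalIntegral.integral_finsetSum]
    · refine Finset.sum_congr rfl fun m _ => ?_
      rw [intervalIntegral.integral_finsetSum]
      intro n _
      exact ((hE m).mul (hc n)).intervalIntegrable _ _
    · intro m _
      exact (continuous_finsetSum _ fun n _ => (hE m).mul (hc n)).intervalIntegrable _ _
  rw [dsum_split] at h1
  have h2 : ∑ m ∈ Finset.range N, ∫ y in y0..y1, E m y * (starRingEnd ℂ) (E m y) =
      ((∫ y in y0..y1, ∑ m ∈ Finset.range N, (‖E m y‖^2 : ℝ) : ℝ) : ℂ) := by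
    rw [← intervalIntegral.integral_ofReal, ← intervalIntegral.integral_finsetSum]
    · refine intervalIntegral.integral_congr fun y _ => ?_
      simp only [Complex.ofReal_sum]
      refine Finset.sum_congr rfl fun m _ => ?_
      rw [Complex.mul_conj, Complex.normSq_eq_norm_sq]
    · intro m _
      exact ((hE m).mul (hc m)).intervalIntegrable _ _
  rw [h2] at h1
  have h3 := congrArg norm h1
  rw [Complex.norm_real] at h3
  calc _ ≤ _ := Real.le_norm_self _
    _ = _ := h3
    _ ≤ D + O := by
      refine (norm_add_le _ _).trans (add_le_add ?_ ?_)
      · rw [Complex.norm_real]; exact hD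
      · refine le_trans ?_ hO
        refine (norm_sum_le _ _).trans (Finset.sum_le_sum fun m _ => ?_)
        refine (norm_sum_le _ _).trans (Finset.sum_le_sum fun n _ => norm_add_le _ _)

lemma osc (ρ : ℂ) (hρ : 0 < ρ.re) (y0 y1 : ℝ) (h0 : 0 ≤ y0) (h01 : y0 ≤ y1) (h1 : y1 ≤ y0 + 1) :
    ‖∫ y in y0..y1, cexp (-(ρ * (Real.exp y : ℝ))) * (Real.exp (y/2) : ℝ)‖ ≤ 3 * Real.exp (-ρ.re) / ‖ρ‖ := by
  have hρ0 : ρ ≠ 0 := by rintro rfl; simp at hρ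
  have hρn : 0 < ‖ρ‖ := norm_pos_iff.2 hρ0
  let Φ : ℝ → ℂ := fun y => -(cexp (-(ρ * (Real.exp y : ℝ))) * (Real.exp (-(y/2)) : ℝ)) / ρ
  have hb : ∀ y, y0 ≤ y → ‖cexp (-(ρ * (Real.exp y : ℝ))) * (Real.exp (-(y/2)) : ℝ)‖ ≤ Real.exp (-ρ.re) := by
    intro y hy
    have hy0 : 0 ≤ y := h0.trans hy
    rw [norm_mul, Complex.norm_exp, Complex.norm_real, Real.norm_of_nonneg (Real.exp_pos _).le,
      neg_re, mul_comm ρ, Complex.re_ofReal_mul]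
    have e1 : Real.exp (-(Real.exp y * ρ.re)) ≤ Real.exp (-ρ.re) := by
      apply Real.exp_le_exp.2
      have : 1 ≤ Real.exp y := Real.one_le_exp hy0
      nlinarith
    have e2 : Real.exp (-(y/2)) ≤ 1 := Real.exp_le_one_iff.2 (by linarith)
    calc _ ≤ Real.exp (-ρ.re) * 1 := by gcongr
      _ = _ := mul_one _
  have hd : ∀ y : ℝ, HasDerivAt Φ (cexp (-(ρ * (Real.exp y : ℝ))) * (Real.exp (y/2) : ℝ) +
      (cexp (-(ρ * (Real.exp y : ℝ))) * (Real.exp (-(y/2)) : ℝ)) / (2*ρ)) y := by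
    intro y
    have a1 : HasDerivAt (fun y : ℝ => ((Real.exp y : ℝ) : ℂ)) ((Real.exp y : ℝ) : ℂ) y :=
      (Real.hasDerivAt_exp y).ofReal_comp
    have a2 : HasDerivAt (fun y : ℝ => cexp (-(ρ * (Real.exp y : ℝ))))
        (cexp (-(ρ * (Real.exp y : ℝ))) * (-(ρ * (Real.exp y : ℝ)))) y := (a1.const_mul ρ).neg.cexp
    have a3 : HasDerivAt (fun y : ℝ => Real.exp (-(y/2))) (Real.exp (-(y/2)) * (-(1/2))) y :=
      (((hasDerivAt_id y).div_const 2).neg).exp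
    have a4 := ((a2.mul a3.ofReal_comp).neg).div_const ρ
    refine HasDerivAt.congr_deriv (f := Φ) a4 ?_
    have : ((Real.exp (y/2) : ℝ) : ℂ) = (Real.exp y : ℝ) * (Real.exp (-(y/2)) : ℝ) := by
      rw [← Complex.ofReal_mul, ← Real.exp_add]; congr 2; ring
    rw [this]
    push_cast
    field_simp
    ring
  have hi := intervalIntegral.integral_eq_sub_of_hasDerivAt (a := y0) (b := y1) (fun y _ => hd y)
    (Continuous.intervalIntegrable (by fun_prop) _ _)
  rw [intervalIntegral.integral_add (Continuous.intervalIntegrable (by fun_prop) _ _)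
    (Continuous.intervalIntegrable (by fun_prop) _ _)] at hi
  rw [eq_sub_of_add_eq hi]
  have hΦ : ∀ y, y0 ≤ y → ‖Φ y‖ ≤ Real.exp (-ρ.re) / ‖ρ‖ := by
    intro y hy
    simp only [Φ]
    rw [norm_div, norm_neg]
    gcongr
    exact hb y hy
  have hI : ‖∫ y in y0..y1, (cexp (-(ρ * (Real.exp y : ℝ))) * (Real.exp (-(y/2)) : ℝ)) / (2*ρ)‖ ≤
      (Real.exp (-ρ.re) / ‖ρ‖) * |y1 - y0| := by
    refine intervalIntegral.norm_integral_le_of_norm_le_const fun y hy => ?_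
    rw [Set.uIoc_of_le h01] at hy
    have h2 : ‖(2:ℂ) * ρ‖ = 2 * ‖ρ‖ := by rw [norm_mul]; simp
    rw [norm_div, h2]
    have := hb y hy.1.le
    have : ‖cexp (-(ρ * (Real.exp y : ℝ))) * (Real.exp (-(y/2)) : ℝ)‖ / (2 * ‖ρ‖) ≤ Real.exp (-ρ.re) / (1 * ‖ρ‖) := by
      gcongr; norm_num
    rwa [one_mul] at this
  have hab : |y1 - y0| ≤ 1 := by rw [abs_of_nonneg (by linarith)]; linarith
  have hpos : 0 ≤ Real.exp (-ρ.re) / ‖ρ‖ := by positivity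
  have h2 := hΦ y1 h01
  have h3 := hΦ y0 le_rfl
  have e : 3 * Real.exp (-ρ.re) / ‖ρ‖ = 3 * (Real.exp (-ρ.re) / ‖ρ‖) := by ring
  rw [e]
  have h4 := norm_sub_le (Φ y1 - Φ y0) (∫ y in y0..y1, (cexp (-(ρ * (Real.exp y : ℝ))) * (Real.exp (-(y/2)) : ℝ)) / (2*ρ))
  have h5 := norm_sub_le (Φ y1) (Φ y0)
  nlinarith

lemma gauss_sum (c : ℝ) (hc : 0 < c) (b : ℝ) (hb : 0 < b) (N : ℕ) :
    ∑ n ∈ Finset.range N, Real.exp (-(c * ((n:ℝ) + b) ^ 2)) ≤ (1 / b + 1) / Real.sqrt c := by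
  have hs : 0 < Real.sqrt c := Real.sqrt_pos.2 hc
  have hss : Real.sqrt c ^ 2 = c := Real.sq_sqrt hc.le
  have h1 : Real.exp (-(c * b ^ 2)) ≤ 1 / b / Real.sqrt c := by
    rw [div_div, Real.exp_neg, one_div]
    apply inv_anti₀ (by positivity)
    have := Real.add_one_le_exp (c * b ^ 2)
    have e3 : c * b ^ 2 = (b * Real.sqrt c) ^ 2 := by rw [mul_pow, hss]; ring
    rw [e3] at this ⊢
    nlinarith [sq_nonneg (b * Real.sqrt c - 1)]
  have h2 : ∑ i ∈ Finset.range N, Real.exp (-(c * ((i:ℝ) + 1) ^ 2)) ≤ 1 / Real.sqrt c := by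
    have hanti : AntitoneOn (fun x : ℝ => Real.exp (-c * x ^ 2)) (Set.Icc 0 (0 + N)) := by
      intro x hx y hy hxy
      apply Real.exp_le_exp.2
      have : x ^ 2 ≤ y ^ 2 := by have := hx.1; gcongr
      nlinarith
    have h3 := hanti.sum_le_integral
    have h4 : ∫ x in (0:ℝ)..(0 + N), Real.exp (-c * x ^ 2) ≤ ∫ x in Set.Ioi (0:ℝ), Real.exp (-c * x ^ 2) := by
      rw [intervalIntegral.integral_of_le (by simp)]
      exact setIntegral_mono_set (integrable_exp_neg_mul_sq hc).integrableOn
        (Filter.Eventually.of_forall fun x => (Real.exp_pos _).le) Set.Ioc_subset_Ioi_self.eventuallyLE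
    rw [integral_gaussian_Ioi] at h4
    have h5 : Real.sqrt (Real.pi / c) / 2 ≤ 1 / Real.sqrt c := by
      rw [Real.sqrt_div Real.pi_pos.le]
      have : Real.sqrt Real.pi ≤ 2 := by
        rw [Real.sqrt_le_left (by norm_num)]; linarith [Real.pi_le_four]
      rw [div_div, mul_comm (Real.sqrt c), ← div_div]
      gcongr; linarith
    refine le_trans (le_of_eq ?_) (h3.trans (h4.trans h5))
    refine Finset.sum_congr rfl fun i _ => ?_
    congr 1; push_cast; ring
  have h3 : ∑ n ∈ Finset.range N, Real.exp (-(c * ((n:ℝ) + b) ^ 2)) ≤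
      ∑ n ∈ Finset.range (N+1), Real.exp (-(c * ((n:ℝ) + b) ^ 2)) := by
    rw [Finset.sum_range_succ]; linarith [Real.exp_pos (-(c * ((N:ℝ) + b) ^ 2))]
  rw [Finset.sum_range_succ'] at h3
  have h4 : ∑ n ∈ Finset.range N, Real.exp (-(c * (((n+1 : ℕ):ℝ) + b) ^ 2)) ≤
      ∑ i ∈ Finset.range N, Real.exp (-(c * ((i:ℝ) + 1) ^ 2)) := by
    refine Finset.sum_le_sum fun i _ => Real.exp_le_exp.2 ?_
    have : ((i:ℝ) + 1) ^ 2 ≤ (((i+1 : ℕ):ℝ) + b) ^ 2 := by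
      apply pow_le_pow_left₀ (by positivity); push_cast; linarith
    nlinarith
  have h5 : Real.exp (-(c * (((0:ℕ):ℝ) + b) ^ 2)) = Real.exp (-(c * b ^ 2)) := by simp
  rw [h5] at h3
  rw [add_div]; linarith

lemma harm_le (m : ℕ) : ∑ n ∈ Finset.range m, 1 / ((m:ℝ) - n) ≤ 2 * Real.sqrt m := by
  have h : ∑ n ∈ Finset.range m, 1 / ((m:ℝ) - n) = ∑ n ∈ Finset.range m, 1 / ((n:ℝ) + 1) := by
    rw [← Finset.sum_range_reflect]
    refine Finset.sum_congr rfl fun i hi => ?_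
    have := Finset.mem_range.1 hi
    congr 1
    rw [Nat.sub_sub, Nat.cast_sub (by omega)]
    push_cast; ring
  rw [h]
  induction m with
  | zero => simp
  | succ m ih =>
    rw [Finset.sum_range_succ]
    have e : ∑ n ∈ Finset.range m, 1 / ((m:ℝ) - n) = ∑ n ∈ Finset.range m, 1 / ((n:ℝ) + 1) := by
      rw [← Finset.sum_range_reflect]
      refine Finset.sum_congr rfl fun i hi => ?_
      have := Finset.mem_range.1 hi
      congr 1
      rw [Nat.sub_sub, Nat.cast_sub (by omega)]
      push_cast; ring
    have ih' := ih e
    have h1 : Real.sqrt ((m:ℝ)+1) ^ 2 = m + 1 := Real.sq_sqrt (by positivity)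
    have h2 : Real.sqrt (m:ℝ) ^ 2 = m := Real.sq_sqrt (by positivity)
    have h3 : 1 ≤ Real.sqrt ((m:ℝ)+1) := Real.one_le_sqrt.2 (by linarith [(Nat.cast_nonneg m : (0:ℝ) ≤ m)])
    have h4 : 0 ≤ Real.sqrt (m:ℝ) := Real.sqrt_nonneg _
    have h5 : Real.sqrt (m:ℝ) ≤ Real.sqrt ((m:ℝ)+1) := Real.sqrt_le_sqrt (by linarith)
    push_cast
    have h6 : 1 / ((m:ℝ)+1) ≤ 2 * Real.sqrt ((m:ℝ)+1) - 2 * Real.sqrt m := by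
      rw [div_le_iff₀ (by positivity)]
      have e2 : 1 = (Real.sqrt ((m:ℝ)+1) - Real.sqrt m) * (Real.sqrt ((m:ℝ)+1) + Real.sqrt m) := by nlinarith
      have h7 : Real.sqrt ((m:ℝ)+1) + Real.sqrt m ≤ 2 * ((m:ℝ)+1) := by nlinarith
      have h8 : 0 ≤ Real.sqrt ((m:ℝ)+1) - Real.sqrt m := by linarith
      nlinarith [mul_le_mul_of_nonneg_left h7 h8]
    linarith

lemma exp_le_rpow (t : ℝ) (ht : 0 < t) : Real.exp (-t) ≤ t ^ (-(3/8) : ℝ) := by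
  rw [Real.exp_neg, Real.rpow_neg ht.le]
  apply inv_anti₀ (by positivity)
  have h := Real.add_one_le_exp t
  have : t ^ (3/8 : ℝ) ≤ 1 + t := by
    rcases le_total t 1 with h1 | h1
    · have := Real.rpow_le_one ht.le h1 (by norm_num : (0:ℝ) ≤ 3/8); linarith
    · have := Real.rpow_le_rpow_of_exponent_le h1 (by norm_num : (3/8:ℝ) ≤ 1)
      rw [Real.rpow_one] at this; linarith
  linarith

noncomputable def Koff : ℝ := ∑' m : ℕ, ((m:ℝ)) ^ (-(5/4) : ℝ)

lemma Koff_nonneg : 0 ≤ Koff := tsum_nonneg fun m => by positivity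

lemma off_sum (κ : ℝ) (hκ : 0 < κ) (N : ℕ) :
    ∑ m ∈ Finset.range N, ∑ n ∈ Finset.range m, Real.exp (-(κ * (m:ℝ)^2)) / (((m:ℝ) - n) * m) ≤
      2 * κ ^ (-(3/8) : ℝ) * Koff := by
  have hs : Summable fun m : ℕ => ((m:ℝ)) ^ (-(5/4) : ℝ) := Real.summable_nat_rpow.2 (by norm_num)
  have h := hs.sum_le_tsum (Finset.range N) (fun i _ => by positivity)
  have h2 := mul_le_mul_of_nonneg_left h (by positivity : 0 ≤ 2 * κ ^ (-(3/8) : ℝ))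
  refine le_trans ?_ h2
  rw [Finset.mul_sum]
  refine Finset.sum_le_sum fun m _ => ?_
  rcases Nat.eq_zero_or_pos m with rfl | hm
  · simp
  have hm' : (0:ℝ) < m := by exact_mod_cast hm
  have e : ∑ n ∈ Finset.range m, Real.exp (-(κ * (m:ℝ)^2)) / (((m:ℝ) - n) * m) =
      Real.exp (-(κ * (m:ℝ)^2)) / m * ∑ n ∈ Finset.range m, 1 / ((m:ℝ) - n) := by
    rw [Finset.mul_sum]
    refine Finset.sum_congr rfl fun n hn => ?_
    have : (0:ℝ) < m - n := by have := Finset.mem_range.1 hn; rw [sub_pos]; exact_mod_cast this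
    field_simp
  rw [e]
  have h3 := exp_le_rpow (κ * (m:ℝ)^2) (by positivity)
  calc _ ≤ (κ * (m:ℝ)^2) ^ (-(3/8) : ℝ) / m * (2 * Real.sqrt m) := by
        apply mul_le_mul _ (harm_le m) _ (by positivity)
        · gcongr
        · refine Finset.sum_nonneg fun n hn => ?_
          have : (0:ℝ) < m - n := by have := Finset.mem_range.1 hn; rw [sub_pos]; exact_mod_cast this
          positivity
    _ = _ := by
      rw [Real.mul_rpow hκ.le (by positivity), ← Real.rpow_natCast_mul hm'.le, Real.sqrt_eq_rpow]
      have : (m:ℝ) ^ (-(5/4):ℝ) = (m:ℝ) ^ (((2:ℕ):ℝ) * -(3/8)) * (m:ℝ)⁻¹ * (m:ℝ) ^ (1/2:ℝ) := by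
        rw [← Real.rpow_neg_one, ← Real.rpow_add hm', ← Real.rpow_add hm']; norm_num
      rw [this]; ring


lemma off_one (ω : ℂ) (hω : 0 < ω.re) (hi : 1/2 ≤ |ω.im|) (y0 y1 : ℝ) (h0 : 0 ≤ y0) (h01 : y0 ≤ y1) (h1 : y1 ≤ y0 + 1)
    (c d : ℂ) (hc : ‖c‖ ≤ 2) (hd : ‖d‖ ≤ 2) (u v D : ℝ) (hu : 0 < u) (hv : 0 < v) (hD : 0 < D) (hDu : D ≤ |u^2 - v^2|) :
    ‖∫ y in y0..y1, (c * cexp (-(Real.pi * (u:ℂ) ^ 2 * (ω * (Real.exp y : ℝ)))) * (Real.exp (y/4) : ℝ)) *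
      (starRingEnd ℂ) (d * cexp (-(Real.pi * (v:ℂ) ^ 2 * (ω * (Real.exp y : ℝ)))) * (Real.exp (y/4) : ℝ))‖ ≤
      12 * Real.exp (-(Real.pi * ω.re * (u^2 + v^2))) / D := by
  set ρ : ℂ := Real.pi * ((u:ℂ)^2 * ω + (v:ℂ)^2 * (starRingEnd ℂ) ω) with hρ
  have e : ∀ y : ℝ, (c * cexp (-(Real.pi * (u:ℂ) ^ 2 * (ω * (Real.exp y : ℝ)))) * (Real.exp (y/4) : ℝ)) *
      (starRingEnd ℂ) (d * cexp (-(Real.pi * (v:ℂ) ^ 2 * (ω * (Real.exp y : ℝ)))) * (Real.exp (y/4) : ℝ)) =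
      (c * (starRingEnd ℂ) d) * (cexp (-(ρ * (Real.exp y : ℝ))) * (Real.exp (y/2) : ℝ)) := by
    intro y
    have e1 : ((Real.exp (y/2) : ℝ) : ℂ) = (Real.exp (y/4) : ℝ) * (Real.exp (y/4) : ℝ) := by
      rw [← Complex.ofReal_mul, ← Real.exp_add]; congr 2; ring
    have e2 : cexp (-(ρ * (Real.exp y : ℝ))) = cexp (-(Real.pi * (u:ℂ) ^ 2 * (ω * (Real.exp y : ℝ)))) *
        cexp (-(Real.pi * (v:ℂ) ^ 2 * ((starRingEnd ℂ) ω * (Real.exp y : ℝ)))) := by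
      rw [← Complex.exp_add]; congr 1; rw [hρ]; ring
    rw [e1, e2]
    simp only [map_mul, ← Complex.exp_conj, map_neg, Complex.conj_ofReal, map_pow]
    ring
  simp_rw [e]
  rw [intervalIntegral.integral_const_mul, norm_mul]
  have hre : ρ.re = Real.pi * ω.re * (u^2 + v^2) := by
    rw [hρ, Complex.re_ofReal_mul, Complex.add_re, ← Complex.ofReal_pow, ← Complex.ofReal_pow,
      Complex.re_ofReal_mul, Complex.re_ofReal_mul, Complex.conj_re]; ring
  have him : ρ.im = Real.pi * ω.im * (u^2 - v^2) := by
    rw [hρ, Complex.im_ofReal_mul, Complex.add_im, ← Complex.ofReal_pow, ← Complex.ofReal_pow,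
      Complex.im_ofReal_mul, Complex.im_ofReal_mul, Complex.conj_im]; ring
  have hpos : 0 < ρ.re := by rw [hre]; have := Real.pi_pos; positivity
  have h := osc ρ hpos y0 y1 h0 h01 h1
  have hn : D ≤ ‖ρ‖ := by
    refine le_trans ?_ (Complex.abs_im_le_norm ρ)
    rw [him, abs_mul, abs_mul, abs_of_pos Real.pi_pos]
    have : 1 ≤ Real.pi * |ω.im| := by nlinarith [Real.pi_gt_three]
    have h3 := abs_nonneg (u^2 - v^2)
    nlinarith
  rw [hre] at h
  have hcd : ‖c * (starRingEnd ℂ) d‖ ≤ 4 := by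
    rw [norm_mul, RCLike.norm_conj]
    have := norm_nonneg c; have := norm_nonneg d
    nlinarith
  calc _ ≤ 4 * (3 * Real.exp (-(Real.pi * ω.re * (u^2 + v^2))) / ‖ρ‖) := by gcongr
    _ ≤ 4 * (3 * Real.exp (-(Real.pi * ω.re * (u^2 + v^2))) / D) := by gcongr
    _ = _ := by ring

lemma ms_partial (c : ℕ → ℂ) (hc : ∀ n, ‖c n‖ ≤ 2) (b : ℝ) (hb : 0 < b) (ω : ℂ) (hω : 0 < ω.re) (hi : 1/2 ≤ |ω.im|)
    (y0 y1 : ℝ) (h0 : 0 ≤ y0) (h01 : y0 ≤ y1) (h1 : y1 ≤ y0 + 1) (N : ℕ) :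
    ∫ y in y0..y1, ‖(∑ n ∈ Finset.range N, c n * cexp (-(Real.pi * ((n:ℝ) + b : ℝ) ^ 2 * (ω * (Real.exp y : ℝ))))) *
      (Real.exp (y/4) : ℝ)‖^2 ≤ 4 * (1/b+1) / Real.sqrt (Real.pi * ω.re) * (y1 - y0) +
        48 * Koff * (Real.pi * ω.re) ^ (-(3/8) : ℝ) := by
  have hκ : 0 < Real.pi * ω.re := mul_pos Real.pi_pos hω
  simp_rw [Finset.sum_mul]
  refine ms_abstract (fun n y => c n * cexp (-(Real.pi * ((n:ℝ) + b : ℝ) ^ 2 * (ω * (Real.exp y : ℝ)))) * (Real.exp (y/4) : ℝ))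
    (fun n => by fun_prop) N y0 y1 _ _ ?_ ?_
  · have : |y1 - y0| = y1 - y0 := abs_of_nonneg (by linarith)
    rw [← this]
    refine intervalIntegral.norm_integral_le_of_norm_le_const fun y hy => ?_
    rw [Real.norm_of_nonneg (Finset.sum_nonneg fun _ _ => by positivity)]
    have key : ∀ n ∈ Finset.range N, ‖c n * cexp (-(Real.pi * ((n:ℝ) + b : ℝ) ^ 2 * (ω * (Real.exp y : ℝ)))) * (Real.exp (y/4) : ℝ)‖^2
        ≤ 4 * Real.exp (y/2) * Real.exp (-((2 * (Real.pi * ω.re) * Real.exp y) * ((n:ℝ) + b)^2)) := by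
      intro n _
      rw [norm_mul, norm_mul, norm_term, Complex.norm_real, Real.norm_of_nonneg (Real.exp_pos _).le, mul_pow, mul_pow,
        ← Real.exp_nat_mul, ← Real.exp_nat_mul, mul_comm ω, Complex.re_ofReal_mul]
      have e1 : ((2:ℕ):ℝ) * (y/4) = y/2 := by push_cast; ring
      have e2 : ((2:ℕ):ℝ) * -(Real.pi * ((n:ℝ) + b)^2 * (Real.exp y * ω.re)) =
         -((2 * (Real.pi * ω.re) * Real.exp y) * ((n:ℝ) + b)^2) := by push_cast; ring
      rw [e1, e2]
      have : ‖c n‖^2 ≤ 4 := by have := hc n; have := norm_nonneg (c n); nlinarith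
      have h5 := mul_le_mul_of_nonneg_right this (mul_pos (Real.exp_pos (y/2)) (Real.exp_pos (-((2 * (Real.pi * ω.re) * Real.exp y) * ((n:ℝ) + b)^2)))).le
      linarith
    refine (Finset.sum_le_sum key).trans ?_
    rw [← Finset.mul_sum]
    have hg := gauss_sum (2 * (Real.pi * ω.re) * Real.exp y) (by positivity) b hb N
    have hsq : Real.sqrt (Real.pi * ω.re) * Real.exp (y/2) ≤ Real.sqrt (2 * (Real.pi * ω.re) * Real.exp y) := by
      apply Real.le_sqrt_of_sq_le
      rw [mul_pow, Real.sq_sqrt hκ.le, ← Real.exp_nat_mul]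
      have e1 : ((2:ℕ):ℝ) * (y/2) = y := by push_cast; ring
      rw [e1]
      nlinarith [mul_pos hκ (Real.exp_pos y)]
    calc _ ≤ 4 * Real.exp (y/2) * ((1/b+1) / Real.sqrt (2 * (Real.pi * ω.re) * Real.exp y)) := by gcongr
      _ ≤ 4 * Real.exp (y/2) * ((1/b+1) / (Real.sqrt (Real.pi * ω.re) * Real.exp (y/2))) := by gcongr
      _ = _ := by
        have := Real.exp_pos (y/2)
        have := Real.sqrt_pos.2 hκ
        field_simp
  · have key : ∀ m ∈ Finset.range N, ∀ n ∈ Finset.range m, 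
        12 * Real.exp (-(Real.pi * ω.re * (((m:ℝ)+b)^2 + ((n:ℝ)+b)^2))) / (((m:ℝ) - n) * m) ≤
        12 * (Real.exp (-(Real.pi * ω.re * (m:ℝ)^2)) / (((m:ℝ) - n) * m)) := by
      intro m _ n hn
      have hn' : (n:ℝ) < m := by exact_mod_cast Finset.mem_range.1 hn
      have hm : (0:ℝ) ≤ n := Nat.cast_nonneg n
      have : 0 < ((m:ℝ) - n) * m := mul_pos (by linarith) (by linarith)
      rw [mul_div_assoc]
      gcongr
      nlinarith [sq_nonneg ((n:ℝ)+b)]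
    have hb2 : ∑ m ∈ Finset.range N, ∑ n ∈ Finset.range m, 24 * (Real.exp (-(Real.pi * ω.re * (m:ℝ)^2)) / (((m:ℝ) - n) * m)) ≤
       48 * Koff * (Real.pi * ω.re) ^ (-(3/8) : ℝ) := by
      simp_rw [← Finset.mul_sum]
      have := off_sum (Real.pi * ω.re) hκ N
      nlinarith
    refine le_trans (Finset.sum_le_sum fun m hm => Finset.sum_le_sum fun n hn => ?_) hb2
    have hn' : (n:ℝ) < m := by exact_mod_cast Finset.mem_range.1 hn
    have hm0 : (0:ℝ) ≤ n := Nat.cast_nonneg n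
    have hD : 0 < ((m:ℝ) - n) * m := mul_pos (by linarith) (by linarith)
    have hDD : ((m:ℝ) - n) * m ≤ ((m:ℝ)+b)^2 - ((n:ℝ)+b)^2 := by nlinarith
    have k := key m hm n hn
    have a1 := off_one ω hω hi y0 y1 h0 h01 h1 (c m) (c n) (hc m) (hc n) ((m:ℝ)+b) ((n:ℝ)+b) _ (by positivity) (by positivity) hD
      (hDD.trans (le_abs_self _))
    have a2 := off_one ω hω hi y0 y1 h0 h01 h1 (c n) (c m) (hc n) (hc m) ((n:ℝ)+b) ((m:ℝ)+b) _ (by positivity) (by positivity) hD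
      (by rw [abs_sub_comm]; exact hDD.trans (le_abs_self _))
    rw [add_comm (((n:ℝ)+b)^2)] at a2
    linarith

lemma ms_full (c : ℕ → ℂ) (hc : ∀ n, ‖c n‖ ≤ 2) (b : ℝ) (hb : 0 < b) (ω : ℂ) (hω : 0 < ω.re) (hi : 1/2 ≤ |ω.im|)
    (y0 y1 : ℝ) (h0 : 0 ≤ y0) (h01 : y0 ≤ y1) (h1 : y1 ≤ y0 + 1) :
    ∫ y in y0..y1, ‖Sfam c b (ω * (Real.exp y : ℝ)) * (Real.exp (y/4) : ℝ)‖^2 ≤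
        4 * (1/b+1) / Real.sqrt (Real.pi * ω.re) * (y1 - y0) +
        48 * Koff * (Real.pi * ω.re) ^ (-(3/8) : ℝ) := by
  have hre : ∀ y : ℝ, (ω * (Real.exp y : ℝ)).re = Real.exp y * ω.re := fun y => by
    rw [mul_comm, Complex.re_ofReal_mul]
  have ht : Filter.Tendsto (fun N : ℕ => ∫ y in y0..y1, ‖(∑ n ∈ Finset.range N, c n * cexp (-(Real.pi * ((n:ℝ) + b : ℝ) ^ 2 * (ω * (Real.exp y : ℝ))))) *
      (Real.exp (y/4) : ℝ)‖^2) Filter.atTop (nhds (∫ y in y0..y1, ‖Sfam c b (ω * (Real.exp y : ℝ)) * (Real.exp (y/4) : ℝ)‖^2)) := by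
    refine intervalIntegral.tendsto_integral_filter_of_dominated_convergence
      (fun y => ((2 * Real.exp (-(Real.pi * b ^ 2 * (Real.exp y * ω.re))) / (1 - Real.exp (-(Real.pi * (Real.exp y * ω.re))))) * Real.exp (y/4))^2) ?_ ?_ ?_ ?_
    · refine Filter.Eventually.of_forall fun N => Continuous.aestronglyMeasurable (by fun_prop)
    · refine Filter.Eventually.of_forall fun N => Filter.Eventually.of_forall fun y _ => ?_
      rw [Real.norm_of_nonneg (by positivity), norm_mul, Complex.norm_real, Real.norm_of_nonneg (Real.exp_pos _).le]
      have := norm_partial_le c 2 hc b hb (ω * (Real.exp y : ℝ)) (by rw [hre]; positivity) (Finset.range N)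
      rw [hre] at this
      gcongr
    · refine Continuous.intervalIntegrable ?_ _ _
      refine Continuous.pow (Continuous.mul (Continuous.div (by fun_prop) (by fun_prop) fun y => ?_) (by fun_prop)) 2
      have := geom_lt_one (Real.exp y * ω.re) (by positivity)
      linarith
    · refine Filter.Eventually.of_forall fun y _ => ?_
      have := (summable_Sfam c 2 hc b hb (ω * (Real.exp y : ℝ)) (by rw [hre]; positivity)).hasSum.tendsto_sum_nat
      exact ((this.mul_const _).norm).pow 2
  exact le_of_tendsto ht (Filter.Eventually.of_forall fun N => ms_partial c hc b hb ω hω hi y0 y1 h0 h01 h1 N)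


noncomputable def fth (a : ℝ) (ω : ℂ) (y : ℝ) : ℂ := Gth a (ω * (Real.exp y : ℝ)) * (Real.exp (y/4) : ℝ)

lemma re_ωexp (ω : ℂ) (y : ℝ) : (ω * (Real.exp y : ℝ)).re = Real.exp y * ω.re := by
  rw [mul_comm, Complex.re_ofReal_mul]

lemma cont_Sfam (c : ℕ → ℂ) (hc : ∀ n, ‖c n‖ ≤ 2) (b : ℝ) (hb : 0 < b) (ω : ℂ) (hω : 0 < ω.re) :
    Continuous (fun y : ℝ => Sfam c b (ω * (Real.exp y : ℝ))) := by
  rw [continuous_iff_continuousAt]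
  intro y
  have h : ContinuousOn (fun y : ℝ => Sfam c b (ω * (Real.exp y : ℝ))) (Set.Ioi (y-1)) := by
    unfold Sfam
    refine continuousOn_tsum (u := fun n : ℕ => 2 * Real.exp (-(Real.pi * ((n:ℝ) + b) ^ 2 * (Real.exp (y-1) * ω.re))))
      (fun n => by fun_prop) ((summable_gauss b hb _ (by positivity)).mul_left 2) ?_
    intro n x hx
    rw [norm_mul, norm_term, re_ωexp]
    have : Real.exp (y-1) ≤ Real.exp x := Real.exp_le_exp.2 (le_of_lt hx)
    have hp := Real.pi_pos
    gcongr
    exact hc n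
  exact h.continuousAt (Ioi_mem_nhds (by linarith))

lemma cont_half (ω : ℂ) (hω : 0 < ω.re) : Continuous (fun y : ℝ => (ω * (Real.exp y : ℝ)) ^ (-(1/2) : ℂ)) := by
  rw [continuous_iff_continuousAt]
  intro y
  refine ContinuousAt.cpow (by fun_prop) continuousAt_const (Or.inl ?_)
  rw [re_ωexp]; positivity

lemma cont_fth (a : ℝ) (ha : 0 < a) (ha' : a ≤ 1/2) (ω : ℂ) (hω : 0 < ω.re) : Continuous (fth a ω) := by
  unfold fth Gth Stot
  have h1 := cont_Sfam cone cone_le a ha ω hω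
  have h2 := cont_Sfam cone cone_le (1-a) (by linarith) ω hω
  have h3 := cont_Sfam (ccos a) (ccos_le a) 1 one_pos ω hω
  exact ((h1.add (h2.add h3)).sub (cont_half ω hω)).mul (by fun_prop)

lemma norm_half (w : ℂ) (hw : w ≠ 0) (r : ℝ) (s : ℂ) (hs : s = (r:ℂ)) : ‖w ^ s‖ = ‖w‖ ^ r := by
  subst hs; exact Complex.norm_cpow_real w r

lemma norm_ωexp (ω : ℂ) (h1 : ‖ω‖ = 1) (y : ℝ) : ‖ω * (Real.exp y : ℝ)‖ = Real.exp y := by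
  rw [norm_mul, h1, one_mul, Complex.norm_real, Real.norm_of_nonneg (Real.exp_pos _).le]

lemma half_small (ω : ℂ) (hω : 0 < ω.re) (h1 : ‖ω‖ = 1) (y : ℝ) :
    ‖(ω * (Real.exp y : ℝ)) ^ (-(1/2) : ℂ) * (Real.exp (y/4) : ℝ)‖ = Real.exp (-(y/4)) := by
  have h0 : ω * (Real.exp y : ℝ) ≠ 0 := by
    intro h; have := norm_ωexp ω h1 y; rw [h, norm_zero] at this; exact (Real.exp_pos y).ne this
  rw [norm_mul, norm_half _ h0 (-(1/2)) _ (by push_cast; ring), norm_ωexp ω h1, Complex.norm_real,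
    Real.norm_of_nonneg (Real.exp_pos _).le, ← Real.exp_mul, ← Real.exp_add]
  congr 1; ring

lemma fth_neg (a : ℝ) (ha : 0 < a) (ha' : a ≤ 1/2) (ω : ℂ) (hω : 0 < ω.re) (h1 : ‖ω‖ = 1) (y : ℝ) :
    ‖fth a ω (-y)‖ = ‖fth a (1/ω) y‖ := by
  have hω0 : ω ≠ 0 := by rintro rfl; simp at hω
  unfold fth
  have h1' : ‖1/ω‖ = 1 := by rw [norm_div, h1]; simp
  have h := Gth_fe a ha (by linarith) (1/ω * (Real.exp y : ℝ)) (by rw [re_ωexp]; have := inv_re_pos ω hω; positivity)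
  have e : 1 / (1/ω * ((Real.exp y : ℝ):ℂ)) = ω * (Real.exp (-y) : ℝ) := by
    have : ((Real.exp (-y) : ℝ):ℂ) = ((Real.exp y : ℝ):ℂ)⁻¹ := by rw [Real.exp_neg]; push_cast; rfl
    rw [this]
    have : ((Real.exp y : ℝ):ℂ) ≠ 0 := by exact_mod_cast (Real.exp_pos y).ne'
    field_simp
  rw [e] at h
  have h0 : 1/ω * ((Real.exp y : ℝ):ℂ) ≠ 0 := by
    intro h; have := norm_ωexp (1/ω) h1' y; rw [h, norm_zero] at this; exact (Real.exp_pos y).ne this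
  rw [h, norm_mul, norm_mul, norm_mul, norm_half _ h0 (1/2) _ (by push_cast; ring), norm_ωexp _ h1', Complex.norm_real,
    Complex.norm_real, Real.norm_of_nonneg (Real.exp_pos _).le, Real.norm_of_nonneg (Real.exp_pos _).le, ← Real.exp_mul]
  rw [mul_comm (Real.exp (y * (1/2))), mul_assoc, ← Real.exp_add]
  congr 2; ring

lemma inv_unit (ω : ℂ) (h1 : ‖ω‖ = 1) : 1/ω = (starRingEnd ℂ) ω := by
  rw [one_div, Complex.inv_def, Complex.normSq_eq_norm_sq, h1]; simp

lemma fth_bdd_pos (a : ℝ) (ha : 0 < a) (ha' : a ≤ 1/2) (ω : ℂ) (hω : 0 < ω.re) (h1 : ‖ω‖ = 1) :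
    ∃ K, ∀ y, 0 ≤ y → ‖fth a ω y‖ ≤ K := by
  have hd : 0 < 1 - Real.exp (-(Real.pi * ω.re)) := by linarith [geom_lt_one ω.re hω]
  refine ⟨6 / (1 - Real.exp (-(Real.pi * ω.re))) / (Real.pi * a^2 * ω.re) + 1, fun y hy => ?_⟩
  unfold fth Gth
  rw [sub_mul]
  refine (norm_sub_le _ _).trans (add_le_add ?_ ?_)
  · have h := Stot_decay a ha ha' (ω * (Real.exp y : ℝ)) (by rw [re_ωexp]; positivity)
    rw [re_ωexp] at h
    have hy1 : 1 ≤ Real.exp y := Real.one_le_exp hy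
    have hp := Real.pi_pos
    have h2 : Real.exp (-(Real.pi * (Real.exp y * ω.re))) ≤ Real.exp (-(Real.pi * ω.re)) := by
      apply Real.exp_le_exp.2
      have := mul_pos hp hω
      nlinarith
    rw [norm_mul, Complex.norm_real, Real.norm_of_nonneg (Real.exp_pos _).le]
    have h3 : Real.exp (-(Real.pi * a^2 * (Real.exp y * ω.re))) ≤ 1 / (Real.pi * a^2 * ω.re) / Real.exp y := by
      rw [div_div, Real.exp_neg, one_div]
      apply inv_anti₀ (by positivity)
      have := Real.add_one_le_exp (Real.pi * a^2 * (Real.exp y * ω.re))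
      nlinarith
    have h4 : Real.exp (y/4) ≤ Real.exp y := Real.exp_le_exp.2 (by linarith)
    calc _ ≤ (6 * (1 / (Real.pi * a^2 * ω.re) / Real.exp y) / (1 - Real.exp (-(Real.pi * ω.re)))) * Real.exp y := by
          gcongr
          refine h.trans ?_
          gcongr
      _ = _ := by
        have := Real.exp_pos y
        field_simp
  · rw [half_small ω hω h1]
    exact Real.exp_le_one_iff.2 (by linarith)

lemma fth_bdd (a : ℝ) (ha : 0 < a) (ha' : a ≤ 1/2) (ω : ℂ) (hω : 0 < ω.re) (h1 : ‖ω‖ = 1) :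
    ∃ K, ∀ y, ‖fth a ω y‖ ≤ K := by
  obtain ⟨K, hK⟩ := fth_bdd_pos a ha ha' ω hω h1
  obtain ⟨K', hK'⟩ := fth_bdd_pos a ha ha' (1/ω) (inv_re_pos ω hω) (by rw [norm_div, h1]; simp)
  refine ⟨max K K', fun y => ?_⟩
  rcases le_total 0 y with h | h
  · exact (hK y h).trans (le_max_left _ _)
  · have := fth_neg a ha ha' ω hω h1 (-y)
    rw [neg_neg] at this
    rw [this]
    exact (hK' (-y) (by linarith)).trans (le_max_right _ _)

lemma exp_split (v y : ℝ) : cexp (((1/4 : ℂ) + v * I) * y) = (Real.exp (y/4) : ℝ) * cexp (I * v * y) := by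
  rw [Complex.ofReal_exp, ← Complex.exp_add]; congr 1; push_cast; ring

lemma fth_id (a : ℝ) (ha : 0 < a) (ha' : a ≤ 1/2) (ω : ℂ) (hω : 0 < ω.re) (v : ℝ) (hv : 0 < v) :
    (1 / (Real.pi * ω)) ^ ((1/4 : ℂ) + v * I) * Complex.Gamma ((1/4 : ℂ) + v * I) * (2 * Qzeta (1/2 + (2*v : ℝ) * I) a) =
      ∫ y : ℝ, fth a ω y * cexp (I * v * y) := by
  have h := theta_id a ha ha' ω hω ((1/4 : ℂ) + v * I) (by simp) (by simp; norm_num) (by simpa using hv)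
  have e : 2 * ((1/4 : ℂ) + v * I) = 1/2 + (2*v : ℝ) * I := by push_cast; ring
  rw [e] at h
  rw [← h.2, mellin_exp_form]
  refine integral_congr_ae (Filter.Eventually.of_forall fun y => ?_)
  simp only [fth]
  rw [exp_split]; ring

lemma fth_int (a : ℝ) (ha : 0 < a) (ha' : a ≤ 1/2) (ω : ℂ) (hω : 0 < ω.re) : Integrable (fth a ω) := by
  have h := theta_id a ha ha' ω hω ((1/4 : ℂ) + (1:ℝ) * I) (by simp) (by simp; norm_num) (by simp)
  have h2 := (mellinConvergent_exp_form _ _ h.1).norm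
  refine (integrable_norm_iff (cont_fth a ha ha' ω hω).aestronglyMeasurable).1 (h2.congr ?_)
  refine Filter.Eventually.of_forall fun y => ?_
  simp only [fth]
  rw [exp_split, norm_mul, norm_mul, norm_mul]
  have : ‖cexp (I * (1:ℝ) * y)‖ = 1 := by
    rw [Complex.norm_exp]; simp
  rw [this, mul_one]

lemma fth_int2 (a : ℝ) (ha : 0 < a) (ha' : a ≤ 1/2) (ω : ℂ) (hω : 0 < ω.re) (h1 : ‖ω‖ = 1) :
    Integrable (fun y => ‖fth a ω y‖^2) := by
  obtain ⟨K, hK⟩ := fth_bdd a ha ha' ω hω h1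
  refine Integrable.mono' ((fth_int a ha ha' ω hω).norm.const_mul K)
    (((cont_fth a ha ha' ω hω).norm.pow 2).aestronglyMeasurable) (Filter.Eventually.of_forall fun y => ?_)
  rw [Real.norm_of_nonneg (by positivity), pow_two]
  exact mul_le_mul_of_nonneg_right (hK y) (norm_nonneg _)

lemma sq4 (p q r s : ℂ) : ‖p + (q + r) - s‖^2 ≤ 4 * (‖p‖^2 + ‖q‖^2 + ‖r‖^2 + ‖s‖^2) := by
  have h : ‖p + (q + r) - s‖ ≤ ‖p‖ + ‖q‖ + ‖r‖ + ‖s‖ := by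
    have := norm_sub_le (p + (q+r)) s
    have := norm_add_le p (q+r)
    have := norm_add_le q r
    linarith
  have h2 := pow_le_pow_left₀ (norm_nonneg _) h 2
  nlinarith [sq_nonneg (‖p‖-‖q‖), sq_nonneg (‖p‖-‖r‖), sq_nonneg (‖p‖-‖s‖), sq_nonneg (‖q‖-‖r‖), sq_nonneg (‖q‖-‖s‖), sq_nonneg (‖r‖-‖s‖)]

noncomputable def Cms (a : ℝ) : ℝ := 4 * (12 * (1/a+1) + 144 * Koff + 1)

lemma ms_G (a : ℝ) (ha : 0 < a) (ha' : a ≤ 1/2) (ω : ℂ) (hω : 0 < ω.re) (h1 : ‖ω‖ = 1) (hi : 1/2 ≤ |ω.im|)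
    (L : ℝ) (hL : 0 < L) (hL1 : L ≤ 1) (hκ : Real.pi * ω.re ≤ L^8) (y0 y1 : ℝ) (h0 : 0 ≤ y0) (h01 : y1 = y0 + L) :
    ∫ y in y0..y1, ‖fth a ω y‖^2 ≤ Cms a * L / Real.sqrt (Real.pi * ω.re) := by
  have hκ0 : 0 < Real.pi * ω.re := mul_pos Real.pi_pos hω
  set κ := Real.pi * ω.re
  have hκ1 : κ ≤ 1 := hκ.trans (pow_le_one₀ hL.le hL1)
  have hy : y0 ≤ y1 := by linarith
  have hy1 : y1 ≤ y0 + 1 := by linarith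
  have m1 := ms_full cone cone_le a ha ω hω hi y0 y1 h0 hy hy1
  have m2 := ms_full cone cone_le (1-a) (by linarith) ω hω hi y0 y1 h0 hy hy1
  have m3 := ms_full (ccos a) (ccos_le a) 1 one_pos ω hω hi y0 y1 h0 hy hy1
  have c1 := cont_Sfam cone cone_le a ha ω hω
  have c2 := cont_Sfam cone cone_le (1-a) (by linarith) ω hω
  have c3 := cont_Sfam (ccos a) (ccos_le a) 1 one_pos ω hω
  have c4 := cont_half ω hω
  have ce : Continuous fun y : ℝ => ((Real.exp (y/4) : ℝ) : ℂ) := by fun_prop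
  have m4 : ∫ y in y0..y1, ‖(ω * (Real.exp y : ℝ)) ^ (-(1/2) : ℂ) * (Real.exp (y/4) : ℝ)‖^2 ≤ L := by
    have : ∫ y in y0..y1, ‖(ω * (Real.exp y : ℝ)) ^ (-(1/2) : ℂ) * (Real.exp (y/4) : ℝ)‖^2 ≤ ∫ y in y0..y1, (1:ℝ) := by
      refine intervalIntegral.integral_mono_on hy (((c4.mul ce).norm.pow 2).intervalIntegrable _ _)
        (continuous_const.intervalIntegrable _ _) fun y hy => ?_
      rw [half_small ω hω h1]
      have : Real.exp (-(y/4)) ≤ 1 := Real.exp_le_one_iff.2 (by linarith [hy.1])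
      exact pow_le_one₀ (Real.exp_pos _).le this
    rw [intervalIntegral.integral_const, smul_eq_mul, mul_one] at this
    linarith
  have big : ∫ y in y0..y1, ‖fth a ω y‖^2 ≤ ∫ y in y0..y1, 4 * (‖Sfam cone a (ω * (Real.exp y : ℝ)) * (Real.exp (y/4) : ℝ)‖^2 +
      ‖Sfam cone (1-a) (ω * (Real.exp y : ℝ)) * (Real.exp (y/4) : ℝ)‖^2 + ‖Sfam (ccos a) 1 (ω * (Real.exp y : ℝ)) * (Real.exp (y/4) : ℝ)‖^2 +
      ‖(ω * (Real.exp y : ℝ)) ^ (-(1/2) : ℂ) * (Real.exp (y/4) : ℝ)‖^2) := by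
    refine intervalIntegral.integral_mono_on hy (((cont_fth a ha ha' ω hω).norm.pow 2).intervalIntegrable _ _)
      (Continuous.intervalIntegrable (by fun_prop) _ _) fun y _ => ?_
    have e : fth a ω y = Sfam cone a (ω * (Real.exp y : ℝ)) * (Real.exp (y/4) : ℝ) + (Sfam cone (1-a) (ω * (Real.exp y : ℝ)) * (Real.exp (y/4) : ℝ)
       + Sfam (ccos a) 1 (ω * (Real.exp y : ℝ)) * (Real.exp (y/4) : ℝ)) - (ω * (Real.exp y : ℝ)) ^ (-(1/2) : ℂ) * (Real.exp (y/4) : ℝ) := by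
      unfold fth Gth Stot; ring
    rw [e]; exact sq4 _ _ _ _
  rw [intervalIntegral.integral_const_mul, intervalIntegral.integral_add (Continuous.intervalIntegrable (by fun_prop) _ _) (Continuous.intervalIntegrable (by fun_prop) _ _),
    intervalIntegral.integral_add (Continuous.intervalIntegrable (by fun_prop) _ _) (Continuous.intervalIntegrable (by fun_prop) _ _),
    intervalIntegral.integral_add (Continuous.intervalIntegrable (by fun_prop) _ _) (Continuous.intervalIntegrable (by fun_prop) _ _)] at big
  have hs : 0 < Real.sqrt κ := Real.sqrt_pos.2 hκ0
  have k1 : κ ^ (-(3/8) : ℝ) ≤ L / Real.sqrt κ := by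
    rw [le_div_iff₀ hs, Real.sqrt_eq_rpow, ← Real.rpow_add hκ0]
    have : κ ^ ((-(3/8) : ℝ) + 1/2) ≤ (L^8) ^ ((-(3/8) : ℝ) + 1/2) := Real.rpow_le_rpow hκ0.le hκ (by norm_num)
    refine this.trans (le_of_eq ?_)
    rw [← Real.rpow_natCast_mul hL.le]; norm_num
  have k2 : L ≤ L / Real.sqrt κ := by
    rw [le_div_iff₀ hs]
    have : Real.sqrt κ ≤ 1 := Real.sqrt_le_one.2 hκ1
    nlinarith
  have hyL : y1 - y0 = L := by linarith
  rw [hyL] at m1 m2 m3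
  have k3 : 1/(1-a) ≤ 1/a := one_div_le_one_div_of_le ha (by linarith)
  have k4 : (1:ℝ)/1 ≤ 1/a := one_div_le_one_div_of_le ha (by linarith)
  have hX : 0 < L / Real.sqrt κ := by positivity
  set X := L / Real.sqrt κ
  have r : ∀ q : ℝ, 4 * q / Real.sqrt κ * L = 4 * q * X := fun q => by simp only [X]; ring
  rw [r] at m1 m2 m3
  have hKo := Koff_nonneg
  have e : Cms a * L / Real.sqrt κ = 4 * (12 * (1/a+1) + 144 * Koff + 1) * X := by unfold Cms; simp only [X]; ring
  rw [e]
  have k5 := mul_le_mul_of_nonneg_left k1 hKo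
  have k6 := mul_le_mul_of_nonneg_right k3 hX.le
  have k7 := mul_le_mul_of_nonneg_right k4 hX.le
  nlinarith

lemma theta_ms (a : ℝ) (ha : 0 < a) (ha' : a ≤ 1/2) (ω : ℂ) (hω : 0 < ω.re) (h1 : ‖ω‖ = 1) (hi : 1/2 ≤ |ω.im|)
    (H : ℝ) (hH : 1 ≤ H) (hκ : Real.pi * ω.re ≤ (1/H)^8) (A B : ℝ) (hAB : A ≤ B) :
    ∫ t in A..B, ‖∫ v in t..t+H, ∫ y, fth a ω y * cexp (I*v*y)‖^2 ≤
      36 * Real.pi * Cms a * H / Real.sqrt (Real.pi * ω.re) := by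
  have hH0 : 0 < H := by linarith
  have hL : 0 < 1/H := by positivity
  have hL1 : 1/H ≤ 1 := by rw [div_le_one hH0]; exact hH
  have hκ0 : 0 < Real.pi * ω.re := mul_pos Real.pi_pos hω
  have hc : 0 ≤ Cms a := by unfold Cms; have := Koff_nonneg; positivity
  have h1' : ‖1/ω‖ = 1 := by rw [norm_div, h1]; simp
  have hre : (1/ω).re = ω.re := by rw [inv_unit ω h1, Complex.conj_re]
  have him : |(1/ω).im| = |ω.im| := by rw [inv_unit ω h1, Complex.conj_im, abs_neg]
  set M := Cms a * (1/H) / Real.sqrt (Real.pi * ω.re) with hM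
  have hM0 : 0 ≤ M := by positivity
  have g : ∀ y0 y1 : ℝ, 0 ≤ y0 → y1 = y0 + 1/H → ∫ y in y0..y1, ‖fth a ω y‖^2 ≤ M := fun y0 y1 h0 h01 =>
    ms_G a ha ha' ω hω h1 hi (1/H) hL hL1 hκ y0 y1 h0 h01
  have g' : ∀ y0 y1 : ℝ, 0 ≤ y0 → y1 = y0 + 1/H → ∫ y in y0..y1, ‖fth a ω (-y)‖^2 ≤ M := fun y0 y1 h0 h01 => by
    simp_rw [fth_neg a ha ha' ω hω h1]
    have := ms_G a ha ha' (1/ω) (by rwa [hre]) h1' (by rwa [him]) (1/H) hL hL1 (by rwa [hre]) y0 y1 h0 h01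
    rwa [hre] at this
  have h := planchW (fth a ω) (fth_int a ha ha' ω hω) (fth_int2 a ha ha' ω hω h1) A B hAB H (1/H) M M hH0.le hL hM0
    (g _ _ le_rfl (by ring)) (fun k => g _ _ (by positivity) (by ring)) (g' _ _ le_rfl (by ring)) (fun k => g' _ _ (by positivity) (by ring))
  refine h.trans (le_of_eq ?_)
  rw [hM]
  have := Real.sqrt_pos.2 hκ0
  field_simp
  ring


lemma norm_shift (σ v : ℝ) (j : ℕ) : ‖((σ:ℂ) + v * I) + j‖ = Real.sqrt ((σ + j)^2 + v^2) := by
  have : ((σ:ℂ) + v * I) + j = ((σ + j : ℝ):ℂ) + (v:ℝ) * I := by push_cast; ring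
  rw [this, Complex.norm_add_mul_I]

lemma norm_GS (σ v : ℝ) (n : ℕ) (hn : 0 < n) :
    ‖Complex.GammaSeq ((σ:ℂ) + v * I) n‖ = (n:ℝ)^σ * n.factorial / ∏ j ∈ Finset.range (n+1), Real.sqrt ((σ + j)^2 + v^2) := by
  rw [Complex.GammaSeq, norm_div, norm_mul, Complex.norm_natCast_cpow_of_pos hn, Complex.norm_natCast, norm_prod]
  simp_rw [norm_shift]
  simp

lemma gfac (y v : ℝ) (hy : 1/2 < y) :
    Real.sqrt (y^2+v^2)^2 * (Real.sqrt ((y-1/2)^2+0^2) * Real.sqrt ((y+1/2)^2+0^2)) ≤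
      Real.sqrt (y^2+0^2)^2 * (Real.sqrt ((y-1/2)^2+v^2) * Real.sqrt ((y+1/2)^2+v^2)) := by
  have e1 : Real.sqrt ((y-1/2)^2+0^2) = y - 1/2 := by
    rw [zero_pow two_ne_zero, add_zero, Real.sqrt_sq (by linarith)]
  have e2 : Real.sqrt ((y+1/2)^2+0^2) = y + 1/2 := by
    rw [zero_pow two_ne_zero, add_zero, Real.sqrt_sq (by linarith)]
  rw [e1, e2, Real.sq_sqrt (by positivity), Real.sq_sqrt (by positivity), ← Real.sqrt_mul (by positivity)]
  have hy3 : 0 ≤ y - 1/2 := by linarith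
  refine (sq_le_sq₀ (by positivity) (by positivity)).1 ?_
  rw [mul_pow, mul_pow _ (Real.sqrt _), Real.sq_sqrt (by positivity)]
  have hy2 : 1/4 ≤ y^2 := by nlinarith
  have : 0 ≤ v^2 * (3/2 * (y^2)^2 - y^2/8) + (v^2)^2 * (y^2/2 - 1/16) := by
    have := sq_nonneg v
    have h1 : 0 ≤ 3/2 * (y^2)^2 - y^2/8 := by nlinarith
    have h2 : 0 ≤ y^2/2 - 1/16 := by linarith
    positivity
  nlinarith

lemma gineq (v : ℝ) :
    ‖Complex.Gamma (((3/4:ℝ):ℂ) + v * I)‖ * ‖Complex.Gamma (((7/4:ℝ):ℂ) + v * I)‖ * ‖Complex.Gamma (((5/4:ℝ):ℂ) + (0:ℝ) * I)‖^2 ≤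
    ‖Complex.Gamma (((3/4:ℝ):ℂ) + (0:ℝ) * I)‖ * ‖Complex.Gamma (((7/4:ℝ):ℂ) + (0:ℝ) * I)‖ * ‖Complex.Gamma (((5/4:ℝ):ℂ) + v * I)‖^2 := by
  have T := fun s : ℂ => (Complex.GammaSeq_tendsto_Gamma s).norm
  refine le_of_tendsto_of_tendsto (((T _).mul (T _)).mul ((T _).pow 2)) (((T _).mul (T _)).mul ((T _).pow 2)) ?_
  filter_upwards [Filter.eventually_gt_atTop 0] with n hn
  simp only [norm_GS _ _ n hn]
  have hpos : ∀ σ u : ℝ, 0 < σ → 0 < ∏ j ∈ Finset.range (n+1), Real.sqrt ((σ + j)^2 + u^2) := fun σ u hσ =>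
    Finset.prod_pos fun j _ => Real.sqrt_pos.2 (by positivity)
  have h3 := hpos (3/4) v (by norm_num)
  have h7 := hpos (7/4) v (by norm_num)
  have h5 := hpos (5/4) v (by norm_num)
  have h30 := hpos (3/4) 0 (by norm_num)
  have h70 := hpos (7/4) 0 (by norm_num)
  have h50 := hpos (5/4) 0 (by norm_num)
  have key : (∏ j ∈ Finset.range (n+1), Real.sqrt ((5/4 + (j:ℝ))^2 + v^2))^2 *
      ((∏ j ∈ Finset.range (n+1), Real.sqrt ((3/4 + (j:ℝ))^2 + 0^2)) * (∏ j ∈ Finset.range (n+1), Real.sqrt ((7/4 + (j:ℝ))^2 + 0^2))) ≤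
      (∏ j ∈ Finset.range (n+1), Real.sqrt ((5/4 + (j:ℝ))^2 + 0^2))^2 *
      ((∏ j ∈ Finset.range (n+1), Real.sqrt ((3/4 + (j:ℝ))^2 + v^2)) * (∏ j ∈ Finset.range (n+1), Real.sqrt ((7/4 + (j:ℝ))^2 + v^2))) := by
    simp only [← Finset.prod_pow, ← Finset.prod_mul_distrib]
    refine Finset.prod_le_prod (fun j _ => by positivity) fun j _ => ?_
    have := gfac (5/4 + (j:ℝ)) v (by have : (0:ℝ) ≤ j := Nat.cast_nonneg j; linarith)
    have e1 : (5/4 + (j:ℝ)) - 1/2 = 3/4 + j := by ring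
    have e2 : (5/4 + (j:ℝ)) + 1/2 = 7/4 + j := by ring
    rwa [e1, e2] at this
  set p3 := ∏ j ∈ Finset.range (n+1), Real.sqrt ((3/4 + (j:ℝ))^2 + v^2)
  set p7 := ∏ j ∈ Finset.range (n+1), Real.sqrt ((7/4 + (j:ℝ))^2 + v^2)
  set p5 := ∏ j ∈ Finset.range (n+1), Real.sqrt ((5/4 + (j:ℝ))^2 + v^2)
  set q3 := ∏ j ∈ Finset.range (n+1), Real.sqrt ((3/4 + (j:ℝ))^2 + 0^2)
  set q7 := ∏ j ∈ Finset.range (n+1), Real.sqrt ((7/4 + (j:ℝ))^2 + 0^2)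
  set q5 := ∏ j ∈ Finset.range (n+1), Real.sqrt ((5/4 + (j:ℝ))^2 + 0^2)
  set N3 := (n:ℝ)^(3/4:ℝ) * (n.factorial:ℝ)
  set N7 := (n:ℝ)^(7/4:ℝ) * (n.factorial:ℝ)
  set N5 := (n:ℝ)^(5/4:ℝ) * (n.factorial:ℝ)
  have e1 : N3 / p3 * (N7 / p7) * (N5 / q5)^2 = N3 * N7 * N5^2 / (q5^2 * (p3 * p7)) := by field_simp
  have e2 : N3 / q3 * (N7 / q7) * (N5 / p5)^2 = N3 * N7 * N5^2 / (p5^2 * (q3 * q7)) := by field_simp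
  rw [e1, e2]
  have : 0 ≤ N3 * N7 * N5^2 := by positivity
  gcongr

lemma norm_sin_le (z : ℂ) : ‖Complex.sin z‖ ≤ Real.exp |z.im| := by
  rw [Complex.sin, norm_div, norm_mul, Complex.norm_I, mul_one]
  have h := norm_sub_le (cexp (-z * I)) (cexp (z * I))
  rw [Complex.norm_exp, Complex.norm_exp] at h
  have e1 : (-z * I).re = z.im := by simp
  have e2 : (z * I).re = -z.im := by simp
  rw [e1, e2] at h
  have h1 : Real.exp z.im ≤ Real.exp |z.im| := Real.exp_le_exp.2 (le_abs_self _)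
  have h2 : Real.exp (-z.im) ≤ Real.exp |z.im| := Real.exp_le_exp.2 (neg_le_abs _)
  have : ‖(2:ℂ)‖ = 2 := by simp
  rw [this]; linarith

lemma gamma_half (u : ℝ) : Real.pi * Real.exp (-(Real.pi * |u|)) ≤ ‖Complex.Gamma ((1/2 : ℂ) + u * I)‖^2 := by
  have h := Complex.Gamma_mul_Gamma_one_sub ((1/2 : ℂ) + u * I)
  have e : 1 - ((1/2 : ℂ) + u * I) = (starRingEnd ℂ) ((1/2 : ℂ) + u * I) := by
    apply Complex.ext <;> simp; norm_num
  rw [e, Complex.Gamma_conj, Complex.mul_conj, Complex.normSq_eq_norm_sq] at h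
  have h2 := congrArg norm h
  rw [Complex.norm_real, Real.norm_of_nonneg (by positivity), norm_div, Complex.norm_real, Real.norm_of_nonneg Real.pi_pos.le] at h2
  rw [h2]
  have h3 := norm_sin_le (Real.pi * ((1/2 : ℂ) + u * I))
  rw [Complex.im_ofReal_mul] at h3
  have e3 : ((1/2 : ℂ) + u * I).im = u := by simp
  rw [e3, abs_mul, abs_of_pos Real.pi_pos] at h3
  have hs : 0 < ‖Complex.sin (Real.pi * ((1/2 : ℂ) + u * I))‖ := by
    rcases (norm_nonneg (Complex.sin (Real.pi * ((1/2 : ℂ) + u * I)))).eq_or_lt with h4 | h4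
    · rw [← h4, div_zero] at h2
      have hg : Complex.Gamma ((1/2 : ℂ) + u * I) ≠ 0 := Complex.Gamma_ne_zero_of_re_pos (by simp)
      exact absurd (pow_eq_zero_iff two_ne_zero |>.1 h2) (norm_ne_zero_iff.2 hg)
    · exact h4
  rw [Real.exp_neg, ← div_eq_mul_inv]
  have := Real.pi_pos
  gcongr

lemma gamma_low : ∃ c > (0:ℝ), ∀ v : ℝ, 1 ≤ v → c ≤ v * ‖Complex.Gamma ((1/4 : ℂ) + v * I)‖^4 * Real.exp (2 * Real.pi * v) := by
  set G3 := ‖Complex.Gamma (((3/4:ℝ):ℂ) + (0:ℝ) * I)‖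
  set G7 := ‖Complex.Gamma (((7/4:ℝ):ℂ) + (0:ℝ) * I)‖
  set G5 := ‖Complex.Gamma (((5/4:ℝ):ℂ) + (0:ℝ) * I)‖
  have g3 : 0 < G3 := norm_pos_iff.2 (Complex.Gamma_ne_zero_of_re_pos (by simp))
  have g7 : 0 < G7 := norm_pos_iff.2 (Complex.Gamma_ne_zero_of_re_pos (by simp))
  have g5 : 0 < G5 := norm_pos_iff.2 (Complex.Gamma_ne_zero_of_re_pos (by simp))
  refine ⟨G5^2 / (2 * G3 * G7) * (2 * Real.pi^2), by positivity, fun v hv => ?_⟩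
  have h := gineq v
  have hv0 : (0:ℝ) < v := by linarith
  have ne1 : ((1/4 : ℂ) + v * I) ≠ 0 := by intro h; have := congrArg Complex.re h; simp at this
  have ne3 : (((3/4:ℝ):ℂ) + v * I) ≠ 0 := by intro h; have := congrArg Complex.re h; simp at this
  have e5 : (((5/4:ℝ):ℂ) + v * I) = ((1/4 : ℂ) + v * I) + 1 := by push_cast; ring
  have e7 : (((7/4:ℝ):ℂ) + v * I) = (((3/4:ℝ):ℂ) + v * I) + 1 := by push_cast; ring
  rw [e5, e7, Complex.Gamma_add_one _ ne1, Complex.Gamma_add_one _ ne3, norm_mul, norm_mul] at h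
  have n3 : v ≤ ‖((3/4:ℝ):ℂ) + v * I‖ := by
    have := Complex.abs_im_le_norm (((3/4:ℝ):ℂ) + v * I)
    simp only [add_im, ofReal_im, mul_im, ofReal_re, I_im, mul_one, I_re, mul_zero, add_zero, zero_add] at this
    exact (le_abs_self v).trans this
  have n1 : ‖(1/4 : ℂ) + v * I‖^2 ≤ 2 * v^2 := by
    have : (1/4 : ℂ) + v * I = ((1/4 : ℝ):ℂ) + v * I := by push_cast; ring
    rw [this, Complex.norm_add_mul_I, Real.sq_sqrt (by positivity)]
    nlinarith
  have d := Complex.Gamma_mul_Gamma_add_half ((1/4 : ℂ) + v * I)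
  have e3 : (1/4 : ℂ) + v * I + 1/2 = ((3/4:ℝ):ℂ) + v * I := by push_cast; ring
  have e2 : 2 * ((1/4 : ℂ) + v * I) = (1/2 : ℂ) + (2*v : ℝ) * I := by push_cast; ring
  rw [e3, e2] at d
  have d2 := congrArg norm d
  rw [norm_mul, norm_mul, norm_mul] at d2
  have n2 : ‖(2:ℂ) ^ (1 - ((1/2 : ℂ) + (2*v : ℝ) * I))‖ = (2:ℝ)^(1/2:ℝ) := by
    have := Complex.norm_cpow_eq_rpow_re_of_pos (by norm_num : (0:ℝ) < 2) (1 - ((1/2 : ℂ) + (2*v : ℝ) * I))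
    rw [Complex.ofReal_ofNat] at this
    rw [this]; congr 1; simp; norm_num
  have npi : ‖((Real.sqrt Real.pi : ℝ) : ℂ)‖ = Real.sqrt Real.pi := by
    rw [Complex.norm_real, Real.norm_of_nonneg (Real.sqrt_nonneg _)]
  rw [n2, npi] at d2
  have gh := gamma_half (2*v)
  rw [abs_of_pos (by linarith : 0 < 2*v)] at gh
  set g1 := ‖Complex.Gamma ((1/4 : ℂ) + v * I)‖
  set g3v := ‖Complex.Gamma (((3/4:ℝ):ℂ) + v * I)‖
  set gg := ‖Complex.Gamma ((1/2 : ℂ) + (2*v : ℝ) * I)‖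
  have hg1 : 0 ≤ g1 := norm_nonneg _
  have hg3 : 0 ≤ g3v := norm_nonneg _
  have sq2 : ((2:ℝ)^(1/2:ℝ))^2 = 2 := by rw [← Real.sqrt_eq_rpow]; exact Real.sq_sqrt (by norm_num)
  have sqpi : (Real.sqrt Real.pi)^2 = Real.pi := Real.sq_sqrt Real.pi_pos.le
  have k1 : g1^2 * g3v^2 = gg^2 * (2 * Real.pi) := by
    rw [← mul_pow, d2, mul_pow, mul_pow, sq2, sqpi]; ring
  -- main inequality
  have k2 : g3v^2 * v * G5^2 ≤ G3 * G7 * (2 * v^2 * g1^2) := by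
    calc g3v^2 * v * G5^2 ≤ g3v^2 * ‖((3/4:ℝ):ℂ) + v * I‖ * G5^2 := by gcongr
      _ = g3v * (‖((3/4:ℝ):ℂ) + v * I‖ * g3v) * G5^2 := by ring
      _ ≤ _ := h
      _ = G3 * G7 * (‖(1/4 : ℂ) + v * I‖^2 * g1^2) := by ring
      _ ≤ _ := by gcongr
  have k3 : g3v^2 * G5^2 ≤ G3 * G7 * (2 * v * g1^2) := by
    have : v * (g3v^2 * G5^2) ≤ v * (G3 * G7 * (2 * v * g1^2)) := by linarith
    exact le_of_mul_le_mul_left this hv0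
  have k4 : gg^2 * (2 * Real.pi) * G5^2 ≤ 2 * G3 * G7 * (v * g1^4) := by
    rw [← k1]
    have := mul_le_mul_of_nonneg_left k3 (sq_nonneg g1)
    nlinarith
  have k5 : 2 * Real.pi^2 * G5^2 ≤ 2 * G3 * G7 * (v * g1^4 * Real.exp (2 * Real.pi * v)) := by
    have m := mul_le_mul_of_nonneg_right k4 (Real.exp_pos (2 * Real.pi * v)).le
    have m2 := mul_le_mul_of_nonneg_right gh (Real.exp_pos (2 * Real.pi * v)).le
    rw [mul_assoc, ← Real.exp_add] at m2
    have : -(Real.pi * (2 * v)) + 2 * Real.pi * v = 0 := by ring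
    rw [this, Real.exp_zero, mul_one] at m2
    have m3 := mul_le_mul_of_nonneg_left m2 (by positivity : 0 ≤ 2 * Real.pi * G5^2)
    nlinarith
  rw [div_mul_eq_mul_div, div_le_iff₀ (by positivity)]
  linarith


noncomputable def Fth (a : ℝ) (ω : ℂ) (v : ℝ) : ℂ := ∫ y : ℝ, fth a ω y * cexp (I * v * y)

noncomputable def Rr (a : ℝ) (v : ℝ) : ℝ := (Fth a 1 v).re

lemma cont_Fth (a : ℝ) (ha : 0 < a) (ha' : a ≤ 1/2) (ω : ℂ) (hω : 0 < ω.re) : Continuous (Fth a ω) := by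
  unfold Fth
  refine continuous_of_dominated (bound := fun y => ‖fth a ω y‖) ?_ ?_ (fth_int a ha ha' ω hω).norm ?_
  · intro v
    exact ((cont_fth a ha ha' ω hω).mul (by fun_prop)).aestronglyMeasurable
  · intro v
    refine Filter.Eventually.of_forall fun y => ?_
    have : ‖cexp (I * v * y)‖ = 1 := by rw [Complex.norm_exp]; simp
    rw [norm_mul, this, mul_one]
  · refine Filter.Eventually.of_forall fun y => ?_
    fun_prop

lemma cont_Rr (a : ℝ) (ha : 0 < a) (ha' : a ≤ 1/2) : Continuous (Rr a) :=
  Complex.continuous_re.comp (cont_Fth a ha ha' 1 (by simp))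

lemma conj_Sfam (c : ℕ → ℂ) (hc : ∀ n, (starRingEnd ℂ) (c n) = c n) (b x : ℝ) :
    (starRingEnd ℂ) (Sfam c b (x:ℂ)) = Sfam c b (x:ℂ) := by
  unfold Sfam
  rw [Complex.conj_tsum]
  refine tsum_congr fun n => ?_
  simp only [map_mul, hc, ← Complex.exp_conj, map_neg, Complex.conj_ofReal, map_pow]

lemma real_half (x : ℝ) (hx : 0 ≤ x) (r : ℝ) (s : ℂ) (hs : s = (r:ℂ)) : (x:ℂ) ^ s = ((x ^ r : ℝ) : ℂ) := by
  subst hs; exact (Complex.ofReal_cpow hx r).symm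

lemma conj_fth (a y : ℝ) : (starRingEnd ℂ) (fth a 1 y) = fth a 1 y := by
  unfold fth Gth Stot
  rw [one_mul, real_half _ (Real.exp_pos y).le (-(1/2)) _ (by push_cast; ring)]
  simp only [map_mul, map_sub, map_add, Complex.conj_ofReal]
  rw [conj_Sfam cone (by simp [cone]), conj_Sfam cone (by simp [cone]), conj_Sfam (ccos a) (fun n => by simp only [ccos]; exact Complex.conj_ofReal _)]

lemma even_fth (a : ℝ) (ha : 0 < a) (ha' : a ≤ 1/2) (y : ℝ) : fth a 1 (-y) = fth a 1 y := by
  unfold fth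
  have h := Gth_fe a ha (by linarith) ((Real.exp y : ℝ) : ℂ) (by rw [Complex.ofReal_re]; positivity)
  have e : 1 / ((Real.exp y : ℝ):ℂ) = ((Real.exp (-y) : ℝ) : ℂ) := by
    rw [Real.exp_neg]; push_cast; rw [one_div]
  rw [e, real_half _ (Real.exp_pos y).le (1/2) _ (by push_cast; ring), ← Real.exp_mul] at h
  rw [one_mul, one_mul, h]
  have e2 : ((Real.exp (y/4) : ℝ) : ℂ) = (Real.exp (y * (1/2)) : ℝ) * (Real.exp (-y/4) : ℝ) := by
    rw [← Complex.ofReal_mul, ← Real.exp_add]; congr 2; ring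
  rw [e2]; ring

lemma Fth_real (a : ℝ) (ha : 0 < a) (ha' : a ≤ 1/2) (v : ℝ) : Fth a 1 v = (Rr a v : ℂ) := by
  have h : (starRingEnd ℂ) (Fth a 1 v) = Fth a 1 v := by
    unfold Fth
    rw [← integral_conj, ← integral_neg_eq_self]
    refine integral_congr_ae (Filter.Eventually.of_forall fun y => ?_)
    simp only [map_mul, conj_fth, even_fth a ha ha']
    rw [← Complex.exp_conj]
    simp
  exact (Complex.conj_eq_iff_re.1 h).symm

lemma F_struct (a : ℝ) (ha : 0 < a) (ha' : a ≤ 1/2) (φ : ℝ) (h1 : -(Real.pi/2) < φ) (h2 : φ < Real.pi/2) (v : ℝ) (hv : 0 < v) :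
    Fth a (cexp (φ * I)) v = cexp (-(φ/4) * I) * ((Real.exp (φ * v) * Rr a v : ℝ) : ℂ) := by
  have hre : 0 < (cexp (φ * I)).re := by rw [Complex.exp_ofReal_mul_I_re]; exact Real.cos_pos_of_mem_Ioo ⟨h1, h2⟩
  have i1 := fth_id a ha ha' (cexp (φ * I)) hre v hv
  have i2 := fth_id a ha ha' 1 (by simp) v hv
  rw [mul_one] at i2
  change _ = Fth a 1 v at i2
  change _ = Fth a _ v at i1
  rw [← i1, Complex.ofReal_mul (Real.exp (φ * v)), ← Fth_real a ha ha', ← i2]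
  have e0 : 1 / ((Real.pi:ℂ) * cexp (φ * I)) = cexp (-φ * I) * ((1/Real.pi : ℝ) : ℂ) := by
    have : cexp (-φ * I) = (cexp (φ * I))⁻¹ := by rw [← Complex.exp_neg]; congr 1; ring
    rw [this]; push_cast
    have := Complex.exp_ne_zero (φ * I)
    have hp : (Real.pi:ℂ) ≠ 0 := by exact_mod_cast Real.pi_pos.ne'
    field_simp
  have e1 : (cexp (-φ * I)) ^ ((1/4 : ℂ) + v * I) = cexp (-(φ/4) * I) * (Real.exp (φ * v) : ℝ) := by
    rw [Complex.cpow_def_of_ne_zero (Complex.exp_ne_zero _), Complex.log_exp (by simp; linarith [Real.pi_pos]) (by simp; linarith [Real.pi_pos]),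
      Complex.ofReal_exp, ← Complex.exp_add]
    congr 1; push_cast
    linear_combination (-φ * v : ℂ) * I_sq
  have hre' : 0 < (cexp (-φ * I)).re := by
    have := Complex.exp_ofReal_mul_I_re (-φ)
    rw [Complex.ofReal_neg] at this
    rw [this, Real.cos_neg]; exact Real.cos_pos_of_mem_Ioo ⟨h1, h2⟩
  rw [e0, mul_real_cpow _ hre' _ (by positivity), e1]
  push_cast; ring

lemma F_norm (a : ℝ) (ha : 0 < a) (ha' : a ≤ 1/2) (φ : ℝ) (h1 : -(Real.pi/2) < φ) (h2 : φ < Real.pi/2) (v : ℝ) (hv : 0 < v) :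
    ‖Fth a (cexp (φ * I)) v‖ = Real.exp (φ * v) * |Rr a v| := by
  rw [F_struct a ha ha' φ h1 h2 v hv, norm_mul, Complex.norm_real, Real.norm_eq_abs, abs_mul, abs_of_pos (Real.exp_pos _)]
  have : ‖cexp (-(φ/4) * I)‖ = 1 := by
    have := Complex.norm_exp_ofReal_mul_I (-(φ/4)); push_cast at this; exact this
  rw [this, one_mul]

lemma Rr_abs (a : ℝ) (ha : 0 < a) (ha' : a ≤ 1/2) (v : ℝ) (hv : 0 < v) :
    |Rr a v| = (1/Real.pi)^(1/4:ℝ) * ‖Complex.Gamma ((1/4 : ℂ) + v * I)‖ * (2 * ‖Qzeta (1/2 + (2*v : ℝ) * I) a‖) := by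
  have i2 := fth_id a ha ha' 1 (by simp) v hv
  rw [mul_one] at i2
  change _ = Fth a 1 v at i2
  rw [Fth_real a ha ha'] at i2
  have h := congrArg norm i2
  rw [Complex.norm_real, Real.norm_eq_abs] at h
  rw [← h, norm_mul, norm_mul, norm_mul]
  have e : (1 / (Real.pi:ℂ)) = ((1/Real.pi : ℝ) : ℂ) := by push_cast; rfl
  rw [e, Complex.norm_cpow_eq_rpow_re_of_pos (by positivity)]
  simp

lemma Rr_zero_iff (a : ℝ) (ha : 0 < a) (ha' : a ≤ 1/2) (v : ℝ) (hv : 0 < v) :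
    Rr a v = 0 ↔ Qzeta (1/2 + (2*v : ℝ) * I) a = 0 := by
  rw [← abs_eq_zero, Rr_abs a ha ha' v hv]
  have h1 : (0:ℝ) < (1/Real.pi)^(1/4:ℝ) := Real.rpow_pos_of_pos (by positivity) _
  have h2 : 0 < ‖Complex.Gamma ((1/4 : ℂ) + v * I)‖ := norm_pos_iff.2 (Complex.Gamma_ne_zero_of_re_pos (by simp))
  rw [mul_eq_zero, mul_eq_zero, mul_eq_zero]
  constructor
  · rintro ((h | h) | (h | h))
    · exact absurd h h1.ne'
    · exact absurd h h2.ne'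
    · norm_num at h
    · exact norm_eq_zero.1 h
  · intro h; right; right; rw [h, norm_zero]

lemma F_lower (a : ℝ) (ha : 0 < a) (ha' : a ≤ 1/2) : ∃ c > (0:ℝ), ∀ T : ℝ, 1 ≤ T → ∀ v, T ≤ v → v ≤ 3*T →
    c * T^(-(1/4):ℝ) * ‖Qzeta (1/2 + (2*v : ℝ) * I) a‖ ≤ Real.exp ((Real.pi/2 - 1/T) * v) * |Rr a v| := by
  obtain ⟨c, hc, h⟩ := gamma_low
  refine ⟨(c/3)^(1/4:ℝ) * Real.exp (-3) * (1/Real.pi)^(1/4:ℝ) * 2, by positivity, fun T hT v hv hv' => ?_⟩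
  have hv0 : 0 < v := by linarith
  have hT0 : 0 < T := by linarith
  rw [Rr_abs a ha ha' v hv0]
  set g := ‖Complex.Gamma ((1/4 : ℂ) + v * I)‖ with hg
  have hg0 : 0 ≤ g := norm_nonneg _
  have h1 := h v (by linarith)
  have k1 : c / (3 * T) ≤ (g * Real.exp (Real.pi/2 * v))^4 := by
    rw [mul_pow, ← Real.exp_nat_mul, div_le_iff₀ (by positivity)]
    have : ((4:ℕ):ℝ) * (Real.pi/2 * v) = 2 * Real.pi * v := by push_cast; ring
    rw [this]
    have h3 : 0 ≤ g^4 * Real.exp (2 * Real.pi * v) := by positivity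
    nlinarith
  have k2 : (c/(3*T))^(1/4:ℝ) ≤ g * Real.exp (Real.pi/2 * v) := by
    have := Real.rpow_le_rpow (by positivity) k1 (by norm_num : (0:ℝ) ≤ 1/4)
    refine this.trans (le_of_eq ?_)
    rw [← Real.rpow_natCast_mul (by positivity)]; norm_num
  have k3 : (c/(3*T))^(1/4:ℝ) = (c/3)^(1/4:ℝ) * T^(-(1/4):ℝ) := by
    rw [← div_div, Real.div_rpow (by positivity) hT0.le, Real.rpow_neg hT0.le]; rfl
  rw [k3] at k2
  have k4 : Real.exp (-3) ≤ Real.exp (-(1/T*v)) := by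
    apply Real.exp_le_exp.2
    have : 1/T*v ≤ 3 := by rw [one_div, inv_mul_le_iff₀ hT0]; linarith
    linarith
  have k5 : Real.exp ((Real.pi/2 - 1/T) * v) = Real.exp (Real.pi/2 * v) * Real.exp (-(1/T*v)) := by
    rw [← Real.exp_add]; congr 1; ring
  rw [k5]
  set q := ‖Qzeta (1/2 + (2*v : ℝ) * I) a‖
  have hq : 0 ≤ q := norm_nonneg _
  calc _ = ((c/3)^(1/4:ℝ) * T^(-(1/4):ℝ)) * Real.exp (-3) * ((1/Real.pi)^(1/4:ℝ) * 2 * q) := by ring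
    _ ≤ (g * Real.exp (Real.pi/2 * v)) * Real.exp (-(1/T*v)) * ((1/Real.pi)^(1/4:ℝ) * 2 * q) := by gcongr
    _ = _ := by ring

lemma sign_const (f : ℝ → ℝ) (hf : Continuous f) (s t : ℝ) (hst : s ≤ t) (h : ∀ v ∈ Set.Icc s t, f v ≠ 0) :
    (∀ v ∈ Set.Icc s t, 0 ≤ f v) ∨ (∀ v ∈ Set.Icc s t, f v ≤ 0) := by
  by_contra hcon
  push Not at hcon
  obtain ⟨⟨x, hx, hx0⟩, ⟨y, hy, hy0⟩⟩ := hcon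
  have := isPreconnected_Icc.intermediate_value hx hy hf.continuousOn
  obtain ⟨z, hz, hz0⟩ := this ⟨hx0.le, hy0.le⟩
  exact h z hz hz0

lemma F_const (a : ℝ) (ha : 0 < a) (ha' : a ≤ 1/2) (φ : ℝ) (h1 : -(Real.pi/2) < φ) (h2 : φ < Real.pi/2)
    (s t : ℝ) (hs : 0 < s) (hst : s ≤ t) (h : ∀ v ∈ Set.Icc s t, Rr a v ≠ 0) :
    ‖∫ v in s..t, Fth a (cexp (φ * I)) v‖ = ∫ v in s..t, Real.exp (φ * v) * |Rr a v| := by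
  have e : ∫ v in s..t, Fth a (cexp (φ * I)) v = cexp (-(φ/4) * I) * ((∫ v in s..t, Real.exp (φ * v) * Rr a v : ℝ) : ℂ) := by
    rw [← intervalIntegral.integral_ofReal, ← intervalIntegral.integral_const_mul]
    refine intervalIntegral.integral_congr fun v hv => ?_
    rw [Set.uIcc_of_le hst] at hv
    exact F_struct a ha ha' φ h1 h2 v (by linarith [hv.1])
  have en : ‖cexp (-(φ/4) * I)‖ = 1 := by
    have := Complex.norm_exp_ofReal_mul_I (-(φ/4)); push_cast at this; exact this
  rw [e, norm_mul, en, one_mul, Complex.norm_real, Real.norm_eq_abs]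
  rcases sign_const _ (cont_Rr a ha ha') s t hst h with hp | hp
  · have : ∫ v in s..t, Real.exp (φ * v) * |Rr a v| = ∫ v in s..t, Real.exp (φ * v) * Rr a v := by
      refine intervalIntegral.integral_congr fun v hv => ?_
      rw [Set.uIcc_of_le hst] at hv
      simp only [abs_of_nonneg (hp v hv)]
    rw [this]
    exact abs_of_nonneg (intervalIntegral.integral_nonneg hst fun v hv => mul_nonneg (Real.exp_pos _).le (hp v hv))
  · have : ∫ v in s..t, Real.exp (φ * v) * |Rr a v| = -∫ v in s..t, Real.exp (φ * v) * Rr a v := by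
      rw [← intervalIntegral.integral_neg]
      refine intervalIntegral.integral_congr fun v hv => ?_
      rw [Set.uIcc_of_le hst] at hv
      simp only [abs_of_nonpos (hp v hv)]; ring
    rw [this]
    refine abs_of_nonpos ?_
    rw [← neg_nonneg, ← intervalIntegral.integral_neg]
    refine intervalIntegral.integral_nonneg hst fun v hv => ?_
    have := mul_nonneg (Real.exp_pos (φ * v)).le (neg_nonneg.2 (hp v hv))
    linarith

lemma theta_T (a : ℝ) (ha : 0 < a) (ha' : a ≤ 1/2) : ∃ C > (0:ℝ), ∀ H : ℝ, 1 ≤ H → ∀ T : ℝ, 4 * H^8 ≤ T →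
    ∫ t in T..2*T, ‖∫ v in t..t+H, Fth a (cexp ((Real.pi/2 - 1/T : ℝ) * I)) v‖^2 ≤ C * H * Real.sqrt T := by
  have hK := Koff_nonneg
  have hpi := Real.pi_pos
  have hC : 0 < Cms a := by unfold Cms; positivity
  refine ⟨36 * Real.pi * Cms a, by positivity, fun H hH T hT => ?_⟩
  have hH8 : 1 ≤ H^8 := one_le_pow₀ hH
  have hT4 : 4 ≤ T := by linarith
  have hT0 : 0 < T := by linarith
  have hδ : 0 < 1/T := by positivity
  have hδ1 : 1/T ≤ 1 := by rw [div_le_one hT0]; linarith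
  set ω := cexp ((Real.pi/2 - 1/T : ℝ) * I) with hω
  have hre : ω.re = Real.sin (1/T) := by rw [hω, Complex.exp_ofReal_mul_I_re, Real.cos_pi_div_two_sub]
  have him : ω.im = Real.cos (1/T) := by rw [hω, Complex.exp_ofReal_mul_I_im, Real.sin_pi_div_two_sub]
  have hs1 : Real.sin (1/T) ≤ 1/T := Real.sin_le hδ.le
  have hs2 : 2/Real.pi * (1/T) ≤ Real.sin (1/T) := Real.mul_le_sin hδ.le (by linarith [Real.pi_gt_three])
  have hs0 : 0 < Real.sin (1/T) := lt_of_lt_of_le (by positivity) hs2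
  have hcos : 1/2 ≤ Real.cos (1/T) := by
    have := Real.one_sub_sq_div_two_le_cos (x := 1/T)
    nlinarith
  have hκ : Real.pi * ω.re ≤ (1/H)^8 := by
    rw [hre, one_div_pow]
    have h1 : 1/T ≤ 1/(4 * H^8) := one_div_le_one_div_of_le (by positivity) hT
    have : 1/(4*H^8) = (1/4) * (1/H^8) := by rw [one_div_mul_one_div]
    have h3 : 0 < 1/H^8 := by positivity
    nlinarith [Real.pi_le_four]
  have := theta_ms a ha ha' ω (by rw [hre]; exact hs0) (by rw [hω]; exact Complex.norm_exp_ofReal_mul_I _)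
    (by rw [him]; exact hcos.trans (le_abs_self _)) H hH hκ T (2*T) (by linarith)
  refine this.trans ?_
  have hsq : 1 / Real.sqrt (Real.pi * ω.re) ≤ Real.sqrt T := by
    rw [div_le_iff₀ (Real.sqrt_pos.2 (by rw [hre]; positivity)), ← Real.sqrt_mul hT0.le]
    apply Real.one_le_sqrt.2
    rw [hre]
    have h5 : Real.pi * (2/Real.pi * (1/T)) = 2 * (1/T) := by field_simp
    have h6 := mul_le_mul_of_nonneg_left hs2 hpi.le
    rw [h5] at h6
    have h7 := mul_le_mul_of_nonneg_left h6 hT0.le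
    have h8 : T * (2 * (1/T)) = 2 := by field_simp
    linarith
  rw [div_eq_mul_one_div]
  have hH0 : 0 < H := by linarith
  gcongr


noncomputable def Ac (c : ℕ → ℝ) (b X : ℝ) : ℝ := ∑ n ∈ Finset.range ⌊X - b + 1⌋₊, c n

lemma mem_rg (b X : ℝ) (n : ℕ) : n ∈ Finset.range ⌊X - b + 1⌋₊ ↔ (n:ℝ) + b ≤ X := by
  rw [Finset.mem_range, ← Nat.succ_le_iff, Nat.le_floor_iff' (Nat.succ_ne_zero n)]
  push_cast
  constructor <;> intro h <;> linarith

noncomputable def rk (η x : ℝ) : ℂ := (Set.Ioc 1 (Real.exp η)).indicator (fun _ => ((1/η : ℝ) : ℂ)) x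

lemma rk_tsum (η : ℝ) (hη : 0 < η) (c : ℕ → ℝ) (b : ℝ) (hb : 0 < b) (y : ℝ) :
    ∑' n : ℕ, ((c n : ℝ) : ℂ) * rk η (((n:ℝ) + b) ^ 2 * Real.exp y)
      = (((1/η) * (Ac c b (Real.exp (-(y - η)/2)) - Ac c b (Real.exp (-y/2))) : ℝ) : ℂ) := by
  have hsub : Finset.range ⌊Real.exp (-y/2) - b + 1⌋₊ ⊆ Finset.range ⌊Real.exp (-(y-η)/2) - b + 1⌋₊ := by
    intro n; rw [mem_rg, mem_rg]; intro h
    exact h.trans (Real.exp_le_exp.2 (by linarith))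
  have key : ∀ n : ℕ, ∀ w : ℝ, ((n:ℝ) + b ≤ Real.exp (-w/2) ↔ ((n:ℝ)+b)^2 * Real.exp w ≤ 1) := by
    intro n w
    have h1 : Real.exp (-w/2) ^ 2 * Real.exp w = 1 := by
      rw [← Real.exp_nat_mul, ← Real.exp_add]; norm_num; ring
    rw [← h1, mul_le_mul_iff_left₀ (Real.exp_pos w), pow_le_pow_iff_left₀ (by positivity) (by positivity) two_ne_zero]
  have key2 : ∀ n : ℕ, ((n:ℝ)+b)^2 * Real.exp y ≤ Real.exp η ↔ (n:ℝ) + b ≤ Real.exp (-(y - η)/2) := by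
    intro n
    rw [key, Real.exp_sub, ← mul_div_assoc, div_le_one (Real.exp_pos _)]
  rw [tsum_eq_sum (s := Finset.range ⌊Real.exp (-(y-η)/2) - b + 1⌋₊)]
  · rw [← Finset.sum_sdiff hsub]
    rw [Finset.sum_eq_zero (s := Finset.range ⌊Real.exp (-y/2) - b + 1⌋₊), add_zero]
    · rw [Ac, Ac, ← Finset.sum_sdiff hsub, add_sub_cancel_right, Finset.mul_sum]
      push_cast
      refine Finset.sum_congr rfl fun n hn => ?_
      rw [Finset.mem_sdiff, mem_rg, mem_rg, key n y] at hn
      rw [rk, Set.indicator_of_mem]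
      · push_cast; ring
      · exact ⟨not_le.1 hn.2, (key2 n).2 hn.1⟩
    · intro n hn
      rw [mem_rg, key n y] at hn
      rw [rk, Set.indicator_of_notMem, mul_zero]
      exact fun h => absurd h.1 (not_lt.2 hn)
  · intro n hn
    rw [mem_rg, ← key2] at hn
    rw [rk, Set.indicator_of_notMem, mul_zero]
    exact fun h => hn h.2

noncomputable def Dl (a X : ℝ) : ℝ := Ac (fun _ => 1/2) (1 + a) X + (Ac (fun _ => 1/2) (1 + (1 - a)) X +
  Ac (fun n => Real.cos (2 * Real.pi * a * (n + 1))) 1 X)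

noncomputable def Nn (a X : ℝ) : ℝ := (⌊X - (1+a) + 1⌋₊ : ℝ) + ((⌊X - (1 + (1-a)) + 1⌋₊ : ℝ) + (⌊X - 1 + 1⌋₊ : ℝ))

lemma Ac_half (b X : ℝ) : Ac (fun _ => 1/2) b X = (⌊X - b + 1⌋₊ : ℝ)/2 := by
  rw [Ac]; simp; ring

lemma Ac_half_bd (b X : ℝ) (hb : 1 ≤ b) (hX : 0 ≤ X) : |Ac (fun _ => 1/2) b X - X/2| ≤ b := by
  rw [Ac_half]
  have h1 := Nat.lt_floor_add_one (X - b + 1)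
  have h2 : (⌊X - b + 1⌋₊ : ℝ) ≤ X := by
    by_cases h : 0 ≤ X - b + 1
    · exact (Nat.floor_le h).trans (by linarith)
    · rw [Nat.floor_of_nonpos (by linarith)]; simpa
  rw [abs_le]; constructor <;> linarith

lemma cos_sum_bd (a : ℝ) (ha : 0 < a) (ha' : a ≤ 1/2) : ∃ C : ℝ, ∀ N : ℕ,
    |∑ n ∈ Finset.range N, Real.cos (2 * Real.pi * a * (n + 1))| ≤ C := by
  set w : ℂ := cexp ((2 * Real.pi * a : ℝ) * I) with hw
  have hw1 : w ≠ 1 := by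
    intro h
    rw [hw, Complex.exp_eq_one_iff] at h
    obtain ⟨n, hn⟩ := h
    have h1 := congrArg Complex.im hn
    simp at h1
    have h2 : a = n := by
      have := Real.pi_pos
      have h3 : (2*Real.pi) * (a - n) = 0 := by linarith
      rcases mul_eq_zero.1 h3 with h | h
      · linarith
      · linarith
    rw [h2] at ha ha'
    have h4 : (0:ℤ) < n := by exact_mod_cast ha
    have h5 : (1:ℝ) ≤ n := by exact_mod_cast h4
    linarith
  have hwn : ‖w‖ = 1 := Complex.norm_exp_ofReal_mul_I _
  refine ⟨2 / ‖w - 1‖, fun N => ?_⟩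
  have e : ∑ n ∈ Finset.range N, Real.cos (2 * Real.pi * a * (n + 1)) = (w * ∑ n ∈ Finset.range N, w ^ n).re := by
    rw [Finset.mul_sum, Complex.re_sum]
    refine Finset.sum_congr rfl fun n _ => ?_
    rw [← pow_succ', hw, ← Complex.exp_nat_mul, ← Complex.exp_ofReal_mul_I_re]
    congr 2; push_cast; ring
  rw [e, geom_sum_eq hw1]
  refine (Complex.abs_re_le_norm _).trans ?_
  rw [norm_mul, hwn, one_mul, norm_div]
  gcongr
  refine (norm_sub_le _ _).trans ?_
  rw [norm_pow, hwn]; norm_num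

lemma Dl_bound (a : ℝ) (ha : 0 < a) (ha' : a ≤ 1/2) : ∃ C : ℝ, 1 ≤ C ∧ ∀ X : ℝ, 0 ≤ X → |Dl a X - X| ≤ C := by
  obtain ⟨C, hC⟩ := cos_sum_bd a ha ha'
  refine ⟨max 1 ((1+a) + ((1+(1-a)) + C)), le_max_left _ _, fun X hX => le_trans ?_ (le_max_right _ _)⟩
  have h1 := Ac_half_bd (1+a) X (by linarith) hX
  have h2 := Ac_half_bd (1+(1-a)) X (by linarith) hX
  have h3 : |Ac (fun n => Real.cos (2 * Real.pi * a * (n + 1))) 1 X| ≤ C := hC _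
  rw [Dl]
  rw [abs_le] at *
  constructor <;> linarith [h1.1, h1.2, h2.1, h2.2, h3.1, h3.2]

lemma Ac_diff (c : ℕ → ℝ) (hc : ∀ n, |c n| ≤ 1) (b X Y : ℝ) (h : X ≤ Y) :
    |Ac c b Y - Ac c b X| ≤ (⌊Y - b + 1⌋₊ : ℝ) - ⌊X - b + 1⌋₊ := by
  have hle : ⌊X - b + 1⌋₊ ≤ ⌊Y - b + 1⌋₊ := Nat.floor_mono (by linarith)
  rw [Ac, Ac, ← Finset.sum_Ico_eq_sub _ hle]
  refine (Finset.abs_sum_le_sum_abs _ _).trans ?_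
  refine (Finset.sum_le_sum fun n _ => hc n).trans ?_
  simp [Nat.cast_sub hle]

lemma Dl_diff (a X Y : ℝ) (h : X ≤ Y) : |Dl a Y - Dl a X| ≤ Nn a Y - Nn a X := by
  have h1 := Ac_diff (fun _ => 1/2) (fun _ => by norm_num [abs_of_pos]) (1+a) X Y h
  have h2 := Ac_diff (fun _ => 1/2) (fun _ => by norm_num [abs_of_pos]) (1+(1-a)) X Y h
  have h3 := Ac_diff (fun n => Real.cos (2 * Real.pi * a * (n + 1))) (fun _ => Real.abs_cos_le_one _) 1 X Y h
  rw [Dl, Dl, Nn, Nn]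
  rw [abs_le] at *
  constructor <;> linarith [h1.1, h1.2, h2.1, h2.2, h3.1, h3.2]

lemma Nn_mono (a : ℝ) : Monotone (Nn a) := by
  intro X Y h
  have := (abs_nonneg _).trans (Dl_diff a X Y h)
  linarith

lemma floor_le' (b X : ℝ) (hb : 1 ≤ b) (hX : 0 ≤ X) : (⌊X - b + 1⌋₊ : ℝ) ≤ X := by
  by_cases h : 0 ≤ X - b + 1
  · exact (Nat.floor_le h).trans (by linarith)
  · rw [Nat.floor_of_nonpos (by linarith)]; simpa

lemma Nn_le (a : ℝ) (ha : 0 < a) (ha' : a ≤ 1/2) (X : ℝ) (hX : 0 ≤ X) : Nn a X ≤ 3 * X := by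
  have h1 := floor_le' (1+a) X (by linarith) hX
  have h2 := floor_le' (1+(1-a)) X (by linarith) hX
  have h3 := floor_le' 1 X le_rfl hX
  rw [Nn]; linarith

lemma Nn_nonneg (a X : ℝ) : 0 ≤ Nn a X := by rw [Nn]; positivity

lemma Dl_zero (a : ℝ) (ha : 0 < a) (ha' : a ≤ 1/2) (X : ℝ) (hX : X < 1) : Dl a X = 0 := by
  have h : ∀ (c : ℕ → ℝ) (b : ℝ), 1 ≤ b → Ac c b X = 0 := by
    intro c b hb
    rw [Ac, (Nat.floor_eq_zero).2 (by linarith)]; simp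
  rw [Dl, h _ _ (by linarith), h _ _ (by linarith), h _ _ le_rfl]; simp

lemma Ac_meas (c : ℕ → ℝ) (b : ℝ) : Measurable (Ac c b) := by
  unfold Ac
  exact (measurable_from_nat (f := fun N => ∑ n ∈ Finset.range N, c n)).comp (Nat.measurable_floor.comp (by fun_prop))

lemma Dl_meas (a : ℝ) : Measurable (Dl a) := by
  unfold Dl
  exact (Ac_meas _ _).add ((Ac_meas _ _).add (Ac_meas _ _))


noncomputable def Re3 (a η y : ℝ) : ℝ := Dl a (Real.exp (-(y-η)/2)) - Dl a (Real.exp (-y/2)) - (Real.exp (η/2) - 1) * Real.exp (-y/2)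

noncomputable def f3 (a η y : ℝ) : ℝ := (1/η) * Re3 a η y * Real.exp (y/4)

lemma Re3_meas (a η : ℝ) : Measurable (Re3 a η) := by
  unfold Re3
  exact (((Dl_meas a).comp (by fun_prop)).sub ((Dl_meas a).comp (by fun_prop))).sub (by fun_prop)

lemma f3_meas (a η : ℝ) : Measurable (f3 a η) := by
  unfold f3
  exact ((Re3_meas a η).const_mul _).mul (by fun_prop)

lemma exp_sp (η y : ℝ) : Real.exp (-(y-η)/2) = Real.exp (η/2) * Real.exp (-y/2) := by
  rw [← Real.exp_add]; congr 1; ring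

lemma Re3_bd (a C η : ℝ) (h : ∀ X : ℝ, 0 ≤ X → |Dl a X - X| ≤ C) (y : ℝ) : |Re3 a η y| ≤ 2 * C := by
  have h1 := h (Real.exp (-(y-η)/2)) (by positivity)
  have h2 := h (Real.exp (-y/2)) (by positivity)
  rw [Re3]
  have e := exp_sp η y
  rw [abs_le] at *
  constructor <;> nlinarith [h1.1, h1.2, h2.1, h2.2]

lemma exp_half_sub (η : ℝ) (h0 : 0 < η) (h1 : η ≤ 1) : Real.exp (η/2) - 1 ≤ η := by
  have h := Real.exp_bound_div_one_sub_of_interval (x := η/2) (by linarith) (by linarith)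
  refine (sub_le_sub_right h 1).trans ?_
  rw [sub_le_iff_le_add, div_le_iff₀ (by linarith)]
  nlinarith

lemma Re3_bd2 (a η : ℝ) (h0 : 0 < η) (h1 : η ≤ 1) (y : ℝ) :
    |Re3 a η y| ≤ (Nn a (Real.exp (-(y-η)/2)) - Nn a (Real.exp (-y/2))) + η * Real.exp (-y/2) := by
  rw [Re3]
  refine (abs_sub _ _).trans (add_le_add (Dl_diff a _ _ (Real.exp_le_exp.2 (by linarith))) ?_)
  have : 0 ≤ Real.exp (η/2) - 1 := by have := Real.add_one_le_exp (η/2); linarith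
  rw [abs_of_nonneg (by positivity)]
  exact mul_le_mul_of_nonneg_right (exp_half_sub η h0 h1) (by positivity)

lemma mono_shift (g : ℝ → ℝ) (hg : Antitone g) (hg0 : ∀ y, 0 ≤ g y) (η u : ℝ) (h0 : 0 < η) :
    ∫ y in u..u+1, (g (y - η) - g y) ≤ η * g (u - η) := by
  have hi : ∀ p q, IntervalIntegrable g volume p q := fun p q => (hg.antitoneOn _).intervalIntegrable
  have hi2 : IntervalIntegrable (fun y => g (y - η)) volume u (u+1) :=
    Antitone.intervalIntegrable (fun x y h => hg (by linarith))
  rw [intervalIntegral.integral_sub hi2 (hi _ _), intervalIntegral.integral_comp_sub_right (fun y => g y),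
    intervalIntegral.integral_interval_sub_interval_comm (hi _ _) (hi _ _) (hi _ _)]
  have p1 : ∫ y in (u-η)..u, g y ≤ ∫ y in (u-η)..u, g (u-η) := by
    refine intervalIntegral.integral_mono_on (by linarith) (hi _ _) (by simp) fun y hy => hg hy.1
  have p2 : 0 ≤ ∫ y in (u+1-η)..(u+1), g y := intervalIntegral.integral_nonneg (by linarith) fun y _ => hg0 y
  rw [intervalIntegral.integral_const] at p1
  simp only [sub_sub_cancel, smul_eq_mul] at p1
  linarith

lemma f3_sq (a C η : ℝ) (h0 : 0 < η) (h1 : η ≤ 1) (hC : 1 ≤ C) (h : ∀ X : ℝ, 0 ≤ X → |Dl a X - X| ≤ C) (u y : ℝ) (hy : y ≤ u + 1) :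
    f3 a η y ^ 2 ≤ 2 * C / η^2 * Real.exp ((u+1)/2) * (Nn a (Real.exp (-(y-η)/2)) - Nn a (Real.exp (-y/2))) + 2 * C / η := by
  have b1 := Re3_bd a C η h y
  have b2 := Re3_bd2 a η h0 h1 y
  set d := Nn a (Real.exp (-(y-η)/2)) - Nn a (Real.exp (-y/2)) with hd
  have hd0 : 0 ≤ d := (abs_nonneg _).trans (Dl_diff a _ _ (Real.exp_le_exp.2 (by linarith)))
  have e : Real.exp (y/4)^2 = Real.exp (y/2) := by rw [← Real.exp_nat_mul]; congr 1; push_cast; ring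
  have e2 : Real.exp (y/2) * Real.exp (-y/2) = 1 := by rw [← Real.exp_add]; simp; ring
  have s1 : Re3 a η y ^ 2 ≤ 2 * C * (d + η * Real.exp (-y/2)) := by
    rw [← sq_abs, sq]
    exact mul_le_mul b1 b2 (abs_nonneg _) (by linarith)
  rw [f3, mul_pow, mul_pow, e]
  calc (1/η)^2 * Re3 a η y ^ 2 * Real.exp (y/2) ≤ (1/η)^2 * (2 * C * (d + η * Real.exp (-y/2))) * Real.exp (y/2) := by gcongr
    _ = 2 * C / η^2 * Real.exp (y/2) * d + 2 * C / η * (Real.exp (y/2) * Real.exp (-y/2)) := by field_simp; 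
    _ ≤ _ := by
      rw [e2, mul_one]
      have : Real.exp (y/2) ≤ Real.exp ((u+1)/2) := Real.exp_le_exp.2 (by linarith)
      gcongr

lemma f3_bdd (a C η : ℝ) (h0 : 0 < η) (hC : 1 ≤ C) (h : ∀ X : ℝ, 0 ≤ X → |Dl a X - X| ≤ C) (y : ℝ) :
    |f3 a η y| ≤ 2 * C / η * Real.exp (y/4) := by
  rw [f3, abs_mul, abs_mul, abs_of_pos (Real.exp_pos _), abs_of_pos (by positivity : 0 < 1/η)]
  have := Re3_bd a C η h y
  rw [show 2 * C / η = 1/η * (2*C) by ring]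
  gcongr

lemma f3_right (a : ℝ) (ha : 0 < a) (ha' : a ≤ 1/2) (η : ℝ) (h0 : 0 < η) (h1 : η ≤ 1) (y : ℝ) (hy : η < y) :
    |f3 a η y| ≤ Real.exp (-y/4) := by
  rw [f3, Re3, Dl_zero a ha ha' _ (by rw [Real.exp_lt_one_iff]; linarith), Dl_zero a ha ha' _ (by rw [Real.exp_lt_one_iff]; linarith)]
  have : 0 ≤ Real.exp (η/2) - 1 := by have := Real.add_one_le_exp (η/2); linarith
  have e : Real.exp (-y/4) = Real.exp (-y/2) * Real.exp (y/4) := by rw [← Real.exp_add]; congr 1; ring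
  rw [sub_self, zero_sub, abs_mul, abs_mul, abs_neg, abs_of_pos (Real.exp_pos _), abs_of_pos (by positivity : 0 < 1/η), e,
    abs_of_nonneg (by positivity), ← mul_assoc]
  refine mul_le_mul_of_nonneg_right ?_ (Real.exp_pos _).le
  refine mul_le_of_le_one_left (Real.exp_pos _).le ?_
  rw [one_div, inv_mul_le_iff₀ h0, mul_one]
  exact exp_half_sub η h0 h1

lemma sq_ii (g : ℝ → ℝ) (hm : Measurable g) (p q K : ℝ) (hpq : p ≤ q) (h : ∀ y, y ≤ q → |g y| ≤ K) :
    IntervalIntegrable (fun y => g y ^ 2) volume p q := by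
  rw [intervalIntegrable_iff_integrableOn_Ioc_of_le hpq]
  refine Measure.integrableOn_of_bounded (M := K^2) (by simp) (hm.pow_const 2).aestronglyMeasurable ?_
  refine (ae_restrict_iff' measurableSet_Ioc).2 (Filter.Eventually.of_forall fun y hy => ?_)
  rw [Real.norm_eq_abs, abs_pow]
  exact pow_le_pow_left₀ (abs_nonneg _) (h y hy.2) 2

lemma f3_ms (a : ℝ) (ha : 0 < a) (ha' : a ≤ 1/2) : ∃ K > (0:ℝ), ∀ η : ℝ, 0 < η → η ≤ 1 → ∀ u : ℝ,
    ∫ y in u..u+1, f3 a η y ^ 2 ≤ K / η := by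
  obtain ⟨C, hC, h⟩ := Dl_bound a ha ha'
  refine ⟨6 * C * Real.exp 1 + 2 * C, by positivity, fun η h0 h1 u => ?_⟩
  set g : ℝ → ℝ := fun y => Nn a (Real.exp (-y/2)) with hg
  have hga : Antitone g := fun x y hxy => Nn_mono a (Real.exp_le_exp.2 (by linarith))
  have hi : ∀ p q, IntervalIntegrable g volume p q := fun p q => (hga.antitoneOn _).intervalIntegrable
  have hi2 : IntervalIntegrable (fun y => g (y - η)) volume u (u+1) :=
    Antitone.intervalIntegrable (fun x y h => hga (by linarith))
  have m := mono_shift g hga (fun y => Nn_nonneg _ _) η u h0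
  have hK : IntervalIntegrable (fun y => 2 * C / η^2 * Real.exp ((u+1)/2) * (g (y - η) - g y)) volume u (u+1) :=
    (hi2.sub (hi _ _)).const_mul _
  have s1 : ∫ y in u..u+1, f3 a η y ^ 2 ≤ ∫ y in u..u+1, (2 * C / η^2 * Real.exp ((u+1)/2) * (g (y - η) - g y) + 2 * C / η) := by
    refine intervalIntegral.integral_mono_on (by linarith) ?_ (hK.add (by simp)) fun y hy => f3_sq a C η h0 h1 hC h u y hy.2
    refine sq_ii _ (f3_meas a η) _ _ (2 * C / η * Real.exp ((u+1)/4)) (by linarith) fun y hy => (f3_bdd a C η h0 hC h y).trans ?_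
    gcongr
  rw [intervalIntegral.integral_add hK (by simp), intervalIntegral.integral_const_mul, intervalIntegral.integral_const] at s1
  have hgu : g (u - η) ≤ 3 * Real.exp (-(u-η)/2) := Nn_le a ha ha' _ (by positivity)
  have e : Real.exp ((u+1)/2) * Real.exp (-(u-η)/2) ≤ Real.exp 1 := by
    rw [← Real.exp_add]; exact Real.exp_le_exp.2 (by linarith)
  refine s1.trans ?_
  simp only [add_sub_cancel_left, one_smul]
  calc _ ≤ 2 * C / η^2 * Real.exp ((u+1)/2) * (η * (3 * Real.exp (-(u-η)/2))) + 2 * C / η := by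
        gcongr; exact m.trans (by gcongr)
    _ = 6 * C / η * (Real.exp ((u+1)/2) * Real.exp (-(u-η)/2)) + 2 * C / η := by field_simp; ring
    _ ≤ 6 * C / η * Real.exp 1 + 2 * C / η := by gcongr
    _ = _ := by ring


lemma rk_exp (η : ℝ) (y : ℝ) : rk η (Real.exp y) = (Set.Ioc 0 η).indicator (fun _ => ((1/η : ℝ) : ℂ)) y := by
  unfold rk
  by_cases h : y ∈ Set.Ioc 0 η
  · rw [Set.indicator_of_mem h, Set.indicator_of_mem]
    exact ⟨Real.one_lt_exp_iff.2 h.1, Real.exp_le_exp.2 h.2⟩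
  · rw [Set.indicator_of_notMem h, Set.indicator_of_notMem]
    exact fun h' => h ⟨Real.one_lt_exp_iff.1 h'.1, Real.exp_le_exp.1 h'.2⟩

lemma rk_mellin (η : ℝ) (hη : 0 < η) (z : ℂ) (hz : z ≠ 0) : mellin (rk η) z = (cexp (η * z) - 1) / (η * z) := by
  rw [mellin_exp_form]
  have : (fun y : ℝ => rk η (Real.exp y) * cexp (z * y)) = (Set.Ioc 0 η).indicator (fun y : ℝ => ((1/η : ℝ) : ℂ) * cexp (z * y)) := by
    ext y
    rw [rk_exp]
    by_cases h : y ∈ Set.Ioc 0 η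
    · rw [Set.indicator_of_mem h, Set.indicator_of_mem h]
    · rw [Set.indicator_of_notMem h, Set.indicator_of_notMem h, zero_mul]
  rw [this, integral_indicator measurableSet_Ioc, ← intervalIntegral.integral_of_le hη.le, intervalIntegral.integral_const_mul,
    integral_exp_mul_complex hz]
  have : (η:ℂ) ≠ 0 := by exact_mod_cast hη.ne'
  push_cast
  field_simp
  simp [mul_comm]

lemma rk_conv (η : ℝ) (z : ℂ) : MellinConvergent (rk η) z := by
  unfold MellinConvergent
  have : (fun t : ℝ => (t:ℂ) ^ (z - 1) • rk η t) = (Set.Ioc 1 (Real.exp η)).indicator (fun t : ℝ => (t:ℂ) ^ (z - 1) * ((1/η : ℝ) : ℂ)) := by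
    ext t
    unfold rk
    by_cases h : t ∈ Set.Ioc 1 (Real.exp η)
    · rw [Set.indicator_of_mem h, Set.indicator_of_mem h, smul_eq_mul]
    · rw [Set.indicator_of_notMem h, Set.indicator_of_notMem h, smul_zero]
  rw [this]
  refine Integrable.integrableOn ?_
  rw [integrable_indicator_iff measurableSet_Ioc]
  refine IntegrableOn.mono_set (t := Set.Icc 1 (Real.exp η)) (ContinuousOn.integrableOn_Icc ?_) Set.Ioc_subset_Icc_self
  intro t ht
  have ht0 : (0:ℝ) < t := by linarith [ht.1]
  refine ContinuousAt.continuousWithinAt ?_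
  refine ContinuousAt.mul ?_ continuousAt_const
  exact (Complex.continuousAt_ofReal_cpow_const _ _ (Or.inr ht0.ne'))

lemma rk_summ (η : ℝ) (b : ℝ) (hb : 0 < b) (x : ℝ) (hx : 0 < x) :
    Summable (fun n : ℕ => ‖rk η (((n:ℝ) + b) ^ 2 * x)‖) := by
  obtain ⟨N, hN⟩ := exists_nat_gt (Real.exp η / x)
  refine summable_of_ne_finset_zero (s := Finset.range N) fun n hn => ?_
  rw [Finset.mem_range, not_lt] at hn
  rw [norm_eq_zero, rk, Set.indicator_of_notMem]
  intro h
  have h2 := h.2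
  rw [← le_div_iff₀ hx] at h2
  have h0 : 0 < Real.exp η / x := by positivity
  have hn' : (N:ℝ) ≤ n := by exact_mod_cast hn
  have hN0 : (0:ℝ) < N := by linarith
  have hN1 : (1:ℝ) ≤ N := by exact_mod_cast (by exact_mod_cast hN0 : 0 < N)
  nlinarith

noncomputable def ffam (a η x : ℝ) : ℂ := (∑' n : ℕ, (((fun _ : ℕ => (1/2:ℝ)) n : ℝ) : ℂ) * rk η (((n:ℝ) + (1+a)) ^ 2 * x)) +
      ((∑' n : ℕ, (((fun _ : ℕ => (1/2:ℝ)) n : ℝ) : ℂ) * rk η (((n:ℝ) + (1+(1-a))) ^ 2 * x)) +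
        ∑' n : ℕ, (((fun n : ℕ => Real.cos (2 * Real.pi * a * (n + 1))) n : ℝ) : ℂ) * rk η (((n:ℝ) + 1) ^ 2 * x))

lemma ffam_exp (a : ℝ) (ha : 0 < a) (ha' : a ≤ 1/2) (η : ℝ) (hη : 0 < η) (y : ℝ) : ffam a η (Real.exp y) =
    (((1/η) * (Dl a (Real.exp (-(y-η)/2)) - Dl a (Real.exp (-y/2))) : ℝ) : ℂ) := by
  rw [ffam, rk_tsum η hη _ _ (by linarith), rk_tsum η hη _ _ (by linarith), rk_tsum η hη _ _ (by linarith), Dl, Dl]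
  push_cast; ring

noncomputable def M3 (a : ℝ) (s : ℂ) : ℂ := ((a:ℂ)^(-s) + ((1 - a : ℝ):ℂ)^(-s))/2

lemma ffam_mellin (a : ℝ) (ha : 0 < a) (ha' : a ≤ 1/2) (η : ℝ) (hη : 0 < η) (z : ℂ) (hz : 1/2 < z.re) :
    mellin (ffam a η) z = (cexp (η * z) - 1) / (η * z) * (Qzeta (2*z) a - M3 a (2*z)) := by
  have hs : 1 < (2*z).re := by simp; linarith
  have hz0 : z ≠ 0 := by rintro rfl; norm_num at hz
  have p := (hasSum_pz a (2*z) hs).mul_left (1/2:ℂ)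
  have k := three_mellin (rk η) z hz (rk_conv η z) (fun b hb x hx => rk_summ η b hb x hx)
    (fun n => (((fun _ : ℕ => (1/2:ℝ)) n : ℝ) : ℂ)) (fun n => (((fun _ : ℕ => (1/2:ℝ)) n : ℝ) : ℂ))
    (fun n => (((fun n : ℕ => Real.cos (2 * Real.pi * a * (n + 1))) n : ℝ) : ℂ)) 1
    (fun n => by rw [Complex.norm_real]; norm_num) (fun n => by rw [Complex.norm_real]; norm_num)
    (fun n => by rw [Complex.norm_real]; exact Real.abs_cos_le_one _) (1+a) (1+(1-a)) 1 (by linarith) (by linarith) one_pos _ _ _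
    (hasSum_hz_tail a ha (by linarith) (2*z) hs _) (hasSum_hz_tail (1-a) (by linarith) (by linarith) (2*z) hs _)
    (p.congr_fun fun n => by push_cast; ring)
  change mellin (ffam a η) z = _ at k
  rw [k, rk_mellin η hη z hz0, M3, Qzeta]
  push_cast; ring


lemma ffam_sub (a : ℝ) (ha : 0 < a) (ha' : a ≤ 1/2) (η : ℝ) (hη : 0 < η) (y : ℝ) :
    ffam a η (Real.exp y) - (((Real.exp (η/2) - 1)/η : ℝ) : ℂ) * ((Real.exp y : ℝ) : ℂ) ^ (-(1/2) : ℂ) = (((1/η) * Re3 a η y : ℝ) : ℂ) := by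
  have e : ((Real.exp y : ℝ) : ℂ) ^ (-(1/2) : ℂ) = ((Real.exp (-y/2) : ℝ) : ℂ) := by
    have : (-(1/2) : ℂ) = ((-(1/2) : ℝ) : ℂ) := by push_cast; rfl
    rw [this, ← Complex.ofReal_cpow (Real.exp_pos y).le, ← Real.exp_mul]
    congr 2; ring
  rw [ffam_exp a ha ha' η hη, e, Re3]
  push_cast; ring

lemma ffam_loc (a : ℝ) (ha : 0 < a) (ha' : a ≤ 1/2) (η : ℝ) (hη : 0 < η) :
    LocallyIntegrableOn (ffam a η) (Set.Ioi 0) := by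
  obtain ⟨C, hC, h⟩ := Dl_bound a ha ha'
  have h1 : LocallyIntegrable (fun x : ℝ => (((1/η) * Re3 a η (Real.log x) : ℝ) : ℂ)) := by
    refine (locallyIntegrable_const (1/η * (2 * C))).mono ?_ (Filter.Eventually.of_forall fun x => ?_)
    · refine Measurable.aestronglyMeasurable ?_
      exact Complex.measurable_ofReal.comp (((Re3_meas a η).comp Real.measurable_log).const_mul _)
    · rw [Complex.norm_real, norm_mul, norm_mul]
      have := Re3_bd a C η h (Real.log x)
      rw [Real.norm_eq_abs (Re3 _ _ _), Real.norm_eq_abs (2*C)]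
      exact mul_le_mul_of_nonneg_left (this.trans (le_abs_self _)) (norm_nonneg _)
  have h2 := (h1.locallyIntegrableOn (Set.Ioi 0)).add (locint_cpow (((Real.exp (η/2) - 1)/η : ℝ) : ℂ) (-(1/2) : ℂ))
  refine h2.congr ((ae_restrict_iff' measurableSet_Ioi).2 (Filter.Eventually.of_forall fun x hx => ?_))
  have hx0 : (0:ℝ) < x := hx
  have k := ffam_sub a ha ha' η hη (Real.log x)
  rw [Real.exp_log hx0] at k
  simp only [Pi.add_apply]
  rw [← k]; ring

lemma perron_mellin (a : ℝ) (ha : 0 < a) (ha' : a ≤ 1/2) (η : ℝ) (hη : 0 < η) (z : ℂ) (h0 : 0 < z.re) (h1 : z.re < 1/2) (h2 : 0 < z.im) :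
    HasMellin (fun x => ffam a η x - (((Real.exp (η/2) - 1)/η : ℝ) : ℂ) * (x:ℂ) ^ (-(1/2) : ℂ)) z
      ((cexp (η * z) - 1) / (η * z) * (Qzeta (2*z) a - M3 a (2*z))) := by
  obtain ⟨C, hC, h⟩ := Dl_bound a ha ha'
  refine cont_mellin (ffam a η) _ (fun z => (cexp (η * z) - 1) / (η * z) * (Qzeta (2*z) a - M3 a (2*z)))
    (ffam_loc a ha ha' η hη) ?_ ?_ ?_ ?_ z h0 h1 h2
  · intro R
    refine Filter.EventuallyEq.trans_isBigO (f₂ := fun _ => (0:ℂ)) ?_ (Asymptotics.isBigO_zero _ _)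
    filter_upwards [Filter.eventually_gt_atTop (Real.exp η)] with x hx
    have hx0 : 0 < x := (Real.exp_pos _).trans hx
    have hl : η < Real.log x := (Real.lt_log_iff_exp_lt hx0).2 hx
    rw [← Real.exp_log hx0, ffam_exp a ha ha' η hη, Dl_zero a ha ha' _ (by rw [Real.exp_lt_one_iff]; linarith), Dl_zero a ha ha' _ (by rw [Real.exp_lt_one_iff]; linarith)]
    simp
  · refine Asymptotics.IsBigO.of_bound (1/η * (2 * C)) ?_
    filter_upwards [self_mem_nhdsWithin] with x hx
    have hx0 : (0:ℝ) < x := hx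
    rw [← Real.exp_log hx0, ffam_sub a ha ha' η hη, Complex.norm_real, norm_mul, Real.norm_of_nonneg (by positivity), norm_one, mul_one]
    exact mul_le_mul_of_nonneg_left (Re3_bd a C η h _) (by positivity)
  · intro z hz
    have hre : 0 < z.re := by rcases hz with hz | hz <;> linarith [hz]
    have hz0 : z ≠ 0 := by rintro rfl; simp at hre
    have hη0 : (η:ℂ) ≠ 0 := by exact_mod_cast hη.ne'
    refine DifferentiableAt.mul (DifferentiableAt.div (by fun_prop) (by fun_prop) (mul_ne_zero hη0 hz0)) ((diff_Q2 a z hz).sub ?_)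
    unfold M3
    have e1 : (a:ℂ) ≠ 0 := by exact_mod_cast ha.ne'
    have e2 : ((1 - a : ℝ):ℂ) ≠ 0 := by exact_mod_cast (by linarith : (0:ℝ) < 1 - a).ne'
    refine DifferentiableAt.div_const (DifferentiableAt.add ?_ ?_) _
    · exact DifferentiableAt.const_cpow (by fun_prop) (Or.inl e1)
    · exact DifferentiableAt.const_cpow (by fun_prop) (Or.inl e2)
  · intro z hz
    exact (ffam_mellin a ha ha' η hη z hz).symm

lemma f3_form (a : ℝ) (ha : 0 < a) (ha' : a ≤ 1/2) (η : ℝ) (hη : 0 < η) (v y : ℝ) :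
    (ffam a η (Real.exp y) - (((Real.exp (η/2) - 1)/η : ℝ) : ℂ) * ((Real.exp y : ℝ) : ℂ) ^ (-(1/2) : ℂ)) * cexp ((1/4 + v * I) * y)
      = (f3 a η y : ℂ) * cexp (I * v * y) := by
  rw [ffam_sub a ha ha' η hη, f3]
  have : cexp ((1/4 + v * I) * y) = ((Real.exp (y/4) : ℝ) : ℂ) * cexp (I * v * y) := by
    push_cast
    rw [← Complex.exp_add]; congr 1; ring
  rw [this]; push_cast; ring

lemma perron_id (a : ℝ) (ha : 0 < a) (ha' : a ≤ 1/2) (η : ℝ) (hη : 0 < η) (v : ℝ) (hv : 0 < v) :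
    ∫ y : ℝ, (f3 a η y : ℂ) * cexp (I * v * y) =
      (cexp (η * (1/4 + v * I)) - 1) / (η * (1/4 + v * I)) * (Qzeta (2*(1/4 + v * I)) a - M3 a (2*(1/4 + v * I))) := by
  have h := (perron_mellin a ha ha' η hη (1/4 + v * I) (by simp) (by simp; norm_num) (by simpa)).2
  rw [mellin_exp_form] at h
  rw [← h]
  refine integral_congr_ae (Filter.Eventually.of_forall fun y => ?_)
  exact (f3_form a ha ha' η hη v y).symm

lemma f3_int (a : ℝ) (ha : 0 < a) (ha' : a ≤ 1/2) (η : ℝ) (hη : 0 < η) : Integrable (fun y => (f3 a η y : ℂ)) := by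
  have h := (perron_mellin a ha ha' η hη (1/4 + (1:ℝ) * I) (by simp) (by simp; norm_num) (by simp)).1
  have h' := mellinConvergent_exp_form _ _ h
  refine h'.mono ((Complex.measurable_ofReal.comp (f3_meas a η)).aestronglyMeasurable) (Filter.Eventually.of_forall fun y => ?_)
  have := f3_form a ha ha' η hη 1 y
  rw [this, norm_mul]
  have e : I * (1:ℝ) * y = ((y:ℝ):ℂ) * I := by push_cast; ring
  rw [e, Complex.norm_exp_ofReal_mul_I, mul_one]

lemma f3_int2 (a : ℝ) (ha : 0 < a) (ha' : a ≤ 1/2) (η : ℝ) (hη : 0 < η) (hη1 : η ≤ 1) : Integrable (fun y => ‖(f3 a η y : ℂ)‖^2) := by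
  obtain ⟨C, hC, h⟩ := Dl_bound a ha ha'
  have hi := (f3_int a ha ha' η hη).norm
  set K := 2 * C / η * Real.exp 1 + 1
  have hb : ∀ y, ‖(f3 a η y : ℂ)‖ ≤ K := by
    intro y
    rw [Complex.norm_real, Real.norm_eq_abs]
    by_cases hy : η < y
    · refine (f3_right a ha ha' η hη hη1 y hy).trans ?_
      have : Real.exp (-y/4) ≤ 1 := Real.exp_le_one_iff.2 (by linarith)
      have : 0 ≤ 2 * C / η * Real.exp 1 := by positivity
      linarith
    · refine (f3_bdd a C η hη hC h y).trans ?_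
      have : Real.exp (y/4) ≤ Real.exp 1 := Real.exp_le_exp.2 (by linarith)
      have : 2 * C / η * Real.exp (y/4) ≤ 2 * C / η * Real.exp 1 := by gcongr
      linarith
  refine (hi.const_mul K).mono (((Complex.measurable_ofReal.comp (f3_meas a η)).norm.pow_const 2).aestronglyMeasurable) (Filter.Eventually.of_forall fun y => ?_)
  rw [Real.norm_of_nonneg (by positivity), Real.norm_eq_abs]
  refine le_trans ?_ (le_abs_self _)
  rw [sq]
  exact mul_le_mul_of_nonneg_right (hb y) (norm_nonneg _)


noncomputable def ft (a η y : ℝ) : ℂ := (f3 a η (y + -2 * Real.log a) : ℂ)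

lemma log_half_le (a : ℝ) (ha : 0 < a) (ha' : a ≤ 1/2) : 1.38 ≤ -2 * Real.log a := by
  have h := Real.log_le_log ha ha'
  rw [one_div, Real.log_inv] at h
  have := Real.log_two_gt_d9
  linarith

lemma ft_near (a : ℝ) (ha : 0 < a) (ha' : a ≤ 1/2) (η : ℝ) (h0 : 0 < η) (h1 : η ≤ 1/4) (y : ℝ) (hy : -1 ≤ y) : ‖ft a η y‖ ≤ 1 := by
  have hl := log_half_le a ha ha'
  rw [ft, Complex.norm_real, Real.norm_eq_abs]
  refine (f3_right a ha ha' η h0 (by linarith) _ (by linarith)).trans (Real.exp_le_one_iff.2 (by linarith))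

lemma perron_ms (a : ℝ) (ha : 0 < a) (ha' : a ≤ 1/2) : ∃ C > (0:ℝ), ∀ η : ℝ, 0 < η → η ≤ 1/4 → ∀ H : ℝ, 0 ≤ H → ∀ A B : ℝ, A ≤ B →
    ∫ t in A..B, ‖∫ v in t..t + H, ∫ y, ft a η y * cexp (I * v * y)‖ ^ 2 ≤ C * (H^2 + 1/η) := by
  obtain ⟨K, hK, h⟩ := f3_ms a ha ha'
  have hpi := Real.pi_pos
  refine ⟨4 * Real.pi * (1 + 8 * K), by positivity, fun η h0 h1 H hH A B hAB => ?_⟩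
  have hn : ∀ y, ‖ft a η y‖^2 = f3 a η (y + -2 * Real.log a) ^ 2 := by
    intro y; rw [ft, Complex.norm_real, Real.norm_eq_abs, sq_abs]
  have i1 : Integrable (ft a η) := (f3_int a ha ha' η h0).comp_add_right _
  have i2 : Integrable (fun y => ‖ft a η y‖^2) := (f3_int2 a ha ha' η h0 (by linarith)).comp_add_right (-2 * Real.log a)
  have p := planchW (ft a η) i1 i2 A B hAB H 1 1 (K/η) hH one_pos (by positivity) ?_ ?_ ?_ ?_
  · refine p.trans ?_
    have : 0 ≤ 4 * Real.pi * (8 * K * H^2 + 1/η) := by positivity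
    have e : 4 * Real.pi * (1 + 8 * K) * (H^2 + 1/η) = 4 * Real.pi * (H^2 * 1 + 8/1^2 * (K/η)) + 4 * Real.pi * (8 * K * H^2 + 1/η) := by
      field_simp; ring
    rw [e]; linarith
  · refine (le_abs_self _).trans ?_
    have := intervalIntegral.norm_integral_le_of_norm_le_const (a := 0) (b := 1) (C := 1) (f := fun y => ‖ft a η y‖^2) (fun y hy => by
      rw [Set.uIoc_of_le zero_le_one] at hy
      rw [norm_pow, norm_norm]
      exact pow_le_one₀ (norm_nonneg _) (ft_near a ha ha' η h0 h1 y (by linarith [hy.1])))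
    simpa using this
  · intro k
    simp only [hn, mul_one]
    rw [intervalIntegral.integral_comp_add_right (fun y => f3 a η y ^ 2)]
    have := h η h0 (by linarith) ((k:ℝ) + 1 + -2 * Real.log a)
    refine le_trans (le_of_eq ?_) this
    congr 1; ring
  · refine (le_abs_self _).trans ?_
    have := intervalIntegral.norm_integral_le_of_norm_le_const (a := 0) (b := 1) (C := 1) (f := fun y => ‖ft a η (-y)‖^2) (fun y hy => by
      rw [Set.uIoc_of_le zero_le_one] at hy
      rw [norm_pow, norm_norm]
      exact pow_le_one₀ (norm_nonneg _) (ft_near a ha ha' η h0 h1 (-y) (by linarith [hy.2])))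
    simpa using this
  · intro k
    simp only [hn, mul_one]
    have e : ∀ y : ℝ, -y + -2 * Real.log a = -2 * Real.log a - y := fun y => by ring
    simp only [e]
    rw [intervalIntegral.integral_comp_sub_left (fun y => f3 a η y ^ 2)]
    have := h η h0 (by linarith) (-2 * Real.log a - ((k:ℝ) + 2))
    refine le_trans (le_of_eq ?_) this
    congr 1; ring

lemma ft_id (a : ℝ) (ha : 0 < a) (ha' : a ≤ 1/2) (η : ℝ) (hη : 0 < η) (v : ℝ) (hv : 0 < v) :
    ∫ y : ℝ, ft a η y * cexp (I * v * y) = cexp (2 * v * Real.log a * I) * (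
      (cexp (η * (1/4 + v * I)) - 1) / (η * (1/4 + v * I)) * (Qzeta (2*(1/4 + v * I)) a - M3 a (2*(1/4 + v * I)))) := by
  rw [← perron_id a ha ha' η hη v hv, ← integral_const_mul]
  rw [← integral_add_right_eq_self (fun y : ℝ => cexp (2 * v * Real.log a * I) * ((f3 a η y : ℂ) * cexp (I * v * y))) (-2 * Real.log a)]
  refine integral_congr_ae (Filter.Eventually.of_forall fun y => ?_)
  simp only [ft]
  rw [mul_left_comm, ← Complex.exp_add]
  congr 2; push_cast; ring

lemma rt_near (w : ℂ) (hw0 : w ≠ 0) (δ : ℝ) (hw : ‖w‖ ≤ δ) (hδ : δ ≤ 1) : ‖(cexp w - 1)/w - 1‖ ≤ δ := by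
  have h := Complex.norm_exp_sub_one_sub_id_le (x := w) (hw.trans hδ)
  have e : (cexp w - 1)/w - 1 = (cexp w - 1 - w)/w := by field_simp
  rw [e, norm_div, div_le_iff₀ (norm_pos_iff.2 hw0)]
  refine h.trans ?_
  rw [sq]; gcongr

lemma cpow_form (b : ℝ) (hb : 0 < b) (v : ℝ) : (b:ℂ) ^ (-(2*(1/4 + v * I)) : ℂ) = ((b^(-(1/2):ℝ) : ℝ) : ℂ) * cexp (-(2 * v * Real.log b) * I) := by
  have hb0 : (b:ℂ) ≠ 0 := by exact_mod_cast hb.ne'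
  rw [Complex.cpow_def_of_ne_zero hb0, Real.rpow_def_of_pos hb, ← Complex.ofReal_log hb.le]
  push_cast
  rw [← Complex.exp_add]; congr 1; ring

lemma uM_form (a : ℝ) (ha : 0 < a) (ha' : a ≤ 1/2) (v : ℝ) : cexp (2 * v * Real.log a * I) * M3 a (2*(1/4 + v * I)) =
    ((a^(-(1/2):ℝ)/2 : ℝ) : ℂ) + (((1-a)^(-(1/2):ℝ)/2 : ℝ) : ℂ) * cexp (((2 * (Real.log a - Real.log (1-a)) : ℝ) * I) * v) := by
  rw [M3, cpow_form a ha, cpow_form (1-a) (by linarith)]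
  have e1 : cexp (-(2 * v * Real.log a) * I) = (cexp (2 * v * Real.log a * I))⁻¹ := by rw [← Complex.exp_neg]; congr 1; ring
  have e2 : cexp (((2 * (Real.log a - Real.log (1-a)) : ℝ) * I) * v) = cexp (2 * v * Real.log a * I) * cexp (-(2 * v * Real.log (1-a)) * I) := by
    rw [← Complex.exp_add]; congr 1; push_cast; ring
  have := Complex.exp_ne_zero (2 * v * Real.log a * I)
  rw [e1, e2]; push_cast
  field_simp

lemma uM_int (a : ℝ) (ha : 0 < a) (ha' : a ≤ 1/2) : ∃ C : ℝ, ∀ H : ℝ, 0 ≤ H → ∀ t : ℝ,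
    a^(-(1/2):ℝ)/2 * H - C ≤ ‖∫ v in t..t+H, cexp (2 * v * Real.log a * I) * M3 a (2*(1/4 + v * I))‖ := by
  simp only [uM_form a ha ha']
  set θ : ℝ := 2 * (Real.log a - Real.log (1-a)) with hθ
  set A : ℝ := a^(-(1/2):ℝ)/2 with hA
  set B : ℝ := (1-a)^(-(1/2):ℝ)/2 with hB
  have hA0 : 0 ≤ A := by positivity
  have hB0 : 0 ≤ B := by have : 0 < 1 - a := by linarith
                         positivity
  by_cases h : θ = 0
  · refine ⟨0, fun H hH t => ?_⟩
    simp only [h]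
    simp only [ofReal_zero, zero_mul, Complex.exp_zero, mul_one]
    rw [intervalIntegral.integral_const, ← Complex.ofReal_add]
    rw [add_sub_cancel_left, norm_smul, Complex.norm_real, Real.norm_of_nonneg hH, Real.norm_of_nonneg (by positivity)]
    nlinarith
  · have hc : ((θ:ℝ) * I : ℂ) ≠ 0 := by simp [h]
    refine ⟨B * (2 / |θ|), fun H hH t => ?_⟩
    rw [intervalIntegral.integral_add (by simp) (Continuous.intervalIntegrable (by fun_prop) _ _), intervalIntegral.integral_const,
      intervalIntegral.integral_const_mul, integral_exp_mul_complex hc, add_sub_cancel_left]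
    have n1 : ‖H • (A:ℂ)‖ = A * H := by
      rw [norm_smul, Complex.norm_real, Real.norm_of_nonneg hH, Real.norm_of_nonneg hA0, mul_comm]
    have n2 : ‖(B:ℂ) * ((cexp (θ * I * ((t+H : ℝ):ℂ)) - cexp (θ * I * t)) / (θ * I))‖ ≤ B * (2/|θ|) := by
      rw [norm_mul, Complex.norm_real, Real.norm_of_nonneg hB0, norm_div, norm_mul, Complex.norm_I, mul_one, Complex.norm_real, Real.norm_eq_abs]
      gcongr
      refine (norm_sub_le _ _).trans ?_
      have e : ∀ s : ℝ, ‖cexp (θ * I * s)‖ = 1 := by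
        intro s
        have := Complex.norm_exp_ofReal_mul_I (θ * s)
        rw [← this]; congr 2; push_cast; ring
      rw [e, e]; norm_num
    have := norm_sub_norm_le (H • (A:ℂ)) (-((B:ℂ) * ((cexp (θ * I * ((t+H : ℝ):ℂ)) - cexp (θ * I * t)) / (θ * I))))
    rw [sub_neg_eq_add, norm_neg, n1] at this
    linarith

lemma uM_norm (a : ℝ) (ha : 0 < a) (ha' : a ≤ 1/2) (v : ℝ) : ‖M3 a (2*(1/4 + v * I))‖ ≤ a^(-(1/2):ℝ) := by
  have hb : 0 < 1 - a := by linarith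
  rw [M3, cpow_form a ha, cpow_form (1-a) hb]
  have e : ∀ s : ℝ, ‖cexp (-(2 * v * s) * I)‖ = 1 := by
    intro s
    have := Complex.norm_exp_ofReal_mul_I (-(2*v*s))
    rw [← this]; congr 2; push_cast; ring
  rw [norm_div]
  have h1 := norm_add_le (((a^(-(1/2):ℝ) : ℝ) : ℂ) * cexp (-(2 * v * Real.log a) * I)) ((((1-a)^(-(1/2):ℝ) : ℝ) : ℂ) * cexp (-(2 * v * Real.log (1-a)) * I))
  rw [norm_mul, norm_mul, e, e, Complex.norm_real, Complex.norm_real, Real.norm_of_nonneg (by positivity), Real.norm_of_nonneg (by positivity)] at h1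
  have h2 : (1-a)^(-(1/2):ℝ) ≤ a^(-(1/2):ℝ) := Real.rpow_le_rpow_of_nonpos ha (by linarith) (by norm_num)
  rw [Complex.norm_ofNat, div_le_iff₀ (by norm_num)]
  linarith


lemma Q_cont (a : ℝ) : Continuous (fun v : ℝ => Qzeta (1/2 + (2*v : ℝ) * I) a) := by
  refine continuous_iff_continuousAt.2 fun v => ?_
  refine ContinuousAt.comp (f := fun v : ℝ => (1/2 + (2*v : ℝ) * I : ℂ)) (g := fun s => Qzeta s a) (diff_Q a _ ?_).continuousAt (by fun_prop)
  intro h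
  have := congrArg Complex.re h
  norm_num at this

lemma Q_lower (a : ℝ) (ha : 0 < a) (ha' : a ≤ 1/2) : ∃ c > (0:ℝ), ∃ C : ℝ, ∀ T : ℝ, 1 ≤ T → ∀ t, T ≤ t → t ≤ 2*T → ∀ H, 0 ≤ H → H ≤ T →
    c * H - C - ‖∫ v in t..t+H, ∫ y, ft a (1/(16*T)) y * cexp (I * v * y)‖ ≤ 2 * ∫ v in t..t+H, ‖Qzeta (1/2 + (2*v : ℝ) * I) a‖ := by
  obtain ⟨C, hC⟩ := uM_int a ha ha'
  have hA : 0 < a^(-(1/2):ℝ) := by positivity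
  refine ⟨a^(-(1/2):ℝ)/4, by positivity, C, fun T hT t ht ht' H hH hHT => ?_⟩
  set η := 1/(16*T) with hη
  have hη0 : 0 < η := by positivity
  set q : ℝ → ℂ := fun v => Qzeta (1/2 + (2*v : ℝ) * I) a with hq
  have hqc : Continuous q := Q_cont a
  set m : ℝ → ℂ := fun v => cexp (2 * v * Real.log a * I) * M3 a (2*(1/4 + v * I)) with hm
  have hmc : Continuous m := by
    have : m = fun v : ℝ => ((a^(-(1/2):ℝ)/2 : ℝ) : ℂ) + (((1-a)^(-(1/2):ℝ)/2 : ℝ) : ℂ) * cexp (((2 * (Real.log a - Real.log (1-a)) : ℝ) * I) * v) := by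
      ext v; exact uM_form a ha ha' v
    rw [this]; fun_prop
  set u : ℝ → ℂ := fun v => cexp (2 * v * Real.log a * I) with hu
  have huc : Continuous u := by rw [hu]; fun_prop
  have hun : ∀ v, ‖u v‖ = 1 := by
    intro v
    have := Complex.norm_exp_ofReal_mul_I (2*v*Real.log a)
    rw [← this]; simp only [hu]; congr 2; push_cast; ring
  set r : ℝ → ℂ := fun v => (cexp (η * (1/4 + v * I)) - 1) / (η * (1/4 + v * I)) with hr
  have hz : ∀ v : ℝ, (η:ℂ) * (1/4 + v * I) ≠ 0 := by
    intro v h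
    have := congrArg Complex.re h
    simp at this; exact hη0.ne' this
  have hrc : Continuous r := by
    rw [hr]; exact Continuous.div (by fun_prop) (by fun_prop) hz
  have hrn : ∀ v ∈ Set.Icc t (t+H), ‖r v - 1‖ ≤ 1/4 := by
    intro v hv
    refine rt_near _ (hz v) _ ?_ (by norm_num)
    rw [norm_mul, Complex.norm_real, Real.norm_of_nonneg hη0.le]
    have h1 : ‖(1/4 + v * I : ℂ)‖ ≤ 1/4 + v := by
      refine (norm_add_le _ _).trans ?_
      rw [norm_mul, Complex.norm_I, Complex.norm_real, Real.norm_of_nonneg (by linarith [hv.1])]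
      norm_num
    have h2 : ‖(1/4 + v * I : ℂ)‖ ≤ 4 * T := by linarith [hv.2]
    calc η * ‖(1/4 + v * I : ℂ)‖ ≤ η * (4 * T) := by gcongr
      _ = 1/4 := by rw [hη]; field_simp; norm_num
  have hF : ∫ v in t..t+H, ∫ y, ft a η y * cexp (I * v * y) = ∫ v in t..t+H, r v * (u v * q v - m v) := by
    refine intervalIntegral.integral_congr fun v hv => ?_
    rw [Set.uIcc_of_le (by linarith)] at hv
    rw [ft_id a ha ha' η hη0 v (by linarith [hv.1])]
    have : (2*(1/4 + v * I) : ℂ) = 1/2 + (2*v : ℝ) * I := by push_cast; ring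
    simp only [hr, hu, hm, hq]
    rw [← this]; ring
  rw [hF]
  have hM := hC H hH t
  change _ ≤ ‖∫ v in t..t+H, m v‖ at hM
  have hsplit : ∫ v in t..t+H, m v = (∫ v in t..t+H, r v * (u v * q v)) - (∫ v in t..t+H, r v * (u v * q v - m v)) - ∫ v in t..t+H, (r v - 1) * m v := by
    rw [← intervalIntegral.integral_sub (Continuous.intervalIntegrable (by fun_prop) _ _) (Continuous.intervalIntegrable (by fun_prop) _ _),
      ← intervalIntegral.integral_sub (Continuous.intervalIntegrable (by fun_prop) _ _) (Continuous.intervalIntegrable (by fun_prop) _ _)]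
    congr 1; ext v; ring
  have b1 : ‖∫ v in t..t+H, (r v - 1) * m v‖ ≤ 1/4 * a^(-(1/2):ℝ) * H := by
    have := intervalIntegral.norm_integral_le_of_norm_le_const (a := t) (b := t+H) (C := 1/4 * a^(-(1/2):ℝ)) (f := fun v => (r v - 1) * m v) (fun v hv => by
      rw [Set.uIoc_of_le (by linarith)] at hv
      rw [norm_mul]
      refine mul_le_mul (hrn v ⟨hv.1.le, hv.2⟩) ?_ (norm_nonneg _) (by norm_num)
      change ‖u v * _‖ ≤ _
      rw [norm_mul, hun, one_mul]
      exact uM_norm a ha ha' v)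
    rwa [add_sub_cancel_left, abs_of_nonneg hH] at this
  have b2 : ‖∫ v in t..t+H, r v * (u v * q v)‖ ≤ ∫ v in t..t+H, 2 * ‖q v‖ := by
    refine intervalIntegral.norm_integral_le_of_norm_le (by linarith) (Filter.Eventually.of_forall fun v hv => ?_) (Continuous.intervalIntegrable (by fun_prop) _ _)
    rw [norm_mul, norm_mul, hun, one_mul]
    have h1 := hrn v ⟨hv.1.le, hv.2⟩
    have h2 : ‖r v‖ ≤ 2 := by
      have := norm_add_le (r v - 1) 1
      rw [sub_add_cancel, norm_one] at this
      linarith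
    gcongr
  rw [intervalIntegral.integral_const_mul] at b2
  have b3 : ‖∫ v in t..t+H, m v‖ ≤ ‖∫ v in t..t+H, r v * (u v * q v)‖ + ‖∫ v in t..t+H, r v * (u v * q v - m v)‖ + ‖∫ v in t..t+H, (r v - 1) * m v‖ := by
    rw [hsplit]
    exact (norm_sub_le _ _).trans (add_le_add_left (norm_sub_le _ _) _)
  linarith


lemma cont_ftF (a : ℝ) (ha : 0 < a) (ha' : a ≤ 1/2) (η : ℝ) (hη : 0 < η) :
    Continuous (fun v : ℝ => ∫ y : ℝ, ft a η y * cexp (I * v * y)) := by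
  have hi : Integrable (ft a η) := (f3_int a ha ha' η hη).comp_add_right _
  refine continuous_of_dominated (bound := fun y => ‖ft a η y‖) ?_ ?_ hi.norm ?_
  · intro v
    exact hi.aestronglyMeasurable.mul (Continuous.aestronglyMeasurable (by fun_prop))
  · intro v
    refine Filter.Eventually.of_forall fun y => ?_
    have : ‖cexp (I * v * y)‖ = 1 := by rw [Complex.norm_exp]; simp
    rw [norm_mul, this, mul_one]
  · refine Filter.Eventually.of_forall fun y => ?_
    fun_prop

lemma cont_window (g : ℝ → ℂ) (hg : Continuous g) (H : ℝ) : Continuous (fun t => ∫ v in t..t+H, g v) := by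
  have e : (fun t => ∫ v in t..t+H, g v) = fun t => (∫ v in (0:ℝ)..t+H, g v) - ∫ v in (0:ℝ)..t, g v := by
    ext t
    rw [intervalIntegral.integral_interval_sub_left (hg.intervalIntegrable _ _) (hg.intervalIntegrable _ _)]
  rw [e]
  have h : Continuous (fun t => ∫ v in (0:ℝ)..t, g v) := intervalIntegral.continuous_primitive (fun p q => hg.intervalIntegrable p q) 0
  exact (h.comp (by fun_prop : Continuous fun t : ℝ => t + H)).sub h

lemma choose_H (c c3 C3 C1 C2 : ℝ) (hc : 0 < c) (hc3 : 0 < c3) (h1 : 0 < C1) (h2 : 0 < C2) :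
    ∃ H : ℝ, 1 ≤ H ∧ 0 ≤ c3 * H - C3 ∧ 2 * C1 * H + 9 * c^2 * C2 < c^2/8 * (c3 * H - C3)^2 := by
  set D := 32 * (2 * C1 + 9 * c^2 * C2) / (c^2 * c3^2) with hD
  have hD0 : 0 < D := by positivity
  set H := 1 + 2 * |C3| / c3 + D with hH
  have e1 : 0 ≤ 2 * |C3| / c3 := by positivity
  have hH1 : 1 ≤ H := by linarith
  have hHD : D < H := by linarith
  have hHC : 2 * |C3| ≤ c3 * H := by
    have : 2 * |C3| / c3 ≤ H := by linarith
    rw [div_le_iff₀ hc3] at this; linarith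
  have h3 := le_abs_self C3
  have h3' := abs_nonneg C3
  refine ⟨H, hH1, by linarith, ?_⟩
  have k1 : (c3 * H / 2)^2 ≤ (c3 * H - C3)^2 := pow_le_pow_left₀ (by positivity) (by linarith) 2
  have k2 : 32 * (2 * C1 + 9 * c^2 * C2) < H * (c^2 * c3^2) := by
    rwa [hD, div_lt_iff₀ (by positivity)] at hHD
  have k3 : c^2/8 * (c3 * H / 2)^2 ≤ c^2/8 * (c3 * H - C3)^2 := by gcongr
  refine lt_of_lt_of_le ?_ k3
  have k4 : 9 * c^2 * C2 ≤ 9 * c^2 * C2 * H := le_mul_of_one_le_right (by positivity) hH1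
  have k5 := mul_lt_mul_of_pos_right k2 (by linarith : 0 < H)
  nlinarith

lemma core (a : ℝ) (ha : 0 < a) (ha' : a ≤ 1/2) : ∃ H : ℝ, 1 ≤ H ∧ ∃ T₀ : ℝ, 1 ≤ T₀ ∧ ∀ T, T₀ ≤ T → H ≤ T ∧
    ∀ S : Set ℝ, MeasurableSet S → S ⊆ Set.Icc T (2*T) → T/2 ≤ volume.real S →
      (∀ t ∈ S, ‖∫ v in t..t+H, Fth a (cexp ((Real.pi/2 - 1/T : ℝ) * I)) v‖ = ∫ v in t..t+H, Real.exp ((Real.pi/2 - 1/T) * v) * |Rr a v|) → False := by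
  obtain ⟨c, hc, hlow⟩ := F_lower a ha ha'
  obtain ⟨c3, hc3, C3, hQ⟩ := Q_lower a ha ha'
  obtain ⟨C1, hC1, hth⟩ := theta_T a ha ha'
  obtain ⟨C2, hC2, hpe⟩ := perron_ms a ha ha'
  obtain ⟨H, hH1, hH2, hH3⟩ := choose_H c c3 C3 C1 C2 hc hc3 hC1 hC2
  have hH8 : H^2 ≤ H^8 := pow_le_pow_right₀ hH1 (by norm_num)
  have hH12 : H ≤ H^2 := by nlinarith
  refine ⟨H, hH1, 4 * H^8, by linarith, fun T hT => ⟨by linarith, fun S hSm hS hvol heq => ?_⟩⟩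
  have hT1 : 1 ≤ T := by linarith
  have hT0 : 0 < T := by linarith
  set φ : ℝ := Real.pi/2 - 1/T with hφ
  have hT1' : 1/T ≤ 1 := by rw [div_le_one hT0]; exact hT1
  have hTp : 0 < 1/T := by positivity
  have hre : 0 < (cexp (φ * I)).re := by
    rw [Complex.exp_ofReal_mul_I_re]
    exact Real.cos_pos_of_mem_Ioo ⟨by linarith [Real.pi_gt_three], by linarith⟩
  set Iw : ℝ → ℂ := fun t => ∫ v in t..t+H, Fth a (cexp (φ * I)) v with hIw
  set Ps : ℝ → ℂ := fun t => ∫ v in t..t+H, ∫ y, ft a (1/(16*T)) y * cexp (I * v * y) with hPs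
  have hIc : Continuous Iw := cont_window _ (cont_Fth a ha ha' _ hre) H
  have hPc : Continuous Ps := cont_window _ (cont_ftF a ha ha' _ (by positivity)) H
  have m1 := hth H hH1 T hT
  have m2 := hpe (1/(16*T)) (by positivity) (by rw [div_le_div_iff₀ (by positivity) (by norm_num)]; linarith) H (by linarith) T (2*T) (by linarith)
  change ∫ t in T..2*T, ‖Iw t‖^2 ≤ _ at m1
  change ∫ t in T..2*T, ‖Ps t‖^2 ≤ _ at m2
  set α : ℝ := c * T^(-(1/4):ℝ) / 2 with hα
  have hα0 : 0 < α := by positivity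
  have hα2 : α^2 * Real.sqrt T = c^2/4 := by
    rw [hα, div_pow, mul_pow, ← Real.rpow_natCast (T^(-(1/4):ℝ)), ← Real.rpow_mul hT0.le, Real.sqrt_eq_rpow]
    have : T^(-(1/4) * ((2:ℕ):ℝ)) * T^(1/2:ℝ) = 1 := by rw [← Real.rpow_add hT0]; norm_num
    linear_combination c^2/4 * this
  have pt : ∀ t ∈ S, (α * (c3 * H - C3))^2 ≤ 2 * ‖Iw t‖^2 + 2 * α^2 * ‖Ps t‖^2 := by
    intro t ht
    have htI := hS ht
    have q := hQ T hT1 t htI.1 htI.2 H (by linarith) (by linarith)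
    change c3 * H - C3 - ‖Ps t‖ ≤ _ at q
    have j : c * T^(-(1/4):ℝ) * ∫ v in t..t+H, ‖Qzeta (1/2 + (2*v : ℝ) * I) a‖ ≤ ‖Iw t‖ := by
      rw [hIw]; simp only
      rw [heq t ht, ← intervalIntegral.integral_const_mul]
      refine intervalIntegral.integral_mono_on (by linarith) ?_ ?_ fun v hv => hlow T hT1 v (by linarith [hv.1, htI.1]) (by linarith [hv.2, htI.2])
      · exact Continuous.intervalIntegrable (continuous_const.mul (Q_cont a).norm) _ _
      · have := cont_Rr a ha ha'
        exact Continuous.intervalIntegrable (by fun_prop) _ _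
    have k : α * (c3 * H - C3) ≤ ‖Iw t‖ + α * ‖Ps t‖ := by
      have := mul_le_mul_of_nonneg_left q hα0.le
      have e : α * (2 * ∫ v in t..t+H, ‖Qzeta (1/2 + (2*v : ℝ) * I) a‖) = c * T^(-(1/4):ℝ) * ∫ v in t..t+H, ‖Qzeta (1/2 + (2*v : ℝ) * I) a‖ := by
        rw [hα]; ring
      rw [e] at this
      linarith
    have k0 : 0 ≤ α * (c3 * H - C3) := by positivity
    have k2 := pow_le_pow_left₀ k0 k 2
    nlinarith [sq_nonneg (‖Iw t‖ - α * ‖Ps t‖)]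
  have hcon : Continuous (fun t => 2 * ‖Iw t‖^2 + 2 * α^2 * ‖Ps t‖^2) := by fun_prop
  have hint : IntegrableOn (fun t => 2 * ‖Iw t‖^2 + 2 * α^2 * ‖Ps t‖^2) (Set.Icc T (2*T)) := hcon.integrableOn_Icc
  have hfin : volume S ≠ ⊤ := ne_top_of_le_ne_top (by simp) (measure_mono hS)
  have I1 : volume.real S * (α * (c3 * H - C3))^2 ≤ ∫ t in S, (2 * ‖Iw t‖^2 + 2 * α^2 * ‖Ps t‖^2) := by
    rw [← smul_eq_mul, ← setIntegral_const]
    exact setIntegral_mono_on (integrableOn_const hfin) (hint.mono_set hS) hSm pt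
  have I2 : ∫ t in S, (2 * ‖Iw t‖^2 + 2 * α^2 * ‖Ps t‖^2) ≤ ∫ t in T..2*T, (2 * ‖Iw t‖^2 + 2 * α^2 * ‖Ps t‖^2) := by
    rw [intervalIntegral.integral_of_le (by linarith), ← integral_Icc_eq_integral_Ioc]
    exact setIntegral_mono_set hint (Filter.Eventually.of_forall fun t => by positivity) hS.eventuallyLE
  rw [intervalIntegral.integral_add (Continuous.intervalIntegrable (by fun_prop) _ _) (Continuous.intervalIntegrable (by fun_prop) _ _),
    intervalIntegral.integral_const_mul, intervalIntegral.integral_const_mul] at I2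
  have e16 : 1/(1/(16*T)) = 16 * T := by field_simp
  rw [e16] at m2
  have I3 : T/2 * (α * (c3 * H - C3))^2 ≤ 2 * (C1 * H * Real.sqrt T) + 2 * α^2 * (C2 * (17 * T)) := by
    have a1 : T/2 * (α * (c3 * H - C3))^2 ≤ volume.real S * (α * (c3 * H - C3))^2 := by gcongr
    have a2 : 2 * α^2 * ∫ t in T..2*T, ‖Ps t‖^2 ≤ 2 * α^2 * (C2 * (17 * T)) := by
      have : C2 * (H^2 + 16 * T) ≤ C2 * (17 * T) := by gcongr; linarith
      have := m2.trans this
      gcongr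
    linarith
  have hs0 : 0 < Real.sqrt T := Real.sqrt_pos.2 hT0
  have hs2 : Real.sqrt T * Real.sqrt T = T := Real.mul_self_sqrt hT0.le
  have I4 := mul_le_mul_of_nonneg_right I3 hs0.le
  have e1 : T/2 * (α * (c3 * H - C3))^2 * Real.sqrt T = T * (c^2/8 * (c3 * H - C3)^2) := by
    linear_combination T/2 * (c3 * H - C3)^2 * hα2
  have e2 : (2 * (C1 * H * Real.sqrt T) + 2 * α^2 * (C2 * (17 * T))) * Real.sqrt T = T * (2 * C1 * H + 17/2 * c^2 * C2) := by
    linear_combination 2 * C1 * H * hs2 + 2 * C2 * 17 * T * hα2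
  rw [e1, e2] at I4
  have I5 := le_of_mul_le_mul_left I4 hT0
  have : 0 < c^2 * C2 := by positivity
  linarith


lemma Q_not_zero (a : ℝ) (ha : 0 < a) (ha' : a ≤ 1/2) : ¬ ∀ v : ℝ, 0 < v → Qzeta (1/2 + (2*v : ℝ) * I) a = 0 := by
  intro h
  obtain ⟨H, hH1, T₀, hT₀, hcore⟩ := core a ha ha'
  obtain ⟨hHT, k⟩ := hcore T₀ le_rfl
  have hT0 : 0 < T₀ := by linarith
  have hT1' : 1/T₀ ≤ 1 := by rw [div_le_one hT0]; exact hT₀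
  have hTp : 0 < 1/T₀ := by positivity
  refine k (Set.Icc T₀ (2*T₀)) measurableSet_Icc le_rfl ?_ fun t ht => ?_
  · rw [Real.volume_real_Icc_of_le (by linarith)]; linarith
  · have hR : ∀ v : ℝ, 0 < v → Rr a v = 0 := fun v hv => (Rr_zero_iff a ha ha' v hv).2 (h v hv)
    have e1 : ∫ v in t..t+H, Fth a (cexp ((Real.pi/2 - 1/T₀ : ℝ) * I)) v = ∫ v in t..t+H, (0:ℂ) := by
      refine intervalIntegral.integral_congr fun v hv => ?_
      rw [Set.uIcc_of_le (by linarith)] at hv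
      have hv0 : 0 < v := by linarith [hv.1, ht.1]
      have := F_norm a ha ha' (Real.pi/2 - 1/T₀) (by linarith [Real.pi_gt_three]) (by linarith) v hv0
      rw [hR v hv0, abs_zero, mul_zero, norm_eq_zero] at this
      exact this
    have e2 : ∫ v in t..t+H, Real.exp ((Real.pi/2 - 1/T₀) * v) * |Rr a v| = ∫ v in t..t+H, (0:ℝ) := by
      refine intervalIntegral.integral_congr fun v hv => ?_
      rw [Set.uIcc_of_le (by linarith)] at hv
      have hv0 : 0 < v := by linarith [hv.1, ht.1]
      simp only [hR v hv0, abs_zero, mul_zero]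
    rw [e1, e2]; simp

lemma zeros_finite (a : ℝ) (ha : 0 < a) (ha' : a ≤ 1/2) (T : ℝ) :
    {t : ℝ | 0 ≤ t ∧ t ≤ T ∧ Qzeta (1 / 2 + t * Complex.I) a = 0}.Finite := by
  by_contra hinf
  obtain ⟨t₀, ht₀, hacc⟩ := Set.Infinite.exists_accPt_of_subset_isCompact (K := Set.Icc 0 T) hinf isCompact_Icc (fun t ht => ⟨ht.1, ht.2.1⟩)
  rw [accPt_iff_frequently_nhdsNE] at hacc
  set U : Set ℂ := {s | s.re < 1} with hU
  have hUo : IsOpen U := isOpen_lt Complex.continuous_re continuous_const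
  have hUc : IsPreconnected U := (convex_halfSpace_re_lt 1).isPreconnected
  have han : AnalyticOnNhd ℂ (fun s => Qzeta s a) U := by
    refine DifferentiableOn.analyticOnNhd (fun s hs => (diff_Q a s ?_).differentiableWithinAt) hUo
    rintro rfl
    simp [hU] at hs
  have htend : Filter.Tendsto (fun t : ℝ => (1/2 + t * I : ℂ)) (nhdsWithin t₀ {t₀}ᶜ) (nhdsWithin (1/2 + t₀ * I : ℂ) {(1/2 + t₀ * I : ℂ)}ᶜ) := by
    refine tendsto_nhdsWithin_of_tendsto_nhds_of_eventually_within _ ?_ ?_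
    · exact (Continuous.tendsto (by fun_prop) t₀).mono_left nhdsWithin_le_nhds
    · filter_upwards [self_mem_nhdsWithin] with t ht h
      apply ht
      have := congrArg Complex.im h
      simpa using this
  have hfr : ∃ᶠ s in nhdsWithin (1/2 + t₀ * I : ℂ) {(1/2 + t₀ * I : ℂ)}ᶜ, Qzeta s a = 0 :=
    htend.frequently (hacc.mono fun t ht => ht.2.2)
  have hz := han.eqOn_zero_of_preconnected_of_frequently_eq_zero hUc (z₀ := (1/2 + t₀ * I : ℂ)) (by simp [hU]; norm_num) hfr
  refine Q_not_zero a ha ha' fun v _ => hz ?_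
  simp [hU]; norm_num

lemma many_zeros (a : ℝ) (ha : 0 < a) (ha' : a ≤ 1/2) : ∃ H : ℝ, 1 ≤ H ∧ ∃ T₀ : ℝ, 1 ≤ T₀ ∧ ∀ T, T₀ ≤ T →
    ∀ Z : Finset ℝ, (∀ v, T ≤ v → v ≤ 3*T → Rr a v = 0 → v ∈ Z) → T / (2*H) < Z.card := by
  obtain ⟨H, hH1, T₀, hT₀, hcore⟩ := core a ha ha'
  refine ⟨H, hH1, T₀, hT₀, fun T hT Z hZ => ?_⟩
  obtain ⟨hHT, k⟩ := hcore T hT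
  have hT0 : 0 < T := by linarith
  have hT1' : 1/T ≤ 1 := by rw [div_le_one hT0]; linarith
  have hTp : 0 < 1/T := by positivity
  by_contra hcon
  rw [not_lt, le_div_iff₀ (by linarith)] at hcon
  set B : Set ℝ := ⋃ z ∈ Z, Set.Icc (z - H) z with hB
  have hBm : MeasurableSet B := Finset.measurableSet_biUnion Z fun z _ => measurableSet_Icc
  refine k (Set.Icc T (2*T) \ B) (measurableSet_Icc.diff hBm) Set.sdiff_subset ?_ fun t ht => ?_
  · have hBfin : volume B ≠ ⊤ := by
      refine ((measure_biUnion_finset_le Z _).trans_lt ?_).ne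
      exact ENNReal.sum_lt_top.2 fun z _ => by simp
    have h1 : volume.real B ≤ Z.card * H := by
      refine (measureReal_biUnion_finset_le Z _).trans ?_
      have : ∀ z ∈ Z, volume.real (Set.Icc (z - H) z) = H := fun z _ => by
        rw [Real.volume_real_Icc_of_le (by linarith)]; ring
      rw [Finset.sum_congr rfl this]; simp
    have h2 := le_measureReal_sdiff (μ := volume) (s₁ := Set.Icc T (2*T)) (s₂ := B) hBfin
    rw [Real.volume_real_Icc_of_le (by linarith)] at h2
    linarith
  · refine F_const a ha ha' _ (by linarith [Real.pi_gt_three]) (by linarith) t (t+H) (by linarith [ht.1.1]) (by linarith) fun v hv hR => ht.2 ?_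
    have hvZ := hZ v (by linarith [hv.1, ht.1.1]) (by linarith [hv.2, ht.1.2]) hR
    rw [hB]
    simp only [Set.mem_iUnion]
    exact ⟨v, hvZ, by linarith [hv.2], hv.1⟩

/-- For every `0 < a ≤ 1/2` there are positive constants `A(a)`, `T₀(a)` such that for `T ≥ T₀(a)`
the number of zeros of `Q(·,a)` on the segment from `1/2` to `1/2 + iT` exceeds `A(a) T`. -/
theorem quadrilateral_zeros_on_critical_line (a : ℝ) (ha : 0 < a) (ha' : a ≤ 1 / 2) :
    ∃ A > (0 : ℝ), ∃ T₀ > (0 : ℝ), ∀ T : ℝ, T₀ ≤ T →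
      A * T < ({t : ℝ | 0 ≤ t ∧ t ≤ T ∧ Qzeta (1 / 2 + t * Complex.I) a = 0}.ncard : ℝ) := by
  obtain ⟨H, hH1, T₀, hT₀, h⟩ := many_zeros a ha ha'
  refine ⟨1/(12*H), by positivity, 6*T₀, by linarith, fun T hT => ?_⟩
  have hfin := zeros_finite a ha ha' T
  have k := h (T/6) (by linarith) (hfin.toFinset.image (fun t => t/2)) (fun v hv1 hv2 hR => by
    rw [Finset.mem_image]
    refine ⟨2*v, ?_, by ring⟩
    rw [Set.Finite.mem_toFinset]
    exact ⟨by linarith, by linarith, (Rr_zero_iff a ha ha' v (by linarith)).1 hR⟩)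
  rw [Set.ncard_eq_toFinset_card _ hfin]
  have c1 : ((hfin.toFinset.image (fun t => t/2)).card : ℝ) ≤ hfin.toFinset.card := by exact_mod_cast Finset.card_image_le
  calc 1/(12*H) * T = T/6/(2*H) := by field_simp; ring
    _ < _ := k.trans_le c1
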